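/- Let A_0, A_0', A_1, ..., A_n be nonempty finite subsets of a lattice M of rank n, and F_0, F_0', F_1, ..., F_n the general Laurent polynomials with these supports. Then Res_{A_0 + A_0', A_1, ..., A_n}(F_0 F_0', F_1, ..., F_n) = ± Res_{A_0, A_1, ..., A_n}(F_0, F_1, ..., F_n) * Res_{A_0', A_1, ..., A_n}(F_0', F_1, ..., F_n), where A_0 + A_0' is the Minkowski sum of supports and F_0 F_0' is supported in A_0 + A_0'. -/

import Mathlib

open Pointwise MeasureTheory

noncomputable section

variable {n : ℕ}

/-- Evaluation of the character `χ^a` at a point `ξ` of the torus `(ℂˣ)^n`. -/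
def chEval (ξ : Fin n → ℂˣ) (a : Fin n → ℤ) : ℂ :=
  ∏ j, ((ξ j ^ (a j) : ℂˣ) : ℂ)

/-- `ξ` is a common root of the Laurent polynomials with supports `A i` and
coefficients `c i`. -/
def IsRootOf (A : Fin (n + 1) → Finset (Fin n → ℤ))
    (c : Fin (n + 1) → (Fin n → ℤ) → ℂ) (ξ : Fin n → ℂˣ) : Prop :=
  ∀ i, ∑ a ∈ A i, c i a * chEval ξ a = 0

/-- The family with supports `A` and coefficients `c` has a common root in the torus. -/
def HasRoot (A : Fin (n + 1) → Finset (Fin n → ℤ))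
    (c : Fin (n + 1) → (Fin n → ℤ) → ℂ) : Prop :=
  ∃ ξ, IsRootOf A c ξ

/-- Evaluation of an integer polynomial in the coefficient variables `u_{i,a}` at a
family of complex coefficients. -/
def evalCoeff (R : MvPolynomial (Fin (n + 1) × (Fin n → ℤ)) ℤ)
    (c : Fin (n + 1) → (Fin n → ℤ) → ℂ) : ℂ :=
  MvPolynomial.aeval (fun p => c p.1 p.2) R

/-- `E` is the sparse eliminant of the family of supports `A`. -/
def IsEliminant (A : Fin (n + 1) → Finset (Fin n → ℤ))
    (E : MvPolynomial (Fin (n + 1) × (Fin n → ℤ)) ℤ) : Prop :=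
  (Irreducible E ∧ {c | evalCoeff E c = 0} = closure {c | HasRoot A c})
  ∨ (E = 1 ∧ ∀ E' : MvPolynomial (Fin (n + 1) × (Fin n → ℤ)) ℤ,
      ¬ (Irreducible E' ∧ {c | evalCoeff E' c = 0} = closure {c | HasRoot A c}))

/-- `R` is the sparse resultant of the family of supports `A`: up to sign the power
`E^d` of the sparse eliminant, where `d` is the degree of the projection from the
incidence variety (the number of common roots of a generic coefficient family in the
vanishing locus). -/
def IsResultant (A : Fin (n + 1) → Finset (Fin n → ℤ))
    (R : MvPolynomial (Fin (n + 1) × (Fin n → ℤ)) ℤ) : Prop :=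
  ∃ E d, IsEliminant A E ∧ (R = E ^ d ∨ R = -E ^ d) ∧
    ∃ U : Set (Fin (n + 1) → (Fin n → ℤ) → ℂ), IsOpen U ∧
      closure (U ∩ {c | HasRoot A c}) = closure {c | HasRoot A c} ∧
      ∀ c ∈ U ∩ {c | HasRoot A c}, Nat.card {ξ // IsRootOf A c ξ} = d

/-- The partial degree of `R` in the group of variables `u_i = (u_{i,a})_a`. -/
def groupDeg (i : Fin (n + 1)) (R : MvPolynomial (Fin (n + 1) × (Fin n → ℤ)) ℤ) : ℕ :=
  R.support.sup fun m => ∑ p ∈ m.support.filter (fun p => p.1 = i), m p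

/-- Mixed volume (inclusion-exclusion formula, normalized by `MV(Q,…,Q) = k! vol Q`),
with the convention `MV = 1` for `k = 0`. -/
def mixedVolume (k : ℕ) {ι : Type*} [Fintype ι] (Q : ι → Set (Fin k → ℝ)) : ℝ :=
  if k = 0 then 1 else
    ∑ s ∈ (Finset.univ : Finset ι).powerset,
      if s.Nonempty then
        (-1 : ℝ) ^ (Fintype.card ι - s.card) * (volume (∑ i ∈ s, Q i)).toReal
      else 0

/-- The coordinatewise cast `ℤ^n → ℝ^n`. -/
def castR (n : ℕ) (x : Fin n → ℤ) : Fin n → ℝ := fun j => (x j : ℝ)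


/-- The coefficients of the product `F_0 F_0'` of two Laurent polynomials with supports
`A_0`, `A_0'` and coefficients `c_0`, `c_0'`: the coefficient of `χ^a` is
`∑_{b + b' = a} c_0(b) c_0'(b')`.  It is supported on the Minkowski sum `A_0 + A_0'`. -/
def prodCoeff (A0 A0' : Finset (Fin n → ℤ)) (c0 c0' : (Fin n → ℤ) → ℂ) :
    (Fin n → ℤ) → ℂ :=
  fun a => ∑ b ∈ A0, c0 b * (if a - b ∈ A0' then c0' (a - b) else 0)

open Cardinal in
theorem exists_ringEquiv_comp_eq {S K L : Type} [CommRing S] [IsDomain S] [Countable S]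
    [Field K] [Field L] [IsAlgClosed K] [IsAlgClosed L] (i : S →+* K) (j : S →+* L)
    (hi : Function.Injective i) (hj : Function.Injective j) (hK : ℵ₀ < #K) (hKL : #K = #L) :
    ∃ σ : K ≃+* L, ∀ s, σ (i s) = j s := by
  let := i.toAlgebra
  let := j.toAlgebra
  have : FaithfulSMul S K := (faithfulSMul_iff_algebraMap_injective S K).2 hi
  have : FaithfulSMul S L := (faithfulSMul_iff_algebraMap_injective S L).2 hj
  obtain ⟨s, hs⟩ := exists_isTranscendenceBasis S K
  obtain ⟨t, ht⟩ := exists_isTranscendenceBasis S L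
  have h1 := IsAlgClosed.cardinal_eq_cardinal_transcendence_basis_of_aleph0_lt' _ hs
    Cardinal.mk_le_aleph0 hK
  have h2 := IsAlgClosed.cardinal_eq_cardinal_transcendence_basis_of_aleph0_lt' _ ht
    Cardinal.mk_le_aleph0 (hKL ▸ hK)
  obtain ⟨e⟩ := Cardinal.eq.1 (h1.symm.trans (hKL.trans h2))
  let := IsAlgClosed.isAlgClosure_of_transcendence_basis _ hs
  let := IsAlgClosed.isAlgClosure_of_transcendence_basis _ ht
  let f := (hs.1.aevalEquiv.symm.trans (MvPolynomial.renameEquiv S e)).trans ht.1.aevalEquiv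
  refine ⟨IsAlgClosure.equivOfEquiv K L f.toRingEquiv, fun x => ?_⟩
  change IsAlgClosure.equivOfEquiv K L f.toRingEquiv (algebraMap S K x) = algebraMap S L x
  rw [IsScalarTower.algebraMap_apply S (Algebra.adjoin S (Set.range ((↑) : s → K))) K,
    IsAlgClosure.equivOfEquiv_algebraMap,
    IsScalarTower.algebraMap_apply S (Algebra.adjoin S (Set.range ((↑) : t → L))) L]
  congr 1
  exact f.commutes x

theorem MvPolynomial.countable {ι D : Type} [CommRing D] [Countable D] [Countable ι] :
    Countable (MvPolynomial ι D) := by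
  rw [← Cardinal.mk_le_aleph0_iff]
  refine MvPolynomial.cardinalMk_le_max.trans ?_
  simp

theorem exists_algEquiv_apply_eq {D : Type} [CommRing D] [Countable D] [Algebra D ℂ]
    {ι : Type} [Countable ι] (x y : ι → ℂ)
    (h : ∀ p : MvPolynomial ι D, MvPolynomial.aeval x p = 0 ↔ MvPolynomial.aeval y p = 0) :
    ∃ σ : ℂ ≃ₐ[D] ℂ, ∀ i, σ (x i) = y i := by
  let f := MvPolynomial.aeval (R := D) x
  let g := MvPolynomial.aeval (R := D) y
  have : (RingHom.ker f).IsPrime := RingHom.ker_isPrime f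
  have := MvPolynomial.countable (ι := ι) (D := D)
  have : Countable (MvPolynomial ι D ⧸ RingHom.ker f) :=
    Ideal.Quotient.mk_surjective.countable
  obtain ⟨σ, hσ⟩ := exists_ringEquiv_comp_eq
    (Ideal.Quotient.lift (RingHom.ker f) f.toRingHom fun a ha => ha)
    (Ideal.Quotient.lift (RingHom.ker f) g.toRingHom fun a ha => (h a).1 ha)
    (by
      rw [injective_iff_map_eq_zero]
      intro a
      obtain ⟨a, rfl⟩ := Ideal.Quotient.mk_surjective a
      exact fun ha => Ideal.Quotient.eq_zero_iff_mem.2 ha)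
    (by
      rw [injective_iff_map_eq_zero]
      intro a
      obtain ⟨a, rfl⟩ := Ideal.Quotient.mk_surjective a
      exact fun ha => Ideal.Quotient.eq_zero_iff_mem.2 ((h a).2 ha))
    (by rw [Cardinal.mk_complex]; exact Cardinal.aleph0_lt_continuum) rfl
  have hσ' : ∀ p, σ (f p) = g p := fun p => hσ (Ideal.Quotient.mk _ p)
  refine ⟨AlgEquiv.ofRingEquiv (f := σ) fun d => ?_, fun i => ?_⟩
  · simpa [f, g] using hσ' (MvPolynomial.C d)
  · simpa [f, g] using hσ' (MvPolynomial.X i)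

open Polynomial in
theorem Polynomial.dvd_of_irreducible_of_aeval_eq_zero {D L : Type*} [CommRing D] [IsDomain D]
    [UniqueFactorizationMonoid D] [Field L] [Algebra D L] [FaithfulSMul D L] {f g : D[X]} {x : L}
    (hf : Irreducible f) (hfx : aeval x f = 0) (hgx : aeval x g = 0) : f ∣ g := by
  obtain ⟨_⟩ : Nonempty (NormalizedGCDMonoid D) := inferInstance
  let := FractionRing.liftAlgebra D L
  have hdeg : f.natDegree ≠ 0 := by
    intro h0
    rw [eq_C_of_natDegree_eq_zero h0, aeval_C,
      FaithfulSMul.algebraMap_eq_zero_iff D L] at hfx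
    rw [eq_C_of_natDegree_eq_zero h0, hfx, C_0] at hf
    exact hf.ne_zero rfl
  have hp := hf.isPrimitive hdeg
  have hirr := (hp.irreducible_iff_irreducible_map_fraction_map (K := FractionRing D)).1 hf
  refine hp.dvd_of_fraction_map_dvd_fraction_map (K := FractionRing D) ?_
  have hx1 : aeval x (f.map (algebraMap D (FractionRing D))) = 0 := by
    rwa [aeval_map_algebraMap]
  have hx2 : aeval x (g.map (algebraMap D (FractionRing D))) = 0 := by
    rwa [aeval_map_algebraMap]
  have hint : IsIntegral (FractionRing D) x :=
    isAlgebraic_iff_isIntegral.1 ⟨_, hirr.ne_zero, hx1⟩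
  exact ((minpoly.irreducible hint).dvd_symm hirr (minpoly.dvd _ _ hx1)).trans (minpoly.dvd _ _ hx2)

theorem MvPolynomial.dvd_of_irreducible_of_aeval_eq_zero {D L υ : Type*} [CommRing D] [IsDomain D]
    [UniqueFactorizationMonoid D] [Field L] [Algebra D L] {f g : MvPolynomial υ D} {x : υ → L}
    (j : υ) (hx : AlgebraicIndependent D fun i : {i // i ≠ j} => x i)
    (hf : Irreducible f) (hfx : aeval x f = 0) (hgx : aeval x g = 0) : f ∣ g := by
  classical
  let e := (renameEquiv D (Equiv.optionSubtypeNe j).symm).trans (optionEquivLeft D {i // i ≠ j})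
  let := (aeval (R := D) fun i : {i // i ≠ j} => x i).toRingHom.toAlgebra
  have : FaithfulSMul (MvPolynomial {i // i ≠ j} D) L :=
    (faithfulSMul_iff_algebraMap_injective _ _).2 hx
  have : IsScalarTower D (MvPolynomial {i // i ≠ j} D) L :=
    IsScalarTower.of_algebraMap_eq fun d => by
      simp [RingHom.algebraMap_toAlgebra]
  have key : ∀ p, Polynomial.aeval (x j) (e p) = aeval x p := by
    intro p
    have : ((Polynomial.aeval (R := MvPolynomial {i // i ≠ j} D) (x j)).restrictScalars D).comp
        e.toAlgHom = aeval x := by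
      ext i
      by_cases h : i = j
      · subst h
        simp [e, optionEquivLeft_apply]
      · simp [e, optionEquivLeft_apply, Equiv.optionSubtypeNe_symm_of_ne h,
          RingHom.algebraMap_toAlgebra]
    exact DFunLike.congr_fun this p
  rw [← map_dvd_iff e]
  refine Polynomial.dvd_of_irreducible_of_aeval_eq_zero (x := x j) ?_ ?_ ?_
  · exact (MulEquiv.irreducible_iff e).2 hf
  · rw [key, hfx]
  · rw [key, hgx]

open Polynomial in
theorem exists_algEquiv_apply_eq' {D : Type} [CommRing D] [Countable D] [Algebra D ℂ]
    (x y : ℂ) (h : ∀ p : D[X], aeval x p = 0 ↔ aeval y p = 0) :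
    ∃ σ : ℂ ≃ₐ[D] ℂ, σ x = y := by
  obtain ⟨σ, hσ⟩ := exists_algEquiv_apply_eq (D := D) (fun _ : Unit => x) (fun _ => y) fun p => by
    have key : ∀ z : ℂ, MvPolynomial.aeval (fun _ : Unit => z) p =
        aeval z (MvPolynomial.uniqueAlgEquiv D Unit p) := by
      intro z
      have : MvPolynomial.aeval (fun _ : Unit => z) =
        (aeval (R := D) z).comp (MvPolynomial.uniqueAlgEquiv D Unit).toAlgHom := by
        ext i
        change MvPolynomial.aeval _ (MvPolynomial.X i) =
          aeval z (MvPolynomial.eval₂ C (fun _ => X) (MvPolynomial.X i))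
        simp
      exact DFunLike.congr_fun this p
    rw [key, key, h]
  exact ⟨σ, hσ ()⟩

open Polynomial in
theorem exists_smul_eq_algebraMap_of_fixed {D : Type} [CommRing D] [IsDomain D] [Countable D]
    [Algebra D ℂ] [FaithfulSMul D ℂ] (x : ℂ) (hx : ∀ σ : ℂ ≃ₐ[D] ℂ, σ x = x) :
    ∃ a b : D, b ≠ 0 ∧ algebraMap D ℂ b * x = algebraMap D ℂ a := by
  let := FractionRing.liftAlgebra D ℂ
  have hcz : CharZero (FractionRing D) := (algebraMap (FractionRing D) ℂ).charZero
  have haev : ∀ (z : ℂ) (p : D[X]),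
      aeval z (p.map (algebraMap D (FractionRing D))) = aeval z p := fun z p => by
    rw [aeval_map_algebraMap]
  have hinj : Function.Injective (algebraMap D (FractionRing D)) := IsFractionRing.injective _ _
  by_cases halg : IsAlgebraic (FractionRing D) x
  · have hint := isAlgebraic_iff_isIntegral.1 halg
    have hirr := minpoly.irreducible hint
    have hroot : ∀ y ∈ (minpoly (FractionRing D) x).rootSet ℂ, y = x := by
      intro y hy
      have hy0 := (mem_rootSet.1 hy).2
      have hmy : minpoly (FractionRing D) x = minpoly (FractionRing D) y :=
        minpoly.eq_of_irreducible_of_monic hirr hy0 (minpoly.monic hint)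
      obtain ⟨σ, hσ⟩ := exists_algEquiv_apply_eq' (D := D) x y fun p => by
        rw [← haev, ← haev, ← minpoly.dvd_iff, ← minpoly.dvd_iff, hmy]
      rw [← hσ, hx]
    have hcard := card_rootSet_eq_natDegree (K := ℂ) hirr.separable (IsAlgClosed.splits _)
    have hle : Fintype.card ((minpoly (FractionRing D) x).rootSet ℂ) ≤ 1 := by
      rw [Fintype.card_le_one_iff]
      intro a b
      exact Subtype.ext ((hroot _ a.2).trans (hroot _ b.2).symm)
    have hdeg : (minpoly (FractionRing D) x).natDegree = 1 :=
      le_antisymm (hcard ▸ hle) (minpoly.natDegree_pos hint)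
    obtain ⟨q, hq⟩ : x ∈ (algebraMap (FractionRing D) ℂ).range := by
      rw [← minpoly.natDegree_eq_one_iff]; exact hdeg
    obtain ⟨a, b, hb, rfl⟩ := IsFractionRing.div_surjective (A := D) q
    have hb0 := nonZeroDivisors.ne_zero hb
    refine ⟨a, b, hb0, ?_⟩
    rw [← hq, map_div₀, ← IsScalarTower.algebraMap_apply, ← IsScalarTower.algebraMap_apply,
      mul_div_cancel₀]
    rwa [Ne, FaithfulSMul.algebraMap_eq_zero_iff]
  · have ht : Transcendental (FractionRing D) x := halg
    have ht1 : Transcendental (FractionRing D) (x + 1) := by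
      intro h
      refine halg ?_
      simpa using h.sub (isAlgebraic_algebraMap (1 : FractionRing D))
    obtain ⟨σ, hσ⟩ := exists_algEquiv_apply_eq' (D := D) x (x + 1) fun p => by
      rw [← haev, ← haev, transcendental_iff.1 ht _ |> fun h => (⟨h, fun h => by simp [h]⟩ : _ ↔ _),
        transcendental_iff.1 ht1 _ |> fun h => (⟨h, fun h => by simp [h]⟩ : _ ↔ _)]
    rw [hx] at hσ
    simp at hσ

theorem MvPolynomial.continuous_aeval_int {ι : Type*} (p : MvPolynomial ι ℤ) :
    Continuous fun x : ι → ℂ => MvPolynomial.aeval x p := by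
  have : (fun x : ι → ℂ => MvPolynomial.aeval x p) =
      fun x => MvPolynomial.eval x (MvPolynomial.map (Int.castRingHom ℂ) p) := by
    ext x
    rw [MvPolynomial.eval_map, MvPolynomial.aeval_def]
    rfl
  rw [this]
  exact MvPolynomial.continuous_eval _

theorem MvPolynomial.exists_aeval_intCast_ne_zero {ι : Type*} {p : MvPolynomial ι ℤ}
    (hp : p ≠ 0) : ∃ w : ι → ℤ, MvPolynomial.aeval (fun i => (w i : ℂ)) p ≠ 0 := by
  by_contra! h
  refine hp (MvPolynomial.funext fun w => ?_)
  have := h w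
  rw [map_zero, ← Int.cast_eq_zero (α := ℂ), ← this]
  exact ((MvPolynomial.aeval_algebraMap_apply ℂ w p).symm.trans rfl).symm ▸ rfl

theorem aeval_line {ι : Type*} (p : MvPolynomial ι ℤ) (x w : ι → ℂ) (t : ℂ) :
    (MvPolynomial.aeval (fun i => Polynomial.C (x i) + Polynomial.X * Polynomial.C (w i)) p).eval t
      = MvPolynomial.aeval (fun i => x i + t * w i) p := by
  rw [← Polynomial.coe_evalRingHom, MvPolynomial.aeval_def, MvPolynomial.eval₂_comp_left]
  simp only [MvPolynomial.aeval_def]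
  congr 1
  · ext; simp
  · ext i; simp; ring

theorem dense_algebraicIndependent {ι : Type*} [Countable ι] :
    Dense {x : ι → ℂ | AlgebraicIndependent ℤ x} := by
  have : Countable (MvPolynomial ι ℤ) := by
    rw [← Cardinal.mk_le_aleph0_iff]
    refine (MvPolynomial.cardinalMk_le_max_lift).trans ?_
    simp
  have h1 : {x : ι → ℂ | AlgebraicIndependent ℤ x} =
      ⋂ p : {p : MvPolynomial ι ℤ // p ≠ 0}, {x | MvPolynomial.aeval x p.1 ≠ 0} := by
    ext x
    simp only [Set.mem_ofPred_eq, Set.mem_iInter, algebraicIndependent_iff, Subtype.forall]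
    exact forall_congr' fun p => ⟨fun h h1 h2 => h1 (h h2), fun h h2 => by
      by_contra h1; exact h h1 h2⟩
  rw [h1]
  refine dense_iInter_of_isOpen
    (fun p => (MvPolynomial.continuous_aeval_int p.1).isOpen_preimage _ isOpen_ne) ?_
  rintro ⟨p, hp⟩ x
  obtain ⟨w, hw⟩ := MvPolynomial.exists_aeval_intCast_ne_zero hp
  let q : Polynomial ℂ := MvPolynomial.aeval
    (fun i => Polynomial.C (x i) + Polynomial.X * Polynomial.C ((w i : ℂ) - x i)) p
  have hq : q ≠ 0 := by
    intro h
    have := aeval_line p x (fun i => (w i : ℂ) - x i) 1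
    rw [show MvPolynomial.aeval _ p = q from rfl, h] at this
    simp at this
    exact hw this.symm
  have hev : ∀ᶠ t in nhdsWithin (0 : ℂ) {0}ᶜ, q.eval t ≠ 0 := by
    have : ∀ᶠ t in nhdsWithin (0 : ℂ) {0}ᶜ, t ∉ ((q.roots.toFinset.erase 0 : Finset ℂ) : Set ℂ) :=
      nhdsWithin_le_nhds (((Finset.finite_toSet _).isClosed.isOpen_compl).mem_nhds (by simp))
    filter_upwards [this, self_mem_nhdsWithin] with t ht ht0 h
    apply ht
    simp only [Finset.coe_erase, Set.mem_sdiff, Finset.mem_coe, Multiset.mem_toFinset,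
      Polynomial.mem_roots hq]
    exact ⟨h, ht0⟩
  have hlim : Filter.Tendsto (fun t : ℂ => fun i => x i + t * ((w i : ℂ) - x i))
      (nhdsWithin (0 : ℂ) {0}ᶜ) (nhds x) := by
    have : Continuous (fun t : ℂ => fun i => x i + t * ((w i : ℂ) - x i)) := by fun_prop
    have := this.tendsto 0
    simp only [zero_mul, add_zero] at this
    exact this.mono_left nhdsWithin_le_nhds
  refine mem_closure_of_tendsto hlim ?_
  filter_upwards [hev] with t ht
  rw [← aeval_line]
  exact ht

theorem Polynomial.norm_eval_one_le {f : Polynomial ℂ} {ε : ℝ} (hε : 0 < ε)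
    (h : ∀ r ∈ f.roots, ε ≤ ‖r‖) : ‖f.eval 1‖ ≤ (1 + ε⁻¹) ^ f.natDegree * ‖f.eval 0‖ := by
  have hs := IsAlgClosed.splits f
  have he : ∀ x, ‖f.eval x‖ = ‖f.leadingCoeff‖ * (f.roots.map fun r => ‖x - r‖).prod := by
    intro x
    conv_lhs => rw [hs.eval_eq_prod_roots]
    rw [norm_mul, ← coe_nnnorm (Multiset.prod _)]
    congr 1
    have := map_multiset_prod (nnnormHom (α := ℂ)) (f.roots.map fun r => x - r)
    simp only [Multiset.map_map] at this
    have h2 := map_multiset_prod (normHom (α := ℂ)) (f.roots.map fun r => x - r)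
    simp only [Multiset.map_map] at h2
    exact h2
  rw [he, he, ← hs.natDegree_eq_card_roots.symm]
  have key : ∀ s : Multiset ℂ, (∀ r ∈ s, ε ≤ ‖r‖) →
      (s.map fun r => ‖1 - r‖).prod ≤ (1 + ε⁻¹) ^ s.card * (s.map fun r => ‖0 - r‖).prod := by
    intro s
    induction s using Multiset.induction_on with
    | empty => simp
    | cons a s ih =>
      intro hs
      have ha := hs a (by simp)
      have h1 : ‖1 - a‖ ≤ (1 + ε⁻¹) * ‖0 - a‖ := by
        have h1 := norm_sub_le (1 : ℂ) a
        have h2 : 1 ≤ ε⁻¹ * ‖a‖ := by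
          rw [inv_mul_eq_div, le_div_iff₀ hε]; simpa using ha
        rw [zero_sub, norm_neg]
        rw [norm_one] at h1
        linarith
      have h2 := ih fun r hr => hs r (by simp [hr])
      simp only [Multiset.map_cons, Multiset.prod_cons, Multiset.card_cons]
      calc _ ≤ ((1 + ε⁻¹) * ‖0 - a‖) * ((1 + ε⁻¹) ^ s.card * (s.map fun r => ‖0 - r‖).prod) :=
            mul_le_mul h1 h2 (Multiset.prod_nonneg (by simp)) (by positivity)
        _ = _ := by ring
  calc _ ≤ ‖f.leadingCoeff‖ * ((1 + ε⁻¹) ^ f.roots.card * (f.roots.map fun r => ‖0 - r‖).prod) :=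
        mul_le_mul_of_nonneg_left (key _ h) (norm_nonneg _)
    _ = _ := by ring

theorem exists_root_nhds {ι : Type*} {E : MvPolynomial ι ℤ} (hE : E ≠ 0)
    {c : ι → ℂ} (hc : MvPolynomial.aeval c E = 0) {N : Set (ι → ℂ)} (hN : N ∈ nhds c) :
    ∃ w : ι → ℤ, ∀ᶠ c' in nhds c, ∃ t : ℂ, (fun i => c' i + t * w i) ∈ N ∧
      MvPolynomial.aeval (fun i => c' i + t * w i) E = 0 := by
  obtain ⟨w, hw⟩ : ∃ w : ι → ℤ, MvPolynomial.aeval (fun i => c i + w i) E ≠ 0 := by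
    by_contra! h
    have h1 : MvPolynomial.map (Int.castRingHom ℂ) E ≠ 0 := by
      rwa [Ne, map_eq_zero_iff _ (MvPolynomial.map_injective _ Int.cast_injective)]
    refine h1 (MvPolynomial.funext_set (fun i => Set.range fun z : ℤ => c i + z)
      (fun i => Set.infinite_range_of_injective fun a b hab => by simpa using hab) fun x hx => ?_)
    choose! w hw using hx
    rw [map_zero, MvPolynomial.eval_map]
    have hwx : (fun i => c i + w i) = x := by
      ext i
      exact hw i (by simp)
    rw [← hwx]
    exact h w
  refine ⟨w, ?_⟩
  have hcont : Continuous fun q : (ι → ℂ) × ℂ => fun i => q.1 i + q.2 * w i := by fun_prop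
  have hN' : ∀ᶠ q : (ι → ℂ) × ℂ in nhds (c, 0), (fun i => q.1 i + q.2 * w i) ∈ N := by
    refine hcont.tendsto (c, 0) ?_
    simpa using hN
  rw [nhds_prod_eq, Filter.eventually_prod_iff] at hN'
  obtain ⟨pa, ha, pb, hb, hab⟩ := hN'
  obtain ⟨ε, hε, hball⟩ := Metric.eventually_nhds_iff.1 hb
  have h0 : Continuous fun c' : ι → ℂ => (1 + ε⁻¹) ^ E.totalDegree * ‖MvPolynomial.aeval c' E‖ :=
    continuous_const.mul (MvPolynomial.continuous_aeval_int E).norm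
  have h1 : Continuous fun c' : ι → ℂ => ‖MvPolynomial.aeval (fun i => c' i + w i) E‖ :=
    ((MvPolynomial.continuous_aeval_int E).comp (by fun_prop)).norm
  have hlt := (h0.tendsto c).eventually_lt (h1.tendsto c) (by simpa [hc] using hw)
  filter_upwards [ha, hlt] with c' hc' hlt'
  by_contra! hno
  let f : Polynomial ℂ := MvPolynomial.aeval
    (fun i => Polynomial.C (c' i) + Polynomial.X * Polynomial.C (w i : ℂ)) E
  have hf : ∀ t, f.eval t = MvPolynomial.aeval (fun i => c' i + t * w i) E :=
    aeval_line E c' fun i => (w i : ℂ)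
  have h2 := Polynomial.norm_eval_one_le (f := f) hε fun r hr => by
    by_contra! hr'
    refine hno r (hab hc' (hball (by simpa using hr'))) ?_
    rw [← hf]
    exact Polynomial.isRoot_of_mem_roots hr
  have h3 : f.natDegree ≤ E.totalDegree := by
    have h4 := MvPolynomial.aeval_natDegree_le (n := 1) (MvPolynomial.map (algebraMap ℤ ℂ) E)
      (Finset.sup_mono (MvPolynomial.support_map_subset _ _))
      (fun i => Polynomial.C (c' i) + Polynomial.X * Polynomial.C (w i : ℂ))
      fun i => by compute_degree
    rwa [MvPolynomial.aeval_map_algebraMap, mul_one] at h4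
  rw [hf, hf] at h2
  simp only [one_mul, zero_mul, add_zero] at h2
  have h4 : (1 + ε⁻¹) ^ f.natDegree ≤ (1 + ε⁻¹) ^ E.totalDegree :=
    pow_le_pow_right₀ (by have := inv_pos.2 hε; linarith) h3
  have := mul_le_mul_of_nonneg_right h4 (norm_nonneg (MvPolynomial.aeval c' E))
  linarith

/-- The substitution `u ↦ u + T w`, as an automorphism of `ℤ[u][T]`. -/
noncomputable def lineEquiv {ι : Type*} (w : ι → ℤ) :
    Polynomial (MvPolynomial ι ℤ) ≃+* Polynomial (MvPolynomial ι ℤ) :=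
  let f (w : ι → ℤ) : Polynomial (MvPolynomial ι ℤ) →+* Polynomial (MvPolynomial ι ℤ) :=
    Polynomial.eval₂RingHom
      (MvPolynomial.aeval (R := ℤ) fun i => (Polynomial.C (MvPolynomial.X i) +
        Polynomial.X * Polynomial.C (MvPolynomial.C (w i)))).toRingHom Polynomial.X
  have h (w : ι → ℤ) : (f w).comp (f (-w)) = RingHom.id _ := by
    refine Polynomial.ringHom_ext' (MvPolynomial.ringHom_ext (by simp [f]) fun i => ?_)
      (by simp [f])
    simp [f, -eq_intCast, -map_intCast]
    ring
  RingEquiv.ofRingHom (f w) (f (-w)) (h w) (by simpa using h (-w))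

theorem exists_aeval_eq_zero_iff_dvd {ι : Type*} [Countable ι] {E : MvPolynomial ι ℤ}
    (hE : Irreducible E) {c : ι → ℂ} (hc : MvPolynomial.aeval c E = 0) {N : Set (ι → ℂ)}
    (hN : N ∈ nhds c) : ∃ c' ∈ N, ∀ h : MvPolynomial ι ℤ, MvPolynomial.aeval c' h = 0 ↔ E ∣ h := by
  obtain ⟨w, hw⟩ := exists_root_nhds hE.ne_zero hc hN
  obtain ⟨c', ⟨t, htN, ht⟩, hc'⟩ := mem_closure_iff_nhds.1 (dense_algebraicIndependent c) _ hw
  refine ⟨_, htN, fun h => ⟨fun hh => ?_, fun ⟨q, hq⟩ => by rw [hq, map_mul, ht, zero_mul]⟩⟩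
  let := (MvPolynomial.aeval (R := ℤ) c').toRingHom.toAlgebra
  have : FaithfulSMul (MvPolynomial ι ℤ) ℂ := (faithfulSMul_iff_algebraMap_injective _ _).2 hc'
  have key : ∀ p : MvPolynomial ι ℤ, Polynomial.aeval t (lineEquiv w (Polynomial.C p)) =
      MvPolynomial.aeval (fun i => c' i + t * w i) p := by
    intro p
    have : (((Polynomial.aeval (R := MvPolynomial ι ℤ) t).toRingHom.comp
      (lineEquiv w).toRingHom).comp Polynomial.C) =
        (MvPolynomial.aeval (R := ℤ) fun i => c' i + t * w i).toRingHom := by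
      ext i
      · simp
      · simp [lineEquiv, RingHom.algebraMap_toAlgebra]
    exact DFunLike.congr_fun this p
  have h1 : lineEquiv w (Polynomial.C E) ∣ lineEquiv w (Polynomial.C h) := by
    refine Polynomial.dvd_of_irreducible_of_aeval_eq_zero (x := t) ?_ ?_ ?_
    · rw [MulEquiv.irreducible_iff]
      exact (Polynomial.prime_C_iff.2 hE.prime).irreducible
    · rw [key, ht]
    · rw [key, hh]
  rw [map_dvd_iff] at h1
  simpa using Polynomial.C_dvd_iff_dvd_coeff _ _ |>.1 h1 0

theorem chEval_add (ξ : Fin n → ℂˣ) (a b : Fin n → ℤ) :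
    chEval ξ (a + b) = chEval ξ a * chEval ξ b := by
  simp [chEval, zpow_add, Finset.prod_mul_distrib]

theorem chEval_zero (ξ : Fin n → ℂˣ) : chEval ξ 0 = 1 := by
  simp [chEval]

theorem chEval_ne_zero (ξ : Fin n → ℂˣ) (a : Fin n → ℤ) : chEval ξ a ≠ 0 := by
  exact Finset.prod_ne_zero_iff.2 fun j _ => Units.ne_zero _

theorem chEval_sub_mul (ξ : Fin n → ℂˣ) (a b : Fin n → ℤ) :
    chEval ξ (a - b) * chEval ξ b = chEval ξ a := by
  rw [← chEval_add, sub_add_cancel]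

theorem continuous_chEval (a : Fin n → ℤ) : Continuous fun ξ : Fin n → ℂˣ => chEval ξ a := by
  unfold chEval
  refine continuous_finsetProd _ fun j _ => ?_
  exact Units.continuous_val.comp ((continuous_zpow (a j)).comp (continuous_apply j))

/-- The action of a ring automorphism of `ℂ` on points of the torus. -/
def conjPt (σ : ℂ →+* ℂ) (ξ : Fin n → ℂˣ) : Fin n → ℂˣ := fun j => Units.map σ (ξ j)

@[simp]
theorem conjPt_val (σ : ℂ →+* ℂ) (ξ : Fin n → ℂˣ) (j : Fin n) :
    (conjPt σ ξ j : ℂ) = σ (ξ j) := rfl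

theorem chEval_conjPt (σ : ℂ →+* ℂ) (ξ : Fin n → ℂˣ) (a : Fin n → ℤ) :
    chEval (conjPt σ ξ) a = σ (chEval ξ a) := by
  simp [chEval, map_prod, conjPt, ← map_zpow]

theorem conjPt_injective (σ : ℂ →+* ℂ) : Function.Injective (conjPt (n := n) σ) := by
  intro ξ η h
  ext j
  have := congrArg (fun z : Fin n → ℂˣ => (z j : ℂ)) h
  exact σ.injective this

theorem isRootOf_conjPt (σ : ℂ →+* ℂ) (A : Fin (n + 1) → Finset (Fin n → ℤ))
    (c : Fin (n + 1) → (Fin n → ℤ) → ℂ) (ξ : Fin n → ℂˣ) :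
    IsRootOf A (fun i a => σ (c i a)) (conjPt σ ξ) ↔ IsRootOf A c ξ := by
  refine forall_congr' fun i => ?_
  simp only [chEval_conjPt, ← map_mul, ← map_sum]
  exact map_eq_zero_iff σ σ.injective

theorem card_roots_conj (σ : ℂ ≃+* ℂ) (A : Fin (n + 1) → Finset (Fin n → ℤ))
    (c : Fin (n + 1) → (Fin n → ℤ) → ℂ) :
    Nat.card {ξ // IsRootOf A (fun i a => σ (c i a)) ξ} = Nat.card {ξ // IsRootOf A c ξ} := by
  symm
  refine Nat.card_congr (Equiv.ofBijective
    (fun ξ => ⟨conjPt (σ : ℂ →+* ℂ) ξ.1, (isRootOf_conjPt (σ : ℂ →+* ℂ) A c ξ.1).2 ξ.2⟩)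
    ⟨fun ξ η h => Subtype.ext (conjPt_injective _ (congrArg Subtype.val h)), fun η => ?_⟩)
  have h : conjPt (σ : ℂ →+* ℂ) (conjPt (σ.symm : ℂ →+* ℂ) η.1) = η.1 := by
    ext j
    simp
  refine ⟨⟨conjPt (σ.symm : ℂ →+* ℂ) η.1, ?_⟩, Subtype.ext h⟩
  rw [← isRootOf_conjPt (σ : ℂ →+* ℂ), h]
  exact η.2

theorem evalCoeff_conj (σ : ℂ →+* ℂ) (h : MvPolynomial (Fin (n + 1) × (Fin n → ℤ)) ℤ)
    (c : Fin (n + 1) → (Fin n → ℤ) → ℂ) :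
    evalCoeff h (fun i a => σ (c i a)) = σ (evalCoeff h c) := by
  rw [evalCoeff, evalCoeff]
  have : (MvPolynomial.aeval (R := ℤ) fun p : Fin (n + 1) × (Fin n → ℤ) => σ (c p.1 p.2)) =
      (σ.toIntAlgHom).comp (MvPolynomial.aeval fun p => c p.1 p.2) := by
    ext p; simp
  rw [this]
  rfl

theorem continuous_evalCoeff (h : MvPolynomial (Fin (n + 1) × (Fin n → ℤ)) ℤ) :
    Continuous (evalCoeff h) :=
  (MvPolynomial.continuous_aeval_int h).comp (by fun_prop)

/-- The coefficient family obtained from `u` by overwriting the coefficients at the base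
exponents `b i` so that `ξ` becomes a common root. -/
def fillIn (A : Fin (n + 1) → Finset (Fin n → ℤ)) (b : Fin (n + 1) → Fin n → ℤ)
    (ξ : Fin n → ℂˣ) (u : Fin (n + 1) → (Fin n → ℤ) → ℂ) : Fin (n + 1) → (Fin n → ℤ) → ℂ :=
  fun i a => if a = b i then -∑ a' ∈ (A i).erase (b i), u i a' * chEval ξ (a' - b i) else u i a

theorem fillIn_conj (σ : ℂ →+* ℂ) (A : Fin (n + 1) → Finset (Fin n → ℤ))
    (b : Fin (n + 1) → Fin n → ℤ) (ξ : Fin n → ℂˣ) (u : Fin (n + 1) → (Fin n → ℤ) → ℂ) :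
    fillIn A b (conjPt σ ξ) (fun i a => σ (u i a)) = fun i a => σ (fillIn A b ξ u i a) := by
  ext i a
  simp only [fillIn]
  split_ifs <;> simp [chEval_conjPt]

theorem isRootOf_iff_base {A : Fin (n + 1) → Finset (Fin n → ℤ)} {b : Fin (n + 1) → Fin n → ℤ}
    (hb : ∀ i, b i ∈ A i) {ξ : Fin n → ℂˣ} {c : Fin (n + 1) → (Fin n → ℤ) → ℂ} :
    IsRootOf A c ξ ↔
      ∀ i, c i (b i) = -∑ a' ∈ (A i).erase (b i), c i a' * chEval ξ (a' - b i) := by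
  refine forall_congr' fun i => ?_
  rw [← Finset.add_sum_erase _ _ (hb i)]
  have : ∑ a' ∈ (A i).erase (b i), c i a' * chEval ξ a' =
      (∑ a' ∈ (A i).erase (b i), c i a' * chEval ξ (a' - b i)) * chEval ξ (b i) := by
    rw [Finset.sum_mul]
    exact Finset.sum_congr rfl fun a _ => by rw [mul_assoc, chEval_sub_mul]
  rw [this, ← add_mul, mul_eq_zero, or_iff_left (chEval_ne_zero _ _), add_eq_zero_iff_eq_neg]

theorem fillIn_of_isRootOf {A : Fin (n + 1) → Finset (Fin n → ℤ)} {b : Fin (n + 1) → Fin n → ℤ}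
    (hb : ∀ i, b i ∈ A i) {ξ : Fin n → ℂˣ} {c : Fin (n + 1) → (Fin n → ℤ) → ℂ}
    (h : IsRootOf A c ξ) : fillIn A b ξ c = c := by
  ext i a
  simp only [fillIn]
  split_ifs with h1
  · rw [h1, (isRootOf_iff_base hb).1 h i]
  · rfl

theorem isRootOf_fillIn {A : Fin (n + 1) → Finset (Fin n → ℤ)} {b : Fin (n + 1) → Fin n → ℤ}
    (hb : ∀ i, b i ∈ A i) (ξ : Fin n → ℂˣ) (u : Fin (n + 1) → (Fin n → ℤ) → ℂ) :
    IsRootOf A (fillIn A b ξ u) ξ := by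
  rw [isRootOf_iff_base hb]
  intro i
  simp only [fillIn, if_true]
  congr 1
  exact Finset.sum_congr rfl fun a ha => by rw [if_neg (Finset.ne_of_mem_erase ha)]

theorem continuous_fillIn (A : Fin (n + 1) → Finset (Fin n → ℤ)) (b : Fin (n + 1) → Fin n → ℤ) :
    Continuous fun q : (Fin n → ℂˣ) × (Fin (n + 1) → (Fin n → ℤ) → ℂ) =>
      fillIn A b q.1 q.2 := by
  refine continuous_pi fun i => continuous_pi fun a => ?_
  simp only [fillIn]
  split_ifs
  · refine (continuous_finsetSum _ fun a' _ => ?_).neg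
    exact Continuous.mul (by fun_prop) ((continuous_chEval _).comp continuous_fst)
  · fun_prop

/-- The coordinates of `ξ` and of `u` are jointly algebraically independent over `ℤ`. -/
def IsGenericPair (ξ : Fin n → ℂˣ) (u : Fin (n + 1) → (Fin n → ℤ) → ℂ) : Prop :=
  AlgebraicIndependent ℤ
    (Sum.elim (fun j => (ξ j : ℂ)) fun p : Fin (n + 1) × (Fin n → ℤ) => u p.1 p.2)

theorem IsGenericPair.exists_conj {ξ ξ' : Fin n → ℂˣ} {u u' : Fin (n + 1) → (Fin n → ℤ) → ℂ}
    (h : IsGenericPair ξ u) (h' : IsGenericPair ξ' u') :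
    ∃ σ : ℂ ≃+* ℂ, conjPt (σ : ℂ →+* ℂ) ξ = ξ' ∧ (fun i a => σ (u i a)) = u' := by
  obtain ⟨σ, hσ⟩ := exists_algEquiv_apply_eq (D := ℤ)
    (Sum.elim (fun j => (ξ j : ℂ)) fun p : Fin (n + 1) × (Fin n → ℤ) => u p.1 p.2)
    (Sum.elim (fun j => (ξ' j : ℂ)) fun p : Fin (n + 1) × (Fin n → ℤ) => u' p.1 p.2) fun p => by
      rw [map_eq_zero_iff _ h, map_eq_zero_iff _ h']
  refine ⟨σ.toRingEquiv, ?_, ?_⟩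
  · ext j
    exact hσ (Sum.inl j)
  · ext i a
    exact hσ (Sum.inr (i, a))

theorem dense_isGenericPair :
    Dense {q : (Fin n → ℂˣ) × (Fin (n + 1) → (Fin n → ℤ) → ℂ) | IsGenericPair q.1 q.2} := by
  rintro ⟨ξ, u⟩
  rw [mem_closure_iff_nhds]
  intro N hN
  classical
  let g : ℂ → ℂˣ := fun z => if h : z ≠ 0 then Units.mk0 z h else 1
  have hg : ∀ z : ℂˣ, ContinuousAt g z := by
    intro z
    rw [Units.isEmbedding_val₀.continuousAt_iff]
    refine (continuousAt_id (x := (z : ℂ))).congr ?_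
    filter_upwards [isOpen_ne.mem_nhds z.ne_zero] with w hw
    have : w ≠ 0 := hw
    simp [g, this]
  have hgz : ∀ z : ℂˣ, g z = z := by
    intro z
    ext
    simp [g]
  let f : (Fin n ⊕ (Fin (n + 1) × (Fin n → ℤ)) → ℂ) →
      (Fin n → ℂˣ) × (Fin (n + 1) → (Fin n → ℤ) → ℂ) :=
    fun x => (fun j => g (x (Sum.inl j)), fun i a => x (Sum.inr (i, a)))
  let x0 : Fin n ⊕ (Fin (n + 1) × (Fin n → ℤ)) → ℂ :=
    Sum.elim (fun j => (ξ j : ℂ)) fun p => u p.1 p.2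
  have hf : ContinuousAt f x0 := by
    refine ContinuousAt.prodMk (continuousAt_pi.2 fun j => ?_)
      (continuousAt_pi.2 fun i => continuousAt_pi.2 fun a => continuousAt_apply _ _)
    exact ContinuousAt.comp (f := fun x : (Fin n ⊕ (Fin (n + 1) × (Fin n → ℤ)) → ℂ) =>
      x (Sum.inl j)) (x := x0) (hg (ξ j)) (continuousAt_apply _ _)
  have hf0 : f x0 = (ξ, u) := by
    simp [f, x0, hgz]
  rw [← hf0] at hN
  obtain ⟨x, hxN, hx⟩ := mem_closure_iff_nhds.1 (dense_algebraicIndependent x0) _ (hf hN)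
  refine ⟨f x, hxN, ?_⟩
  have hx' : AlgebraicIndependent ℤ x := hx
  have : Sum.elim (fun j => ((f x).1 j : ℂ))
      (fun p : Fin (n + 1) × (Fin n → ℤ) => (f x).2 p.1 p.2) = x := by
    ext (j | p)
    · have h0 : x (Sum.inl j) ≠ 0 := hx'.ne_zero _
      simp [f, g, h0]
    · rfl
  change AlgebraicIndependent ℤ _
  rw [this]
  exact hx'

theorem exists_isGenericPair :
    ∃ (ξ : Fin n → ℂˣ) (u : Fin (n + 1) → (Fin n → ℤ) → ℂ), IsGenericPair ξ u := by
  obtain ⟨q, hq⟩ := (dense_isGenericPair (n := n)).nonempty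
  exact ⟨q.1, q.2, hq⟩

theorem exists_generic_fillIn_mem {A : Fin (n + 1) → Finset (Fin n → ℤ)}
    {b : Fin (n + 1) → Fin n → ℤ} (hb : ∀ i, b i ∈ A i) {c : Fin (n + 1) → (Fin n → ℤ) → ℂ}
    (hc : HasRoot A c) {N : Set (Fin (n + 1) → (Fin n → ℤ) → ℂ)} (hN : N ∈ nhds c) :
    ∃ ξ u, IsGenericPair ξ u ∧ fillIn A b ξ u ∈ N := by
  obtain ⟨ξ, hξ⟩ := hc
  rw [← fillIn_of_isRootOf hb hξ] at hN
  obtain ⟨q, hqN, hq⟩ := mem_closure_iff_nhds.1 (dense_isGenericPair (ξ, c)) _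
    ((continuous_fillIn A b).continuousAt.preimage_mem_nhds hN)
  exact ⟨q.1, q.2, hq, hqN⟩

theorem exists_fillIn_conj {A : Fin (n + 1) → Finset (Fin n → ℤ)}
    {b : Fin (n + 1) → Fin n → ℤ} {ξ ξ' : Fin n → ℂˣ} {u u' : Fin (n + 1) → (Fin n → ℤ) → ℂ}
    (h : IsGenericPair ξ u) (h' : IsGenericPair ξ' u') :
    ∃ σ : ℂ ≃+* ℂ, fillIn A b ξ' u' = fun i a => σ (fillIn A b ξ u i a) := by
  obtain ⟨σ, rfl, rfl⟩ := h.exists_conj h'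
  exact ⟨σ, fillIn_conj (σ : ℂ →+* ℂ) A b ξ u⟩

theorem evalCoeff_eq_zero_of_generic {A : Fin (n + 1) → Finset (Fin n → ℤ)}
    {b : Fin (n + 1) → Fin n → ℤ} (hb : ∀ i, b i ∈ A i) {ξ : Fin n → ℂˣ}
    {u : Fin (n + 1) → (Fin n → ℤ) → ℂ} (hg : IsGenericPair ξ u)
    {h : MvPolynomial (Fin (n + 1) × (Fin n → ℤ)) ℤ} (hh : evalCoeff h (fillIn A b ξ u) = 0) :
    closure {c | HasRoot A c} ⊆ {c | evalCoeff h c = 0} := by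
  refine closure_minimal (fun c hc => ?_) (isClosed_eq (continuous_evalCoeff h) continuous_const)
  change evalCoeff h c = 0
  by_contra hne
  obtain ⟨ξ', u', hg', hN⟩ := exists_generic_fillIn_mem hb hc
    ((continuous_evalCoeff h).continuousAt.preimage_mem_nhds (isOpen_ne.mem_nhds hne))
  obtain ⟨σ, hσ⟩ := exists_fillIn_conj (A := A) (b := b) hg hg'
  rw [hσ] at hN
  refine hN ?_
  have := evalCoeff_conj (σ : ℂ →+* ℂ) h (fillIn A b ξ u)
  simp only [RingHom.coe_coe] at this
  change evalCoeff h _ = 0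
  rw [this, hh, map_zero]

/-- `E` is irreducible and generates the ideal of polynomials vanishing at `c`. -/
def IsGeneratorAt (c : Fin (n + 1) → (Fin n → ℤ) → ℂ)
    (E : MvPolynomial (Fin (n + 1) × (Fin n → ℤ)) ℤ) : Prop :=
  Irreducible E ∧ ∀ h, evalCoeff h c = 0 ↔ E ∣ h

theorem exists_generator_nhds {E : MvPolynomial (Fin (n + 1) × (Fin n → ℤ)) ℤ}
    (hE : Irreducible E) {c : Fin (n + 1) → (Fin n → ℤ) → ℂ} (hc : evalCoeff E c = 0)
    {N : Set (Fin (n + 1) → (Fin n → ℤ) → ℂ)} (hN : N ∈ nhds c) :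
    ∃ c' ∈ N, IsGeneratorAt c' E := by
  have hcont : Continuous fun (x : Fin (n + 1) × (Fin n → ℤ) → ℂ) i a => x (i, a) := by fun_prop
  obtain ⟨x, hx, h⟩ := exists_aeval_eq_zero_iff_dvd hE hc
    (hcont.continuousAt (x := fun p => c p.1 p.2) |>.preimage_mem_nhds hN)
  exact ⟨_, hx, hE, h⟩

theorem isGeneratorAt_iff {A : Fin (n + 1) → Finset (Fin n → ℤ)}
    {b : Fin (n + 1) → Fin n → ℤ} (hb : ∀ i, b i ∈ A i) {ξ : Fin n → ℂˣ}
    {u : Fin (n + 1) → (Fin n → ℤ) → ℂ} (hg : IsGenericPair ξ u)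
    {E : MvPolynomial (Fin (n + 1) × (Fin n → ℤ)) ℤ} :
    (Irreducible E ∧ {c | evalCoeff E c = 0} = closure {c | HasRoot A c}) ↔
      IsGeneratorAt (fillIn A b ξ u) E := by
  have hmem : fillIn A b ξ u ∈ closure {c | HasRoot A c} :=
    subset_closure ⟨ξ, isRootOf_fillIn hb ξ u⟩
  constructor
  · rintro ⟨hE, hcl⟩
    have h0 : evalCoeff E (fillIn A b ξ u) = 0 := by
      rw [← hcl] at hmem
      exact hmem
    refine ⟨hE, fun h => ⟨fun hh => ?_, fun ⟨q, hq⟩ => ?_⟩⟩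
    · obtain ⟨c', -, hE', hc'⟩ := exists_generator_nhds hE h0 Filter.univ_mem
      have h1 : c' ∈ {c | evalCoeff E c = 0} := (hc' E).2 dvd_rfl
      rw [hcl] at h1
      exact (hc' h).1 (evalCoeff_eq_zero_of_generic hb hg hh h1)
    · rw [hq, evalCoeff, map_mul]
      exact mul_eq_zero_of_left h0 _
  · rintro ⟨hE, hdvd⟩
    refine ⟨hE, (Set.Subset.antisymm
      (evalCoeff_eq_zero_of_generic hb hg ((hdvd E).2 dvd_rfl)) fun c hc => ?_).symm⟩
    rw [mem_closure_iff_nhds]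
    intro N hN
    obtain ⟨c', hc'N, -, hc'⟩ := exists_generator_nhds hE hc hN
    refine ⟨c', hc'N, ?_⟩
    obtain ⟨σ, hσ⟩ := exists_algEquiv_apply_eq (D := ℤ)
      (fun p : Fin (n + 1) × (Fin n → ℤ) => fillIn A b ξ u p.1 p.2) (fun p => c' p.1 p.2)
      fun p => (hdvd p).trans (hc' p).symm
    refine ⟨conjPt (σ : ℂ →+* ℂ) ξ, ?_⟩
    have := (isRootOf_conjPt (σ : ℂ →+* ℂ) A _ ξ).2 (isRootOf_fillIn hb ξ u)
    convert this using 1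
    ext i a
    exact (hσ (i, a)).symm

theorem IsResultant.exists_generator_or {A : Fin (n + 1) → Finset (Fin n → ℤ)}
    {b : Fin (n + 1) → Fin n → ℤ} (hb : ∀ i, b i ∈ A i) {ξ : Fin n → ℂˣ}
    {u : Fin (n + 1) → (Fin n → ℤ) → ℂ} (hg : IsGenericPair ξ u)
    {R : MvPolynomial (Fin (n + 1) × (Fin n → ℤ)) ℤ} (hR : IsResultant A R) :
    (∃ E, IsGeneratorAt (fillIn A b ξ u) E ∧
      (R = E ^ Nat.card {η // IsRootOf A (fillIn A b ξ u) η} ∨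
        R = -E ^ Nat.card {η // IsRootOf A (fillIn A b ξ u) η})) ∨
    ((R = 1 ∨ R = -1) ∧ ∀ E, ¬ IsGeneratorAt (fillIn A b ξ u) E) := by
  obtain ⟨E, d, hE, hRE, U, hU, hcl, hcard⟩ := hR
  rcases hE with hE | ⟨rfl, hE⟩
  · left
    refine ⟨E, (isGeneratorAt_iff hb hg).1 hE, ?_⟩
    have hne : (closure (U ∩ {c | HasRoot A c})).Nonempty := by
      rw [hcl]
      exact ⟨_, subset_closure ⟨ξ, isRootOf_fillIn hb ξ u⟩⟩
    obtain ⟨c, hcU, hc⟩ := closure_nonempty_iff.1 hne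
    obtain ⟨ξ', u', hg', hN⟩ := exists_generic_fillIn_mem hb hc (hU.mem_nhds hcU)
    obtain ⟨σ, hσ⟩ := exists_fillIn_conj (A := A) (b := b) hg hg'
    have h1 := hcard _ ⟨hN, ξ', isRootOf_fillIn hb ξ' u'⟩
    rw [hσ, card_roots_conj] at h1
    rwa [h1]
  · right
    refine ⟨by simpa using hRE, fun E' hE' => hE E' ((isGeneratorAt_iff hb hg).2 hE')⟩

theorem isAlgebraic_chEval {D : Type*} [CommRing D] [IsDomain D] [Algebra D ℂ] {ξ : Fin n → ℂˣ}
    (h : ∀ j, IsAlgebraic D (ξ j : ℂ)) (a : Fin n → ℤ) : IsAlgebraic D (chEval ξ a) := by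
  have hz : ∀ j, IsAlgebraic D ((ξ j ^ a j : ℂˣ) : ℂ) := by
    intro j
    rw [Units.val_zpow_eq_zpow_val]
    cases a j with
    | ofNat k => simpa using (h j).pow k
    | negSucc k => simpa only [zpow_negSucc] using ((h j).pow (k + 1)).inv
  have := prod_mem (S := Subalgebra.algebraicClosure D ℂ) (t := Finset.univ)
    (f := fun j => ((ξ j ^ a j : ℂˣ) : ℂ)) fun j _ => (Subalgebra.mem_algebraicClosure _ _).2 (hz j)
  exact (Subalgebra.mem_algebraicClosure _ _).1 this

theorem AlgebraicIndependent.exchange {D K ι : Type*} [CommRing D] [Field K] [Algebra D K]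
    [FaithfulSMul D K] [Finite ι] {x y : ι → K} (hy : AlgebraicIndependent D y)
    (h : ∀ i, IsAlgebraic (Algebra.adjoin D (Set.range x)) (y i)) :
    AlgebraicIndependent D x ∧ ∀ i, IsAlgebraic (Algebra.adjoin D (Set.range y)) (x i) := by
  have := hy.algebraMap_injective.isDomain
  let M := AlgebraicIndependent.matroid D K
  have hX : (Set.range x).Finite := Set.finite_range x
  have hY : (Set.range y).Finite := Set.finite_range y
  have hYi : M.Indep (Set.range y) :=
    AlgebraicIndependent.matroid_indep_iff.2 hy.to_subtype_range
  have hYX : Set.range y ⊆ M.closure (Set.range x) := by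
    rw [AlgebraicIndependent.matroid_closure_eq]
    rintro _ ⟨i, rfl⟩
    exact (Subalgebra.mem_algebraicClosure _ _).2 (h i)
  have hcard : (Set.range y).encard = ENat.card ι := by
    rw [Set.encard, ENat.card_congr (Equiv.ofInjective y hy.injective)]
  have hle : (Set.range x).encard ≤ ENat.card ι := by
    rw [← Set.image_univ, ← Set.encard_univ]
    exact Set.encard_image_le _ _
  have hge : ENat.card ι ≤ M.eRk (Set.range x) := by
    rw [← hcard, ← hYi.eRk_eq_encard, ← M.eRk_closure_eq (Set.range x)]
    exact M.eRk_mono hYX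
  have hXle := M.eRk_le_encard (Set.range x)
  have hXi : M.Indep (Set.range x) :=
    (Matroid.indep_iff_eRk_eq_encard_of_finite hX).2 (hXle.antisymm (hle.trans hge))
  have hinj : Function.Injective x := by
    have h1 : (Set.univ : Set ι).encard = (x '' Set.univ).encard := by
      rw [Set.image_univ, Set.encard_univ]
      exact (hge.trans hXle).antisymm hle
    have := Set.finite_univ.injOn_of_encard_image_eq h1.symm
    exact Set.injOn_univ.1 this
  refine ⟨.of_subtype_range hinj (AlgebraicIndependent.matroid_indep_iff.1 hXi), fun i => ?_⟩
  have hcl : M.closure (Set.range y) = M.closure (Set.range x) := by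
    rw [← M.closure_closure (Set.range x)]
    refine (M.isRkFinite_of_finite hY).closure_eq_closure_of_subset_of_eRk_ge_eRk hYX ?_
    rw [M.eRk_closure_eq, hYi.eRk_eq_encard, hcard]
    exact hXle.trans hle
  have : x i ∈ M.closure (Set.range y) := by
    rw [hcl]
    exact M.subset_closure _ (fun _ _ => Set.mem_univ _) ⟨i, rfl⟩
  rw [AlgebraicIndependent.matroid_closure_eq] at this
  exact (Subalgebra.mem_algebraicClosure _ _).1 this

theorem exists_conj_of_algebraicIndependent {J : Type} [Countable J] {z : J → ℂ} {y y' : Fin n → ℂ}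
    {ξ ξ' : Fin n → ℂˣ} (hy : AlgebraicIndependent ℤ (Sum.elim y z))
    (hy' : AlgebraicIndependent ℤ (Sum.elim y' z))
    (h : ∀ i, IsAlgebraic (Algebra.adjoin (Algebra.adjoin ℤ (Set.range z))
      (Set.range fun j => (ξ j : ℂ))) (y i))
    (h' : ∀ i, IsAlgebraic (Algebra.adjoin (Algebra.adjoin ℤ (Set.range z))
      (Set.range fun j => (ξ' j : ℂ))) (y' i)) :
    ∃ σ : ℂ ≃+* ℂ, (∀ j, σ (z j) = z j) ∧ conjPt (σ : ℂ →+* ℂ) ξ = ξ' := by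
  rw [AlgebraicIndependent.sumElim_iff] at hy hy'
  have h1 := AlgebraicIndependent.sumElim_iff.2 ⟨hy.1, (hy.2.exchange h).1⟩
  have h2 := AlgebraicIndependent.sumElim_iff.2 ⟨hy.1, (hy'.2.exchange h').1⟩
  obtain ⟨σ, hσ⟩ := exists_algEquiv_apply_eq (D := ℤ) _ _
    fun p => (map_eq_zero_iff _ h1).trans (map_eq_zero_iff _ h2).symm
  refine ⟨σ.toRingEquiv, fun j => hσ (Sum.inr j), ?_⟩
  ext j
  exact hσ (Sum.inl j)

theorem finite_of_transitive {D : Type} [CommRing D] [IsDomain D] [Algebra D ℂ] [FaithfulSMul D ℂ]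
    {V : Set (Fin n → ℂˣ)} {ξ : Fin n → ℂˣ} (halg : ∀ j, IsAlgebraic D (ξ j : ℂ))
    (hV : ∀ η ∈ V, ∃ σ : ℂ ≃ₐ[D] ℂ, conjPt (σ : ℂ →+* ℂ) ξ = η) : V.Finite := by
  choose p hp hpx using halg
  have h1 : (Set.univ.pi fun j => (p j).rootSet ℂ).Finite :=
    Set.Finite.pi fun j => (p j).rootSet_finite ℂ
  refine (h1.preimage (f := fun (η : Fin n → ℂˣ) j => (η j : ℂ)) ?_).subset fun η hη => ?_
  · exact fun a _ b _ hab => funext fun j => Units.ext (congrFun hab j)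
  · obtain ⟨σ, rfl⟩ := hV η hη
    intro j _
    rw [Polynomial.mem_rootSet]
    refine ⟨hp j, ?_⟩
    have := Polynomial.aeval_algHom_apply σ.toAlgHom (ξ j : ℂ) (p j)
    rw [hpx, map_zero] at this
    exact this

/-- The linear form on coefficient families given by evaluation at `ξ`. -/
def linForm (A : Finset (Fin n → ℤ)) (ξ : Fin n → ℂˣ) : MvPolynomial (Fin n → ℤ) ℂ :=
  ∑ a ∈ A, MvPolynomial.C (chEval ξ a) * MvPolynomial.X a

/-- The evaluation form at `ξ`, normalized to have coefficient `1` at the exponent `a0`. -/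
def normForm (A : Finset (Fin n → ℤ)) (a0 : Fin n → ℤ) (ξ : Fin n → ℂˣ) :
    MvPolynomial (Fin n → ℤ) ℂ :=
  ∑ a ∈ A, MvPolynomial.C (chEval ξ (a - a0)) * MvPolynomial.X a

theorem linForm_eq (A : Finset (Fin n → ℤ)) (a0 : Fin n → ℤ) (ξ : Fin n → ℂˣ) :
    linForm A ξ = MvPolynomial.C (chEval ξ a0) * normForm A a0 ξ := by
  rw [linForm, normForm, Finset.mul_sum]
  refine Finset.sum_congr rfl fun a _ => ?_
  rw [← mul_assoc, ← map_mul, mul_comm (chEval ξ a0), chEval_sub_mul]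

theorem coeff_normForm (A : Finset (Fin n → ℤ)) (a0 : Fin n → ℤ) (ξ : Fin n → ℂˣ)
    (a : Fin n → ℤ) : MvPolynomial.coeff (Finsupp.single a 1) (normForm A a0 ξ) =
      if a ∈ A then chEval ξ (a - a0) else 0 := by
  classical
  simp only [normForm, MvPolynomial.coeff_sum, MvPolynomial.coeff_C_mul, MvPolynomial.coeff_X,
    Finsupp.single_left_inj one_ne_zero, mul_ite, mul_one, mul_zero, Finset.sum_ite_eq']

theorem normForm_congr {A : Finset (Fin n → ℤ)} {a0 : Fin n → ℤ} {ξ η : Fin n → ℂˣ} :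
    normForm A a0 ξ = normForm A a0 η ↔ ∀ a ∈ A, chEval ξ (a - a0) = chEval η (a - a0) := by
  constructor
  · intro h a ha
    have := congrArg (MvPolynomial.coeff (Finsupp.single a 1)) h
    simpa [coeff_normForm, ha] using this
  · intro h
    exact Finset.sum_congr rfl fun a ha => by rw [h a ha]

theorem map_normForm (σ : ℂ →+* ℂ) (A : Finset (Fin n → ℤ)) (a0 : Fin n → ℤ) (ξ : Fin n → ℂˣ) :
    MvPolynomial.map σ (normForm A a0 ξ) = normForm A a0 (conjPt σ ξ) := by
  simp [normForm, chEval_conjPt]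

theorem totalDegree_normForm_le (A : Finset (Fin n → ℤ)) (a0 : Fin n → ℤ) (ξ : Fin n → ℂˣ) :
    (normForm A a0 ξ).totalDegree ≤ 1 := by
  refine MvPolynomial.totalDegree_finsetSum_le fun a _ => ?_
  refine (MvPolynomial.totalDegree_mul _ _).trans ?_
  simp

theorem irreducible_normForm {A : Finset (Fin n → ℤ)} {a0 : Fin n → ℤ} (h0 : a0 ∈ A)
    (ξ : Fin n → ℂˣ) : Irreducible (normForm A a0 ξ) := by
  have hc : MvPolynomial.coeff (Finsupp.single a0 1) (normForm A a0 ξ) = 1 := by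
    simp [coeff_normForm, h0, chEval_zero]
  refine MvPolynomial.irreducible_of_totalDegree_eq_one
    (le_antisymm (totalDegree_normForm_le A a0 ξ) ?_) ?_
  · have := MvPolynomial.le_totalDegree (p := normForm A a0 ξ) (s := Finsupp.single a0 1)
      (by rw [MvPolynomial.mem_support_iff, hc]; exact one_ne_zero)
    simpa using this
  · intro x hx
    have := hx (Finsupp.single a0 1)
    rw [hc] at this
    exact isUnit_of_dvd_one this

theorem normForm_eq_of_dvd {A : Finset (Fin n → ℤ)} {a0 : Fin n → ℤ} (h0 : a0 ∈ A)
    {ξ η : Fin n → ℂˣ} (h : normForm A a0 ξ ∣ normForm A a0 η) :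
    normForm A a0 ξ = normForm A a0 η := by
  obtain ⟨q, hq⟩ := h
  have hu := ((irreducible_normForm h0 η).isUnit_or_isUnit hq).resolve_left
    (irreducible_normForm h0 ξ).not_isUnit
  obtain ⟨r, -, rfl⟩ := MvPolynomial.isUnit_iff_eq_C_of_isReduced.1 hu
  have := congrArg (MvPolynomial.coeff (Finsupp.single a0 1)) hq
  rw [mul_comm, MvPolynomial.coeff_C_mul] at this
  simp only [coeff_normForm, h0, if_true, sub_self, chEval_zero, mul_one] at this
  rw [hq, ← this, map_one, mul_one]

theorem eval_linForm (A : Finset (Fin n → ℤ)) (ξ : Fin n → ℂˣ)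
    (c : (Fin n → ℤ) → ℂ) :
    MvPolynomial.eval c (linForm A ξ) = ∑ a ∈ A, c a * chEval ξ a := by
  simp [linForm, mul_comm]

theorem eval_normForm_eq_zero_iff (A : Finset (Fin n → ℤ)) (a0 : Fin n → ℤ) (ξ : Fin n → ℂˣ)
    (c : (Fin n → ℤ) → ℂ) : MvPolynomial.eval c (normForm A a0 ξ) = 0 ↔
      ∑ a ∈ A, c a * chEval ξ a = 0 := by
  rw [← eval_linForm, linForm_eq A a0, map_mul, MvPolynomial.eval_C, mul_eq_zero,
    or_iff_right (chEval_ne_zero _ _)]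

open scoped Classical in
/-- The polynomial `∏ L` over a Galois-stable set of linear forms is defined over the fraction
field of `D`. -/
theorem exists_map_eq_C_mul_prod {D : Type} [CommRing D] [IsDomain D] [Countable D] [Algebra D ℂ]
    [FaithfulSMul D ℂ] {A : Finset (Fin n → ℤ)} {a0 : Fin n → ℤ}
    {V : Finset (Fin n → ℂˣ)}
    (hstab : ∀ σ : ℂ ≃ₐ[D] ℂ, ∀ ξ ∈ V, conjPt ((σ : ℂ ≃+* ℂ) : ℂ →+* ℂ) ξ ∈ V) :
    ∃ (Q : MvPolynomial (Fin n → ℤ) D) (B : ℂ), B ≠ 0 ∧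
      MvPolynomial.map (algebraMap D ℂ) Q =
        MvPolynomial.C B * ∏ p ∈ V.image (normForm A a0), p := by
  set Q0 := ∏ p ∈ V.image (normForm A a0), p with hQ0
  have hmap : ∀ σ : ℂ ≃ₐ[D] ℂ, MvPolynomial.map ((σ : ℂ ≃+* ℂ) : ℂ →+* ℂ) Q0 = Q0 := by
    intro σ
    have hinj : Function.Injective
        (MvPolynomial.map (σ := Fin n → ℤ) ((σ : ℂ ≃+* ℂ) : ℂ →+* ℂ)) :=
      MvPolynomial.map_injective _ (RingHom.injective _)
    have himg : (V.image (normForm A a0)).image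
        (MvPolynomial.map ((σ : ℂ ≃+* ℂ) : ℂ →+* ℂ)) = V.image (normForm A a0) := by
      refine Finset.eq_of_subset_of_card_le ?_ ?_
      · intro p hp
        simp only [Finset.mem_image] at hp ⊢
        obtain ⟨_, ⟨ξ, hξ, rfl⟩, rfl⟩ := hp
        exact ⟨_, hstab σ ξ hξ, (map_normForm _ A a0 ξ).symm⟩
      · rw [Finset.card_image_of_injective _ hinj]
    rw [hQ0, map_prod]
    conv_rhs => rw [← himg, Finset.prod_image fun x _ y _ h => hinj h]
  have hfix : ∀ m, ∃ a b : D, b ≠ 0 ∧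
      algebraMap D ℂ b * MvPolynomial.coeff m Q0 = algebraMap D ℂ a := by
    intro m
    refine exists_smul_eq_algebraMap_of_fixed _ fun σ => ?_
    have := congrArg (MvPolynomial.coeff m) (hmap σ)
    rwa [MvPolynomial.coeff_map] at this
  choose a b hb hab using hfix
  have hinj := FaithfulSMul.algebraMap_injective D ℂ
  have hrange : MvPolynomial.C (algebraMap D ℂ (∏ m ∈ Q0.support, b m)) * Q0 ∈
      Set.range (MvPolynomial.map (algebraMap D ℂ)) := by
    rw [MvPolynomial.mem_range_map_iff_coeffs_subset]
    intro x hx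
    obtain ⟨m, -, rfl⟩ := (MvPolynomial.mem_coeffs_iff).1 hx
    rw [MvPolynomial.coeff_C_mul]
    by_cases hm : m ∈ Q0.support
    · rw [← Finset.mul_prod_erase _ _ hm, mul_comm (b m), map_mul, mul_assoc, hab, ← map_mul]
      exact ⟨_, rfl⟩
    · rw [MvPolynomial.notMem_support_iff.1 hm, mul_zero]
      exact ⟨0, map_zero _⟩
  obtain ⟨Q, hQ⟩ := hrange
  refine ⟨Q, _, ?_, hQ⟩
  rw [Ne, map_eq_zero_iff _ hinj]
  exact Finset.prod_ne_zero_iff.2 fun m _ => hb m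

open scoped Classical in
/-- The norm of a linear form generates, up to multiplicity, the ideal of a generic zero. -/
theorem exists_irreducible_map_pow_eq {D : Type} [CommRing D] [IsDomain D]
    [UniqueFactorizationMonoid D] [Countable D] [Algebra D ℂ]
    [FaithfulSMul D ℂ] {A : Finset (Fin n → ℤ)} {a0 : Fin n → ℤ} (h0 : a0 ∈ A)
    {V : Finset (Fin n → ℂˣ)}
    (hstab : ∀ σ : ℂ ≃ₐ[D] ℂ, ∀ ξ ∈ V, conjPt ((σ : ℂ ≃+* ℂ) : ℂ →+* ℂ) ξ ∈ V)
    (htrans : ∀ ξ ∈ V, ∀ η ∈ V, ∃ σ : ℂ ≃ₐ[D] ℂ, conjPt ((σ : ℂ ≃+* ℂ) : ℂ →+* ℂ) ξ = η)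
    {c : (Fin n → ℤ) → ℂ} {ξ : Fin n → ℂˣ} (hξ : ξ ∈ V)
    (hcξ : ∑ a ∈ A, c a * chEval ξ a = 0)
    (hc : AlgebraicIndependent D fun a : {a // a ≠ a0} => c a)
    (hnd : ∀ η ∈ V, ∑ a ∈ A, c a * chEval η a = 0 →
      ∀ a ∈ A, chEval η (a - a0) = chEval ξ (a - a0)) :
    ∃ S : MvPolynomial (Fin n → ℤ) D, Irreducible S ∧
      (∀ h, MvPolynomial.aeval c h = 0 ↔ S ∣ h) ∧
      ∃ κ : ℂ, κ ≠ 0 ∧ MvPolynomial.map (algebraMap D ℂ) S ^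
          (V.filter fun η => ∑ a ∈ A, c a * chEval η a = 0).card =
        MvPolynomial.C κ * ∏ η ∈ V, linForm A η := by
  obtain ⟨Q, B, hB, hQ⟩ := exists_map_eq_C_mul_prod (A := A) (a0 := a0) hstab
  have hinj := FaithfulSMul.algebraMap_injective D ℂ
  set Q0 := ∏ p ∈ V.image (normForm A a0), p with hQ0
  have haev : ∀ h : MvPolynomial (Fin n → ℤ) D, MvPolynomial.aeval c h =
      MvPolynomial.eval c (MvPolynomial.map (algebraMap D ℂ) h) := by
    intro h
    rw [MvPolynomial.eval_map, MvPolynomial.aeval_def]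
  have hmapinj := MvPolynomial.map_injective (σ := Fin n → ℤ) _ hinj
  have hQ00 : Q0 ≠ 0 := by
    refine Finset.prod_ne_zero_iff.2 fun p hp => ?_
    obtain ⟨η, -, rfl⟩ := Finset.mem_image.1 hp
    exact (irreducible_normForm h0 η).ne_zero
  have hQne : Q ≠ 0 := by
    rintro rfl
    rw [map_zero] at hQ
    exact mul_ne_zero (MvPolynomial.C_ne_zero.2 hB) hQ00 hQ.symm
  have hQc : MvPolynomial.aeval c Q = 0 := by
    rw [haev, hQ, map_mul, map_prod]
    refine mul_eq_zero_of_right _ (Finset.prod_eq_zero (Finset.mem_image_of_mem _ hξ) ?_)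
    rwa [eval_normForm_eq_zero_iff]
  obtain ⟨S, hS, hSQ, hSc⟩ : ∃ S, Irreducible S ∧ S ∣ Q ∧ MvPolynomial.aeval c S = 0 := by
    obtain ⟨f, hf, hfQ⟩ := WfDvdMonoid.exists_factors Q hQne
    have : MvPolynomial.aeval c f.prod = 0 := by
      obtain ⟨u, hu⟩ := hfQ
      rw [← hu, map_mul] at hQc
      exact (mul_eq_zero.1 hQc).resolve_right ((u.isUnit.map _).ne_zero)
    rw [map_multiset_prod, Multiset.prod_eq_zero_iff, Multiset.mem_map] at this
    obtain ⟨S, hSf, hSc⟩ := this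
    exact ⟨S, hf S hSf, (Multiset.dvd_prod hSf).trans hfQ.dvd, hSc⟩
  refine ⟨S, hS, fun h => ⟨fun hh =>
    MvPolynomial.dvd_of_irreducible_of_aeval_eq_zero a0 hc hS hSc hh, ?_⟩, ?_⟩
  · rintro ⟨q, rfl⟩
    rw [map_mul, hSc, zero_mul]
  set T := MvPolynomial.map (algebraMap D ℂ) S with hT
  have hT0 : T ≠ 0 := (map_ne_zero_iff _ hmapinj).2 hS.ne_zero
  have hTc : MvPolynomial.eval c T = 0 := by rw [hT, ← haev, hSc]
  have hTQ : T ∣ MvPolynomial.C B * Q0 := hQ ▸ map_dvd _ hSQ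
  have hBu : IsUnit (MvPolynomial.C B : MvPolynomial (Fin n → ℤ) ℂ) :=
    (IsUnit.mk0 B hB).map _
  have hTQ0 : T ∣ Q0 := (hBu.dvd_mul_left).1 hTQ
  have hTnu : ¬ IsUnit T := by
    intro hu
    obtain ⟨r, hr, hTr⟩ := MvPolynomial.isUnit_iff_eq_C_of_isReduced.1 hu
    rw [hTr, MvPolynomial.eval_C] at hTc
    exact hr.ne_zero hTc
  obtain ⟨p, hp, hpT⟩ := WfDvdMonoid.exists_irreducible_factor hTnu hT0
  obtain ⟨η, hη, hηT⟩ : ∃ η ∈ V, normForm A a0 η ∣ T := by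
    obtain ⟨q, hq, hpq⟩ := (hp.prime.dvd_finsetProd_iff _).1 (hpT.trans hTQ0)
    obtain ⟨η, hη, rfl⟩ := Finset.mem_image.1 hq
    exact ⟨η, hη, (hp.dvd_symm (irreducible_normForm h0 η) hpq).trans hpT⟩
  have hall : ∀ η' ∈ V, normForm A a0 η' ∣ T := by
    intro η' hη'
    obtain ⟨σ, rfl⟩ := htrans η hη η' hη'
    have := map_dvd (MvPolynomial.map ((σ : ℂ ≃+* ℂ) : ℂ →+* ℂ)) hηT
    rw [map_normForm, hT, MvPolynomial.map_map] at this
    convert this using 3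
    ext d
    exact (σ.commutes d).symm
  have hQT : Q0 ∣ T := by
    refine Finset.prod_dvd_of_isRelPrime (fun p hp q hq hpq => ?_) fun p hp => ?_
    · obtain ⟨η, hη, rfl⟩ := Finset.mem_image.1 hp
      obtain ⟨η', hη', rfl⟩ := Finset.mem_image.1 hq
      exact ((irreducible_normForm h0 η).isRelPrime_iff_not_dvd).2
        fun h => hpq (normForm_eq_of_dvd h0 h)
    · obtain ⟨η, hη, rfl⟩ := Finset.mem_image.1 hp
      exact hall η hη
  obtain ⟨u, hu⟩ := associated_of_dvd_dvd hQT hTQ0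
  obtain ⟨r, hr, hur⟩ := MvPolynomial.isUnit_iff_eq_C_of_isReduced.1 u.isUnit
  set d := (V.filter fun η => ∑ a ∈ A, c a * chEval η a = 0).card with hd
  have hfib : ∀ p ∈ V.image (normForm A a0), (V.filter fun η => normForm A a0 η = p).card = d := by
    have hbase : (V.filter fun η => normForm A a0 η = normForm A a0 ξ).card = d := by
      rw [hd]
      congr 1
      refine Finset.filter_congr fun η hη => ⟨fun h => ?_, fun h => ?_⟩
      · rw [← eval_normForm_eq_zero_iff A a0, h, eval_normForm_eq_zero_iff, hcξ]
      · exact normForm_congr.2 (hnd η hη h)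
    intro p hp
    obtain ⟨η, hη, rfl⟩ := Finset.mem_image.1 hp
    obtain ⟨σ, rfl⟩ := htrans ξ hξ η hη
    rw [← hbase]
    refine le_antisymm ?_ ?_
    · refine Finset.card_le_card_of_injOn (conjPt ((σ.symm : ℂ ≃+* ℂ) : ℂ →+* ℂ)) ?_
        ((conjPt_injective _).injOn)
      intro η' hη'
      simp only [Finset.coe_filter, Set.mem_ofPred_eq] at hη' ⊢
      refine ⟨hstab _ _ hη'.1, ?_⟩
      rw [← map_normForm, hη'.2, map_normForm]
      congr 1
      ext j
      exact σ.symm_apply_apply _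
    · refine Finset.card_le_card_of_injOn (conjPt ((σ : ℂ ≃+* ℂ) : ℂ →+* ℂ)) ?_
        ((conjPt_injective _).injOn)
      intro η' hη'
      simp only [Finset.coe_filter, Set.mem_ofPred_eq] at hη' ⊢
      exact ⟨hstab _ _ hη'.1, by rw [← map_normForm, hη'.2, map_normForm]⟩
  have hprod : ∏ η ∈ V, normForm A a0 η = Q0 ^ d := by
    rw [hQ0, ← Finset.prod_pow, ← Finset.prod_fiberwise_of_maps_to
      (g := normForm A a0) (t := V.image (normForm A a0))
      (fun η hη => Finset.mem_image_of_mem _ hη)]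
    refine Finset.prod_congr rfl fun p hp => ?_
    rw [Finset.prod_congr rfl (g := fun _ => p) fun η hη => (Finset.mem_filter.1 hη).2,
      Finset.prod_const, hfib p hp]
  have hchar : ∏ η ∈ V, chEval η a0 ≠ 0 :=
    Finset.prod_ne_zero_iff.2 fun η _ => chEval_ne_zero η a0
  refine ⟨r ^ d * (∏ η ∈ V, chEval η a0)⁻¹, mul_ne_zero (pow_ne_zero _ hr.ne_zero)
    (inv_ne_zero hchar), ?_⟩
  rw [Finset.prod_congr rfl fun η _ => linForm_eq A a0 η, Finset.prod_mul_distrib, ← map_prod,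
    hprod, ← mul_assoc, ← map_mul, mul_assoc, inv_mul_cancel₀ hchar, mul_one, ← hu, hur,
    mul_pow, map_pow, mul_comm]

/-- A polynomial over a valued field is primitive if its coefficients are integral and not all
in the maximal ideal. -/
def IsPrimitiveFor {ι : Type*} {K : Type*} [Field K] (O : ValuationSubring K)
    (p : MvPolynomial ι K) : Prop :=
  ∃ f : MvPolynomial ι O, MvPolynomial.map O.subtype f = p ∧
    MvPolynomial.map (IsLocalRing.residue O) f ≠ 0

namespace IsPrimitiveFor

variable {ι K : Type*} [Field K] {O : ValuationSubring K} {p q : MvPolynomial ι K}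

theorem one : IsPrimitiveFor O (1 : MvPolynomial ι K) := ⟨1, by simp, by simp⟩

theorem mul (hp : IsPrimitiveFor O p) (hq : IsPrimitiveFor O q) : IsPrimitiveFor O (p * q) := by
  obtain ⟨f, rfl, hf⟩ := hp
  obtain ⟨g, rfl, hg⟩ := hq
  exact ⟨f * g, map_mul _ _ _, by rw [map_mul]; exact mul_ne_zero hf hg⟩

theorem pow (hp : IsPrimitiveFor O p) (d : ℕ) : IsPrimitiveFor O (p ^ d) := by
  induction d with
  | zero => simpa using one
  | succ d ih => rw [pow_succ]; exact ih.mul hp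

theorem prod {J : Type*} (s : Finset J) (f : J → MvPolynomial ι K)
    (h : ∀ j ∈ s, IsPrimitiveFor O (f j)) : IsPrimitiveFor O (∏ j ∈ s, f j) :=
  Finset.prod_induction f _ (fun _ _ => mul) one h

theorem of_coeff (h : ∀ m, MvPolynomial.coeff m p ∈ O) {m : ι →₀ ℕ}
    (hm : O.valuation (MvPolynomial.coeff m p) = 1) : IsPrimitiveFor O p := by
  obtain ⟨f, rfl⟩ : ∃ f, MvPolynomial.map O.subtype f = p := by
    change p ∈ Set.range _
    rw [MvPolynomial.mem_range_map_iff_coeffs_subset]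
    intro x hx
    obtain ⟨m, -, rfl⟩ := (MvPolynomial.mem_coeffs_iff).1 hx
    exact ⟨⟨_, h m⟩, rfl⟩
  refine ⟨f, rfl, fun h0 => ?_⟩
  have := congrArg (MvPolynomial.coeff m) h0
  rw [MvPolynomial.coeff_map, MvPolynomial.coeff_zero, IsLocalRing.residue_eq_zero_iff,
    O.valuation_lt_one_iff] at this
  rw [MvPolynomial.coeff_map] at hm
  exact this.ne hm

theorem valuation_le_one {x : K} (hp : IsPrimitiveFor O p)
    (hq : IsPrimitiveFor O (MvPolynomial.C x * p)) (hx : x ∈ O) : O.valuation x = 1 := by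
  obtain ⟨f, rfl, -⟩ := hp
  obtain ⟨g, hg, hg0⟩ := hq
  have hgf : g = MvPolynomial.C ⟨x, hx⟩ * f := by
    refine MvPolynomial.map_injective O.subtype Subtype.val_injective ?_
    rw [hg, map_mul, MvPolynomial.map_C]
    rfl
  refine (O.valuation_lt_one_or_eq_one ⟨x, hx⟩).resolve_left fun h => hg0 ?_
  rw [hgf, map_mul, MvPolynomial.map_C, (IsLocalRing.residue_eq_zero_iff _).2
    ((O.valuation_lt_one_iff _).2 h), map_zero, zero_mul]

theorem valuation_eq_one {x : K} (hp : IsPrimitiveFor O p)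
    (hq : IsPrimitiveFor O (MvPolynomial.C x * p)) : O.valuation x = 1 := by
  rcases O.mem_or_inv_mem x with hx | hx
  · exact valuation_le_one hp hq hx
  · have hx0 : x ≠ 0 := by
      rintro rfl
      obtain ⟨f, hf, hf0⟩ := hq
      rw [map_zero, zero_mul, ← map_zero (MvPolynomial.map O.subtype)] at hf
      rw [MvPolynomial.map_injective O.subtype Subtype.val_injective hf, map_zero] at hf0
      exact hf0 rfl
    have := valuation_le_one (x := x⁻¹) hq
      (by rwa [← mul_assoc, ← map_mul, inv_mul_cancel₀ hx0, map_one, one_mul]) hx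
    rwa [map_inv₀, inv_eq_one] at this

end IsPrimitiveFor

theorem exists_dominant (O : ValuationSubring ℂ) {A : Finset (Fin n → ℤ)} (hA : A.Nonempty)
    (ξ : Fin n → ℂˣ) : ∃ s ∈ A, ∀ a ∈ A, chEval ξ (a - s) ∈ O := by
  obtain ⟨s, hs, h⟩ := A.exists_max_image (fun a => O.valuation (chEval ξ a)) hA
  refine ⟨s, hs, fun a ha => ?_⟩
  rw [← O.valuation_le_one_iff]
  have := h a ha
  rw [← chEval_sub_mul ξ a s, map_mul] at this
  exact (mul_le_iff_le_one_left (zero_lt_iff.2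
    ((map_ne_zero _).2 (chEval_ne_zero ξ s)))).1 this

theorem isPrimitiveFor_normForm {O : ValuationSubring ℂ} {A : Finset (Fin n → ℤ)}
    {s : Fin n → ℤ} (hs : s ∈ A) {ξ : Fin n → ℂˣ} (h : ∀ a ∈ A, chEval ξ (a - s) ∈ O) :
    IsPrimitiveFor O (normForm A s ξ) := by
  refine ⟨∑ a ∈ A.attach, MvPolynomial.C ⟨chEval ξ (a - s), h a a.2⟩ * MvPolynomial.X a.1,
    ?_, fun h0 => ?_⟩
  · rw [normForm, ← Finset.sum_attach A]
    simp
  · have := congrArg (MvPolynomial.eval (Pi.single s 1)) h0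
    rw [map_zero, map_sum, map_sum, Finset.sum_eq_single ⟨s, hs⟩] at this
    · simp only [map_mul, MvPolynomial.map_C, MvPolynomial.map_X, MvPolynomial.eval_C,
        MvPolynomial.eval_X, Pi.single_eq_same, mul_one] at this
      rw [IsLocalRing.residue_eq_zero_iff, O.valuation_lt_one_iff] at this
      simp [chEval_zero] at this
    · intro b _ hb
      have : (b : Fin n → ℤ) ≠ s := fun h => hb (Subtype.ext h)
      simp [this]
    · simp

theorem valuation_mul_prod_eq_one {O : ValuationSubring ℂ} {A : Finset (Fin n → ℤ)}
    {V : Finset (Fin n → ℂˣ)} {s : (Fin n → ℂˣ) → Fin n → ℤ} (hs : ∀ ξ, s ξ ∈ A)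
    (h : ∀ ξ, ∀ a ∈ A, chEval ξ (a - s ξ) ∈ O) {κ : ℂ}
    (hp : IsPrimitiveFor O (MvPolynomial.C κ * ∏ ξ ∈ V, linForm A ξ)) :
    O.valuation κ * O.valuation (∏ ξ ∈ V, chEval ξ (s ξ)) = 1 := by
  rw [Finset.prod_congr rfl fun ξ _ => linForm_eq A (s ξ) ξ, Finset.prod_mul_distrib, ← map_prod,
    ← mul_assoc, ← map_mul] at hp
  rw [← map_mul]
  exact (IsPrimitiveFor.prod V _ fun ξ _ => isPrimitiveFor_normForm (hs ξ) (h ξ)).valuation_eq_one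
    hp

/-- The valuations of the leading constants of primitive products of linear forms are
multiplicative under addition of supports. -/
theorem valuation_sum_eq_mul {O : ValuationSubring ℂ} {A A' : Finset (Fin n → ℤ)}
    (hA : A.Nonempty) (hA' : A'.Nonempty) {V : Finset (Fin n → ℂˣ)} {κ κ' κs : ℂ}
    (hp : IsPrimitiveFor O (MvPolynomial.C κ * ∏ ξ ∈ V, linForm A ξ))
    (hp' : IsPrimitiveFor O (MvPolynomial.C κ' * ∏ ξ ∈ V, linForm A' ξ))
    (hps : IsPrimitiveFor O (MvPolynomial.C κs * ∏ ξ ∈ V, linForm (A + A') ξ)) :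
    O.valuation κs = O.valuation κ * O.valuation κ' := by
  choose s hs h using fun ξ : Fin n → ℂˣ => exists_dominant O hA ξ
  choose s' hs' h' using fun ξ : Fin n → ℂˣ => exists_dominant O hA' ξ
  have e := valuation_mul_prod_eq_one hs h hp
  have e' := valuation_mul_prod_eq_one hs' h' hp'
  have es := valuation_mul_prod_eq_one (s := fun ξ => s ξ + s' ξ)
    (fun ξ => Finset.add_mem_add (hs ξ) (hs' ξ)) (fun ξ a ha => by
      obtain ⟨b, hb, b', hb', rfl⟩ := Finset.mem_add.1 ha
      rw [add_sub_add_comm, chEval_add]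
      exact mul_mem (h ξ b hb) (h' ξ b' hb')) hps
  simp only [chEval_add, Finset.prod_mul_distrib, map_mul] at es
  have hx : O.valuation (∏ ξ ∈ V, chEval ξ (s ξ)) ≠ 0 := right_ne_zero_of_mul_eq_one e
  have hx' : O.valuation (∏ ξ ∈ V, chEval ξ (s' ξ)) ≠ 0 := right_ne_zero_of_mul_eq_one e'
  refine mul_right_cancel₀ (mul_ne_zero hx hx') (es.trans ?_)
  rw [mul_mul_mul_comm, e, e', one_mul]

theorem exists_valuationSubring_of_prime {D : Type*} [CommRing D] [IsDomain D] {K : Type*}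
    [Field K] [Algebra D K] [FaithfulSMul D K] {p : D} (hp : Prime p) :
    ∃ O : ValuationSubring K, (∀ d, algebraMap D K d ∈ O) ∧
      (∀ d, ¬ p ∣ d → O.valuation (algebraMap D K d) = 1) ∧
      O.valuation (algebraMap D K p) < 1 := by
  have hinj := FaithfulSMul.algebraMap_injective D K
  let P : Ideal D := Ideal.span {p}
  have hP : P.IsPrime := (Ideal.span_singleton_prime hp.ne_zero).2 hp
  have hunit : ∀ y : P.primeCompl, IsUnit (algebraMap D K y) := fun y => by
    rw [isUnit_iff_ne_zero, Ne, map_eq_zero_iff _ hinj]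
    rintro h
    exact y.2 (h ▸ P.zero_mem)
  let f : Localization.AtPrime P →+* K := IsLocalization.lift (M := P.primeCompl) hunit
  have hf : ∀ d, f (algebraMap D _ d) = algebraMap D K d := IsLocalization.lift_eq hunit
  have hfinj : Function.Injective f := by
    rw [IsLocalization.lift_injective_iff]
    intro x y
    rw [hinj.eq_iff, (IsLocalization.injective _ P.primeCompl_le_nonZeroDivisors).eq_iff]
  let I := (IsLocalRing.maximalIdeal (Localization.AtPrime P)).map f.rangeRestrict
  have hI : I ≠ ⊤ := by
    intro h
    obtain ⟨y, hy, hy1⟩ := (Ideal.mem_map_iff_of_surjective _ f.rangeRestrict_surjective).1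
      ((Ideal.eq_top_iff_one _).1 h)
    have : y = 1 := hfinj (by rw [map_one]; exact congrArg Subtype.val hy1)
    exact (IsLocalRing.maximalIdeal.isMaximal _).ne_top ((Ideal.eq_top_iff_one _).2 (this ▸ hy))
  obtain ⟨O, hO, hOI⟩ := Ideal.image_subset_nonunits_valuationSubring I hI
  have hfO : ∀ y, f y ∈ O := fun y => hO ⟨y, rfl⟩
  refine ⟨O, fun d => hf d ▸ hfO _, fun d hd => ?_, ?_⟩
  · have hu : IsUnit (algebraMap D (Localization.AtPrime P) d) :=
      IsLocalization.map_units (M := P.primeCompl) _ ⟨d, fun h => hd (Ideal.mem_span_singleton.1 h)⟩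
    obtain ⟨u, hu⟩ := hu
    have h1 := (O.valuation_le_one_iff _).2 (hfO (u : Localization.AtPrime P))
    have h2 := (O.valuation_le_one_iff _).2 (hfO ((u⁻¹ : (Localization.AtPrime P)ˣ) : _))
    have h3 : O.valuation (f u) * O.valuation (f ((u⁻¹ : (Localization.AtPrime P)ˣ) : _)) = 1 := by
      rw [← map_mul, ← map_mul, Units.mul_inv, map_one, map_one]
    rw [← hf, ← hu]
    refine le_antisymm h1 ?_
    rw [← h3]
    exact mul_le_of_le_one_right' h2
  · rw [← O.mem_nonunits_iff]
    refine hOI ⟨f.rangeRestrict (algebraMap D _ p), Ideal.mem_map_of_mem _ ?_, hf p⟩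
    rw [← IsLocalization.AtPrime.map_eq_maximalIdeal P]
    exact Ideal.mem_map_of_mem _ (Ideal.mem_span_singleton_self p)

/-- An element of the fraction field of a factorial ring having trivial valuation at all primes
is a unit. -/
theorem exists_unit_of_valuation_eq_one {D : Type*} [CommRing D] [IsDomain D]
    [UniqueFactorizationMonoid D] {K : Type*}
    [Field K] [Algebra D K] [FaithfulSMul D K] {ρ : K} {x y : D} (hx : x ≠ 0) (hy : y ≠ 0)
    (h : ρ * algebraMap D K x = algebraMap D K y)
    (hv : ∀ p : D, Prime p → ∀ O : ValuationSubring K, (∀ d, algebraMap D K d ∈ O) →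
      (∀ d, ¬ p ∣ d → O.valuation (algebraMap D K d) = 1) → O.valuation ρ = 1) :
    ∃ u : Dˣ, ρ = algebraMap D K u := by
  have hinj := FaithfulSMul.algebraMap_injective D K
  obtain ⟨a, b, c, hab, rfl, rfl⟩ := UniqueFactorizationMonoid.exists_reduced_factors x hx y
  have hc : algebraMap D K c ≠ 0 := (map_ne_zero_iff _ hinj).2 (left_ne_zero_of_mul hx)
  have ha0 : a ≠ 0 := right_ne_zero_of_mul hx
  have hb0 : b ≠ 0 := right_ne_zero_of_mul hy
  have hρ : ρ * algebraMap D K a = algebraMap D K b := by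
    rw [map_mul, map_mul] at h
    exact mul_left_cancel₀ hc (by rw [← h]; ring)
  have key : ∀ p : D, Prime p → (p ∣ a ↔ p ∣ b) := by
    intro p hp
    obtain ⟨O, hO, hO1, hOp⟩ := exists_valuationSubring_of_prime (K := K) hp
    have h1 := congrArg O.valuation hρ
    rw [map_mul, hv p hp O hO hO1, one_mul] at h1
    have : ∀ d, p ∣ d ↔ O.valuation (algebraMap D K d) < 1 := by
      refine fun d => ⟨?_, fun hd => by_contra fun hpd => hd.ne (hO1 d hpd)⟩
      rintro ⟨e, rfl⟩
      rw [map_mul, map_mul]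
      exact mul_lt_one_of_lt_of_le hOp ((O.valuation_le_one_iff _).2 (hO e))
    rw [this, this, h1]
  have hua : IsUnit a := by
    by_contra hua
    obtain ⟨p, hp, hpa⟩ := WfDvdMonoid.exists_irreducible_factor hua ha0
    exact hp.not_isUnit (hab hpa ((key p hp.prime).1 hpa))
  have hub : IsUnit b := by
    by_contra hub
    obtain ⟨p, hp, hpb⟩ := WfDvdMonoid.exists_irreducible_factor hub hb0
    exact hp.not_isUnit (hab ((key p hp.prime).2 hpb) hpb)
  obtain ⟨u, rfl⟩ := hua
  obtain ⟨w, rfl⟩ := hub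
  refine ⟨w * u⁻¹, ?_⟩
  rw [Units.val_mul, map_mul, ← hρ, mul_assoc, ← map_mul, Units.mul_inv, map_one, mul_one]

theorem isPrimitiveFor_map_of_irreducible {D : Type*} [CommRing D] [IsDomain D] {K : Type*}
    [Field K] [Algebra D K] [FaithfulSMul D K] {ι : Type*} {S : MvPolynomial ι D}
    (hS : Irreducible S) {c : ι → K} (hc : MvPolynomial.aeval c S = 0) {p : D} (hp : Prime p)
    {O : ValuationSubring K} (hO : ∀ d, algebraMap D K d ∈ O)
    (hO1 : ∀ d, ¬ p ∣ d → O.valuation (algebraMap D K d) = 1) :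
    IsPrimitiveFor O (MvPolynomial.map (algebraMap D K) S) := by
  obtain ⟨m, hm⟩ : ∃ m, ¬ p ∣ MvPolynomial.coeff m S := by
    by_contra! hall
    obtain ⟨q, rfl⟩ := (MvPolynomial.C_dvd_iff_dvd_coeff p S).2 hall
    rcases hS.isUnit_or_isUnit rfl with hu | hu
    · exact hp.not_isUnit (by simpa using hu.map MvPolynomial.constantCoeff)
    · rw [map_mul, MvPolynomial.aeval_C, mul_eq_zero] at hc
      refine hc.elim (fun h => hp.ne_zero ?_) (hu.map _).ne_zero
      exact (map_eq_zero_iff _ (FaithfulSMul.algebraMap_injective D K)).1 h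
  refine IsPrimitiveFor.of_coeff (m := m) (fun m => ?_) ?_
  · rw [MvPolynomial.coeff_map]
    exact hO _
  · rw [MvPolynomial.coeff_map]
    exact hO1 _ hm

theorem IsAlgebraic.of_range_subset {D D' K : Type*} [CommRing D] [CommRing D'] [Field K]
    [Algebra D K] [Algebra D' K] [FaithfulSMul D' K]
    (h : Set.range (algebraMap D' K) ⊆ Set.range (algebraMap D K)) {x : K}
    (hx : IsAlgebraic D' x) : IsAlgebraic D x := by
  obtain ⟨p, hp, hpx⟩ := hx
  obtain ⟨q, hq⟩ : ∃ q, Polynomial.map (algebraMap D K) q = Polynomial.map (algebraMap D' K) p := by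
    rw [← Polynomial.mem_lifts, Polynomial.lifts_iff_coeff_lifts]
    intro m
    rw [Polynomial.coeff_map]
    exact h ⟨_, rfl⟩
  refine ⟨q, ?_, ?_⟩
  · rintro rfl
    rw [Polynomial.map_zero, eq_comm,
      Polynomial.map_eq_zero_iff (FaithfulSMul.algebraMap_injective D' K)] at hq
    exact hp hq
  · rw [Polynomial.aeval_def, ← Polynomial.eval_map, hq, Polynomial.eval_map,
      ← Polynomial.aeval_def, hpx]

theorem AlgebraicIndependent.of_range_subset {ι D D' K : Type*} [CommRing D] [CommRing D']
    [Field K] [Algebra D K] [Algebra D' K] [FaithfulSMul D K]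
    (h : Set.range (algebraMap D K) ⊆ Set.range (algebraMap D' K)) {x : ι → K}
    (hx : AlgebraicIndependent D' x) : AlgebraicIndependent D x := by
  rw [algebraicIndependent_iff] at hx ⊢
  intro p hp
  obtain ⟨q, hq⟩ : ∃ q, MvPolynomial.map (algebraMap D' K) q =
      MvPolynomial.map (algebraMap D K) p := by
    change MvPolynomial.map (algebraMap D K) p ∈ Set.range _
    rw [MvPolynomial.mem_range_map_iff_coeffs_subset]
    intro y hy
    obtain ⟨m, -, rfl⟩ := (MvPolynomial.mem_coeffs_iff).1 hy
    rw [MvPolynomial.coeff_map]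
    exact h ⟨_, rfl⟩
  have hq0 : q = 0 := by
    refine hx q ?_
    rw [MvPolynomial.aeval_def, ← MvPolynomial.eval_map, hq, MvPolynomial.eval_map,
      ← MvPolynomial.aeval_def, hp]
  rw [hq0, map_zero] at hq
  exact MvPolynomial.map_injective _ (FaithfulSMul.algebraMap_injective D K)
    (hq.symm.trans (map_zero _).symm)

/-- Variables independent of `w` stay independent over any ring algebraic over `ℤ[w]`. -/
theorem AlgebraicIndependent.of_forall_isAlgebraic {I J D K : Type*} [CommRing D]
    [Field K] [CharZero K] [Algebra D K] [FaithfulSMul D K] {x : I → K} {w : J → K}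
    (h : AlgebraicIndependent ℤ (Sum.elim x w))
    (hD : ∀ d, IsAlgebraic (Algebra.adjoin ℤ (Set.range w)) (algebraMap D K d)) :
    AlgebraicIndependent D x := by
  have h1 := (AlgebraicIndependent.sumElim_iff.1 h).2.subalgebraAlgebraicClosure
  refine h1.of_range_subset ?_
  rintro _ ⟨d, rfl⟩
  exact ⟨⟨_, (Subalgebra.mem_algebraicClosure _ _).2 (hD d)⟩, rfl⟩

theorem eq_zero_of_sum_mul_eq_zero {I D : Type*} [CommRing D] [IsDomain D] [Algebra D ℂ]
    {x : I → ℂ} (hx : AlgebraicIndependent D x)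
    {s : Finset I} {w : I → ℂ} (hw : ∀ i ∈ s, IsAlgebraic D (w i))
    (h : ∑ i ∈ s, x i * w i = 0) : ∀ i ∈ s, w i = 0 := by
  classical
  have h1 := linearIndependent_iff'.1 hx.subalgebraAlgebraicClosure.linearIndependent s
    (fun i => if hi : i ∈ s then
      ⟨w i, (Subalgebra.mem_algebraicClosure _ _).2 (hw i hi)⟩ else 0) ?_
  · intro i hi
    have := congrArg Subtype.val (h1 i hi)
    simpa [hi] using this
  · rw [← h]
    refine Finset.sum_congr rfl fun i hi => ?_
    rw [dif_pos hi, Algebra.smul_def, mul_comm]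
    rfl

/-- One row of `fillIn`. -/
def fillRow (A : Finset (Fin n → ℤ)) (b : Fin n → ℤ) (ξ : Fin n → ℂˣ) (u : (Fin n → ℤ) → ℂ) :
    (Fin n → ℤ) → ℂ :=
  fun a => if a = b then -∑ a' ∈ A.erase b, u a' * chEval ξ (a' - b) else u a

theorem fillIn_cons (A0 : Finset (Fin n → ℤ)) (Ar : Fin n → Finset (Fin n → ℤ))
    (b0 : Fin n → ℤ) (br : Fin n → Fin n → ℤ) (ξ : Fin n → ℂˣ)
    (u : Fin (n + 1) → (Fin n → ℤ) → ℂ) :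
    fillIn (Fin.cons A0 Ar) (Fin.cons b0 br) ξ u =
      Fin.cons (fillRow A0 b0 ξ (u 0)) fun i => fillRow (Ar i) (br i) ξ (u i.succ) := by
  funext i
  refine Fin.cases ?_ (fun i => ?_) i <;> rfl

theorem fillRow_of_ne {A : Finset (Fin n → ℤ)} {a b : Fin n → ℤ} {ξ : Fin n → ℂˣ}
    {u : (Fin n → ℤ) → ℂ} (h : a ≠ b) : fillRow A b ξ u a = u a := if_neg h

theorem sum_fillRow {A : Finset (Fin n → ℤ)} {b : Fin n → ℤ} (hb : b ∈ A) (ξ η : Fin n → ℂˣ)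
    (u : (Fin n → ℤ) → ℂ) :
    ∑ a ∈ A, fillRow A b ξ u a * chEval η a =
      chEval η b * ∑ a ∈ A.erase b, u a * (chEval η (a - b) - chEval ξ (a - b)) := by
  rw [← Finset.add_sum_erase _ _ hb]
  have : ∑ a ∈ A.erase b, fillRow A b ξ u a * chEval η a =
      ∑ a ∈ A.erase b, u a * (chEval η (a - b) * chEval η b) := by
    refine Finset.sum_congr rfl fun a ha => ?_
    rw [fillRow_of_ne (Finset.ne_of_mem_erase ha), chEval_sub_mul]
  rw [this, fillRow, if_pos rfl]
  simp only [mul_sub, Finset.sum_sub_distrib, Finset.mul_sum]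
  rw [neg_mul, Finset.sum_mul, neg_add_eq_sub]
  congr 1 <;> exact Finset.sum_congr rfl fun a _ => by ring

theorem sum_fillRow_self {A : Finset (Fin n → ℤ)} {b : Fin n → ℤ} (hb : b ∈ A) (ξ : Fin n → ℂˣ)
    (u : (Fin n → ℤ) → ℂ) : ∑ a ∈ A, fillRow A b ξ u a * chEval ξ a = 0 := by
  simp [sum_fillRow hb]

theorem chEval_eq_of_sum_fillRow_eq_zero {D : Type*} [CommRing D] [IsDomain D] [Algebra D ℂ]
    {A : Finset (Fin n → ℤ)} {b : Fin n → ℤ} (hb : b ∈ A) {ξ η : Fin n → ℂˣ}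
    {u : (Fin n → ℤ) → ℂ} (hu : AlgebraicIndependent D fun a : {a // a ≠ b} => u a)
    (hξ : ∀ j, IsAlgebraic D (ξ j : ℂ)) (hη : ∀ j, IsAlgebraic D (η j : ℂ))
    (h : ∑ a ∈ A, fillRow A b ξ u a * chEval η a = 0) :
    ∀ a ∈ A, chEval η (a - b) = chEval ξ (a - b) := by
  classical
  rw [sum_fillRow hb, mul_eq_zero, or_iff_right (chEval_ne_zero _ _)] at h
  have h1 := eq_zero_of_sum_mul_eq_zero hu (s := A.subtype (· ≠ b))
    (w := fun a => chEval η (a - b) - chEval ξ (a - b))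
    (fun i _ => (isAlgebraic_chEval hη _).sub (isAlgebraic_chEval hξ _)) (by
      rw [← h, Finset.sum_subtype_eq_sum_filter (f := fun a : Fin n → ℤ =>
        u a * (chEval η (a - b) - chEval ξ (a - b)))]
      congr 1
      ext a
      simp [and_comm])
  intro a ha
  by_cases hab : a = b
  · simp [hab, chEval_zero]
  · exact sub_eq_zero.1 (h1 ⟨a, hab⟩ (by simpa using ha))

theorem linForm_prodCoeff (A A' : Finset (Fin n → ℤ)) (ξ : Fin n → ℂˣ) (c c' : (Fin n → ℤ) → ℂ) :
    MvPolynomial.eval (prodCoeff A A' c c') (linForm (A + A') ξ) =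
      MvPolynomial.eval c (linForm A ξ) * MvPolynomial.eval c' (linForm A' ξ) := by
  simp only [eval_linForm, prodCoeff, Finset.sum_mul]
  rw [Finset.sum_comm]
  refine Finset.sum_congr rfl fun b hb => ?_
  rw [Finset.mul_sum]
  symm
  refine Finset.sum_of_injOn (fun b' : Fin n → ℤ => b + b') (fun _ _ _ _ h => add_left_cancel h)
    (fun b' hb' => Finset.mem_coe.2 (Finset.add_mem_add hb hb')) (fun a _ ha => ?_) fun b' hb' => ?_
  · rw [if_neg, mul_zero, zero_mul]
    exact fun h => ha ⟨a - b, h, add_sub_cancel b a⟩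
  · rw [add_sub_cancel_left, if_pos hb', chEval_add]
    ring

theorem prodCoeff_map {R : Type*} [CommRing R] (f : R →+* ℂ) (A A' : Finset (Fin n → ℤ))
    (c c' : (Fin n → ℤ) → R) :
    prodCoeff A A' (fun a => f (c a)) (fun a => f (c' a)) = fun a =>
      f (∑ b ∈ A, c b * (if a - b ∈ A' then c' (a - b) else 0)) := by
  ext a
  simp [prodCoeff, apply_ite f]

theorem exists_aeval_algebraMap_ne_zero {ι D : Type*} [CommRing D] [Algebra D ℂ]
    {p : MvPolynomial ι ℂ} (hp : p ≠ 0) :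
    ∃ w : ι → D, MvPolynomial.eval (fun i => algebraMap D ℂ (w i)) p ≠ 0 := by
  by_contra! h
  refine hp (MvPolynomial.funext_set (fun _ => Set.range (Int.cast : ℤ → ℂ))
    (fun _ => Set.infinite_range_of_injective Int.cast_injective) fun x hx => ?_)
  choose w hw using fun i => hx i (Set.mem_univ i)
  have := h fun i => (w i : D)
  simp only [map_intCast] at this
  rw [map_zero, ← this, show x = fun i => ((w i : ℤ) : ℂ) from funext fun i => (hw i).symm]

/-- The data of a norm polynomial for `A` over `D`: an irreducible polynomial one of whose powers
is a multiple of the product of the evaluation forms over `V`. -/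
structure IsNormPoly (D : Type*) [CommRing D] [Algebra D ℂ] (V : Finset (Fin n → ℂˣ))
    (A : Finset (Fin n → ℤ)) (c : (Fin n → ℤ) → ℂ) (S : MvPolynomial (Fin n → ℤ) D) (d : ℕ)
    (κ : ℂ) : Prop where
  irreducible : Irreducible S
  aeval_eq_zero_iff : ∀ h, MvPolynomial.aeval c h = 0 ↔ S ∣ h
  ne_zero : κ ≠ 0
  map_pow : MvPolynomial.map (algebraMap D ℂ) S ^ d = MvPolynomial.C κ * ∏ η ∈ V, linForm A η

theorem IsNormPoly.isPrimitiveFor {D : Type*} [CommRing D] [IsDomain D] [Algebra D ℂ]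
    [FaithfulSMul D ℂ] {V : Finset (Fin n → ℂˣ)} {A : Finset (Fin n → ℤ)}
    {c : (Fin n → ℤ) → ℂ} {S : MvPolynomial (Fin n → ℤ) D} {d : ℕ} {κ : ℂ}
    (h : IsNormPoly D V A c S d κ) {p : D} (hp : Prime p)
    {O : ValuationSubring ℂ} (hO : ∀ d, algebraMap D ℂ d ∈ O)
    (hO1 : ∀ d, ¬ p ∣ d → O.valuation (algebraMap D ℂ d) = 1) :
    IsPrimitiveFor O (MvPolynomial.C κ * ∏ η ∈ V, linForm A η) :=
  h.map_pow ▸ (isPrimitiveFor_map_of_irreducible h.irreducible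
    ((h.aeval_eq_zero_iff S).2 dvd_rfl) hp hO hO1).pow d

/-- The leading constants of norm polynomials are multiplicative up to units. -/
theorem IsNormPoly.exists_unit {D : Type*} [CommRing D] [IsDomain D]
    [UniqueFactorizationMonoid D] [Algebra D ℂ]
    [FaithfulSMul D ℂ] {V : Finset (Fin n → ℂˣ)} {A A' : Finset (Fin n → ℤ)}
    (hA : A.Nonempty) (hA' : A'.Nonempty) {c c' cs : (Fin n → ℤ) → ℂ}
    {S S' Ss : MvPolynomial (Fin n → ℤ) D} {d d' ds : ℕ} {κ κ' κs : ℂ}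
    (h : IsNormPoly D V A c S d κ) (h' : IsNormPoly D V A' c' S' d' κ')
    (hs : IsNormPoly D V (A + A') cs Ss ds κs) :
    ∃ u : Dˣ, κs = algebraMap D ℂ u * (κ * κ') := by
  have hinj := FaithfulSMul.algebraMap_injective D ℂ
  have hκ : κ * κ' ≠ 0 := mul_ne_zero h.ne_zero h'.ne_zero
  have hmapinj := MvPolynomial.map_injective (σ := Fin n → ℤ) _ hinj
  obtain ⟨w, hw⟩ := exists_aeval_algebraMap_ne_zero (D := D)
    (pow_ne_zero d ((map_ne_zero_iff _ hmapinj).2 h.irreducible.ne_zero))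
  obtain ⟨w', hw'⟩ := exists_aeval_algebraMap_ne_zero (D := D)
    (pow_ne_zero d' ((map_ne_zero_iff _ hmapinj).2 h'.irreducible.ne_zero))
  have hev : ∀ (v : (Fin n → ℤ) → D) (T : MvPolynomial (Fin n → ℤ) D),
      MvPolynomial.eval (fun a => algebraMap D ℂ (v a)) (MvPolynomial.map (algebraMap D ℂ) T) =
        algebraMap D ℂ (MvPolynomial.eval v T) := fun v T => by
    rw [MvPolynomial.eval_map, MvPolynomial.eval₂_comp]; rfl
  set ws : (Fin n → ℤ) → D := fun a => ∑ b ∈ A, w b * (if a - b ∈ A' then w' (a - b) else 0)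
  have e := congrArg (MvPolynomial.eval fun a => algebraMap D ℂ (w a)) h.map_pow
  have e' := congrArg (MvPolynomial.eval fun a => algebraMap D ℂ (w' a)) h'.map_pow
  have es := congrArg (MvPolynomial.eval fun a => algebraMap D ℂ (ws a)) hs.map_pow
  have hx := e ▸ hw
  have hx' := e' ▸ hw'
  have hprod : ∏ η ∈ V, MvPolynomial.eval (fun a => algebraMap D ℂ (ws a)) (linForm (A + A') η) =
      (∏ η ∈ V, MvPolynomial.eval (fun a => algebraMap D ℂ (w a)) (linForm A η)) *
        ∏ η ∈ V, MvPolynomial.eval (fun a => algebraMap D ℂ (w' a)) (linForm A' η) := by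
    rw [← Finset.prod_mul_distrib]
    refine Finset.prod_congr rfl fun η _ => ?_
    rw [← linForm_prodCoeff, prodCoeff_map]
  simp only [map_mul, MvPolynomial.eval_C, map_prod] at e e' es hx hx'
  rw [hprod] at es
  rw [_root_.map_pow, hev, ← _root_.map_pow] at e e' es
  have hP := right_ne_zero_of_mul hx
  have hP' := right_ne_zero_of_mul hx'
  have hx0 : MvPolynomial.eval w S ^ d * MvPolynomial.eval w' S' ^ d' ≠ 0 := by
    refine fun h0 => mul_ne_zero hx hx' ?_
    rw [← e, ← e', ← map_mul, h0, map_zero]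
  have hy0 : MvPolynomial.eval ws Ss ^ ds ≠ 0 := by
    refine fun h0 => mul_ne_zero hs.ne_zero (mul_ne_zero hP hP') ?_
    rw [← es, h0, map_zero]
  obtain ⟨u, hu⟩ := exists_unit_of_valuation_eq_one (K := ℂ) (ρ := κs / (κ * κ')) hx0 hy0 (by
    rw [map_mul, e, e', es]
    rw [div_mul_eq_mul_div, div_eq_iff hκ]
    ring) fun p hp O hO hO1 => by
      have := valuation_sum_eq_mul hA hA' (h.isPrimitiveFor hp hO hO1)
        (h'.isPrimitiveFor hp hO hO1) (hs.isPrimitiveFor hp hO hO1)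
      rw [map_div₀, map_mul, this, div_self]
      exact mul_ne_zero ((map_ne_zero _).2 h.ne_zero) ((map_ne_zero _).2 h'.ne_zero)
  exact ⟨u, by rw [← hu, div_mul_cancel₀ _ hκ]⟩

open scoped Classical in
/-- Norm polynomials exist for generic coefficient families vanishing at an algebraic point. -/
theorem exists_isNormPoly {D : Type} [CommRing D] [IsDomain D]
    [UniqueFactorizationMonoid D] [Countable D] [Algebra D ℂ] [FaithfulSMul D ℂ]
    {V : Finset (Fin n → ℂˣ)}
    (hstab : ∀ σ : ℂ ≃ₐ[D] ℂ, ∀ ξ ∈ V, conjPt ((σ : ℂ ≃+* ℂ) : ℂ →+* ℂ) ξ ∈ V)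
    (htrans : ∀ ξ ∈ V, ∀ η ∈ V, ∃ σ : ℂ ≃ₐ[D] ℂ, conjPt ((σ : ℂ ≃+* ℂ) : ℂ →+* ℂ) ξ = η)
    {ξ : Fin n → ℂˣ} (hξ : ξ ∈ V) (halg : ∀ j, IsAlgebraic D (ξ j : ℂ))
    {A : Finset (Fin n → ℤ)} {b : Fin n → ℤ} (hb : b ∈ A) {u : (Fin n → ℤ) → ℂ}
    (hu : AlgebraicIndependent D fun a : {a // a ≠ b} => u a) :
    ∃ S κ, IsNormPoly D V A (fillRow A b ξ u) S
      (V.filter fun η => ∑ a ∈ A, fillRow A b ξ u a * chEval η a = 0).card κ := by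
  obtain ⟨S, hS, hSc, κ, hκ, h⟩ := exists_irreducible_map_pow_eq hb hstab htrans hξ
    (sum_fillRow_self hb ξ u) (c := fillRow A b ξ u) (by
      convert hu using 2 with a
      exact fillRow_of_ne a.2) fun η hη h => by
        refine chEval_eq_of_sum_fillRow_eq_zero hb hu halg (fun j => ?_) h
        obtain ⟨σ, rfl⟩ := htrans ξ hξ η hη
        exact (halg j).algHom (σ : ℂ →ₐ[D] ℂ)
  exact ⟨S, κ, hS, hSc, hκ, h⟩

theorem isAlgebraic_of_mem_closure {D K : Type*} [CommRing D] [IsDomain D] [Field K] [Algebra D K]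
    {s : Set K} (h : ∀ y ∈ s, IsAlgebraic D y) {x : K} (hx : x ∈ Subfield.closure s)
    [FaithfulSMul D K] : IsAlgebraic D x := by
  induction hx using Subfield.closure_induction with
  | mem y hy => exact h y hy
  | one => exact isAlgebraic_one
  | add y z _ _ hy hz => exact hy.add hz
  | neg y _ hy => exact hy.neg
  | inv y _ hy => exact hy.inv
  | mul y z _ _ hy hz => exact hy.mul hz

theorem eq_of_mem_closure {K : Type*} [Field K] {s : Set K} {σ : K ≃+* K}
    (h : ∀ y ∈ s, σ y = y) {x : K} (hx : x ∈ Subfield.closure s) : σ x = x :=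
  (Subfield.closure_le (t := (σ : K →+* K).eqLocusField (RingHom.id K))).2 h hx

theorem coeff_base_eq {A : Finset (Fin n → ℤ)} {b : Fin n → ℤ} (hb : b ∈ A)
    {c : (Fin n → ℤ) → ℂ} {η : Fin n → ℂˣ} (h : ∑ a ∈ A, c a * chEval η a = 0) :
    c b = -∑ a ∈ A.erase b, c a * chEval η (a - b) := by
  rw [← Finset.add_sum_erase _ _ hb] at h
  have : ∑ a ∈ A.erase b, c a * chEval η a =
      (∑ a ∈ A.erase b, c a * chEval η (a - b)) * chEval η b := by
    rw [Finset.sum_mul]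
    exact Finset.sum_congr rfl fun a _ => by rw [mul_assoc, chEval_sub_mul]
  rw [this, ← add_mul, mul_eq_zero, or_iff_left (chEval_ne_zero _ _)] at h
  exact eq_neg_of_add_eq_zero_left h

theorem isAlgebraic_coeff_base {A : Fin n → Finset (Fin n → ℤ)} {b : Fin n → Fin n → ℤ}
    (hb : ∀ i, b i ∈ A i) {c : Fin n → (Fin n → ℤ) → ℂ} {η : Fin n → ℂˣ}
    (hη : ∀ i, ∑ a ∈ A i, c i a * chEval η a = 0) (k : Fin n) :
    IsAlgebraic (Algebra.adjoin (Algebra.adjoin ℤ (Set.range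
      fun p : {p : Fin n × (Fin n → ℤ) // p.2 ≠ b p.1} => c p.1.1 p.1.2))
      (Set.range fun j => (η j : ℂ))) (c k (b k)) := by
  set z := fun p : {p : Fin n × (Fin n → ℤ) // p.2 ≠ b p.1} => c p.1.1 p.1.2
  rw [coeff_base_eq (hb k) (hη k)]
  refine IsAlgebraic.neg ((Subalgebra.mem_algebraicClosure _ _).1 (sum_mem fun a ha =>
    (Subalgebra.mem_algebraicClosure _ _).2 (IsAlgebraic.mul ?_ (isAlgebraic_chEval (fun j =>
      isAlgebraic_algebraMap (⟨η j, Algebra.subset_adjoin ⟨j, rfl⟩⟩ :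
        Algebra.adjoin (Algebra.adjoin ℤ (Set.range z)) (Set.range fun j => (η j : ℂ)))) _))))
  exact isAlgebraic_algebraMap (algebraMap (Algebra.adjoin ℤ (Set.range z))
    (Algebra.adjoin (Algebra.adjoin ℤ (Set.range z)) (Set.range fun j => (η j : ℂ)))
    ⟨c k a, Algebra.subset_adjoin ⟨⟨(k, a), Finset.ne_of_mem_erase ha⟩, rfl⟩⟩)

theorem map_coeff_eq {A : Fin n → Finset (Fin n → ℤ)} {b : Fin n → Fin n → ℤ}
    (hb : ∀ i, b i ∈ A i) {c : Fin n → (Fin n → ℤ) → ℂ} {η : Fin n → ℂˣ}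
    (hη : ∀ i, ∑ a ∈ A i, c i a * chEval η a = 0) {σ : ℂ ≃+* ℂ}
    (hση : ∀ i, ∑ a ∈ A i, c i a * chEval (conjPt (σ : ℂ →+* ℂ) η) a = 0)
    (hσ : ∀ p : {p : Fin n × (Fin n → ℤ) // p.2 ≠ b p.1}, σ (c p.1.1 p.1.2) = c p.1.1 p.1.2)
    (i : Fin n) (a : Fin n → ℤ) : σ (c i a) = c i a := by
  by_cases hab : a = b i
  · rw [hab]
    nth_rw 1 [coeff_base_eq (hb i) (hη i)]
    rw [coeff_base_eq (hb i) (hση i), map_neg, map_sum]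
    refine congrArg _ (Finset.sum_congr rfl fun a ha => ?_)
    rw [map_mul, chEval_conjPt]
    exact congrArg (· * _) (hσ ⟨(i, a), Finset.ne_of_mem_erase ha⟩)
  · exact hσ ⟨(i, a), hab⟩

/-- The common zeros of generic Laurent polynomials, with some coordinates prescribed, form a
finite orbit under the automorphisms of `ℂ` over a ring of definition. -/
theorem exists_fiber {D : Type} [CommRing D] [IsDomain D] [Algebra D ℂ] [FaithfulSMul D ℂ]
    {A : Fin n → Finset (Fin n → ℤ)} {b : Fin n → Fin n → ℤ} (hb : ∀ i, b i ∈ A i)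
    {c : Fin n → (Fin n → ℤ) → ℂ} {ξ : Fin n → ℂˣ}
    (hξ : ∀ i, ∑ a ∈ A i, c i a * chEval ξ a = 0) (T : Set (Fin n)) {y : Fin n → ℂ}
    (hyz : AlgebraicIndependent ℤ (Sum.elim y
      fun p : {p : Fin n × (Fin n → ℤ) // p.2 ≠ b p.1} => c p.1.1 p.1.2))
    (hy : ∀ i, (∃ k, y i = c k (b k)) ∨ ∃ j ∈ T, y i = ξ j)
    (hcD : ∀ i a, c i a ∈ Set.range (algebraMap D ℂ))
    (hTD : ∀ j ∈ T, (ξ j : ℂ) ∈ Set.range (algebraMap D ℂ))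
    (hD : ∀ d, algebraMap D ℂ d ∈ Subfield.closure
      (Set.range (fun p : Fin n × (Fin n → ℤ) => c p.1 p.2) ∪ (fun j => (ξ j : ℂ)) '' T)) :
    ∃ V : Finset (Fin n → ℂˣ),
      (∀ η, η ∈ V ↔ (∀ i, ∑ a ∈ A i, c i a * chEval η a = 0) ∧ ∀ j ∈ T, η j = ξ j) ∧
      (∀ σ : ℂ ≃ₐ[D] ℂ, ∀ η ∈ V, conjPt ((σ : ℂ ≃+* ℂ) : ℂ →+* ℂ) η ∈ V) ∧
      (∀ η ∈ V, ∀ η' ∈ V, ∃ σ : ℂ ≃ₐ[D] ℂ, conjPt ((σ : ℂ ≃+* ℂ) : ℂ →+* ℂ) η = η') ∧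
      ∀ j, IsAlgebraic D (ξ j : ℂ) := by
  set z := fun p : {p : Fin n × (Fin n → ℤ) // p.2 ≠ b p.1} => c p.1.1 p.1.2 with hz
  set V : Set (Fin n → ℂˣ) :=
    {η | (∀ i, ∑ a ∈ A i, c i a * chEval η a = 0) ∧ ∀ j ∈ T, η j = ξ j}
  have hstab : ∀ σ : ℂ ≃ₐ[D] ℂ, ∀ η ∈ V, conjPt ((σ : ℂ ≃+* ℂ) : ℂ →+* ℂ) η ∈ V := by
    rintro σ η ⟨h1, h2⟩
    refine ⟨fun i => ?_, fun j hj => ?_⟩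
    · have := congrArg σ (h1 i)
      rw [map_zero, map_sum] at this
      rw [← this]
      refine Finset.sum_congr rfl fun a _ => ?_
      obtain ⟨d, hd⟩ := hcD i a
      rw [map_mul, ← hd, σ.commutes, chEval_conjPt]
      rfl
    · ext
      obtain ⟨d, hd⟩ := hTD j hj
      change σ (η j) = ξ j
      rw [h2 j hj, ← hd, σ.commutes]
  have hyalg : ∀ η ∈ V, ∀ i, IsAlgebraic (Algebra.adjoin (Algebra.adjoin ℤ (Set.range z))
      (Set.range fun j => (η j : ℂ))) (y i) := by
    rintro η ⟨h1, h2⟩ i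
    obtain ⟨k, hk⟩ | ⟨j, hj, hk⟩ := hy i
    · rw [hk]
      exact isAlgebraic_coeff_base hb h1 k
    · rw [hk, ← h2 j hj]
      exact isAlgebraic_algebraMap (⟨η j, Algebra.subset_adjoin ⟨j, rfl⟩⟩ :
        Algebra.adjoin (Algebra.adjoin ℤ (Set.range z)) (Set.range fun j => (η j : ℂ)))
  have htrans : ∀ η ∈ V, ∀ η' ∈ V, ∃ σ : ℂ ≃ₐ[D] ℂ,
      conjPt ((σ : ℂ ≃+* ℂ) : ℂ →+* ℂ) η = η' := by
    intro η hη η' hη'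
    obtain ⟨σ, hσz, hσ⟩ := exists_conj_of_algebraicIndependent hyz hyz (hyalg η hη) (hyalg η' hη')
    have hσc := map_coeff_eq hb hη.1 (hσ ▸ hη'.1) hσz
    refine ⟨AlgEquiv.ofRingEquiv (f := σ) fun d => eq_of_mem_closure ?_ (hD d), hσ⟩
    rintro _ (⟨p, rfl⟩ | ⟨j, hj, rfl⟩)
    · exact hσc _ _
    · have := congrArg (fun η : Fin n → ℂˣ => (η j : ℂ)) hσ
      simpa [hη.2 j hj, hη'.2 j hj] using this
  have hξV : ξ ∈ V := ⟨hξ, fun _ _ => rfl⟩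
  have halg : ∀ j, IsAlgebraic D (ξ j : ℂ) := by
    intro j
    refine (((AlgebraicIndependent.sumElim_iff.1 hyz).2.exchange (hyalg ξ hξV)).2
      j).of_range_subset ?_
    have h1 : ∀ t ∈ Algebra.adjoin ℤ (Set.range z), t ∈ (algebraMap D ℂ).range := by
      intro t ht
      refine (Algebra.adjoin_le (S := subalgebraOfSubring (algebraMap D ℂ).range) ?_) ht
      rintro _ ⟨p, rfl⟩
      exact hcD _ _
    rintro _ ⟨⟨t, ht⟩, rfl⟩
    change t ∈ (algebraMap D ℂ).range
    induction ht using Algebra.adjoin_induction with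
    | mem x hx =>
      obtain ⟨i, rfl⟩ := hx
      obtain ⟨k, hk⟩ | ⟨j, hj, hk⟩ := hy i
      · rw [hk]; exact hcD _ _
      · rw [hk]; exact hTD j hj
    | algebraMap r => exact h1 _ r.2
    | add x y _ _ hx hy => exact add_mem hx hy
    | mul x y _ _ hx hy => exact mul_mem hx hy
  have hfin : V.Finite := finite_of_transitive (D := D) halg (htrans ξ hξV)
  refine ⟨hfin.toFinset, fun η => hfin.mem_toFinset, ?_, ?_, halg⟩ <;>
    simpa only [hfin.mem_toFinset]

theorem IsGenericPair.algebraicIndependent {D : Type} [CommRing D] [Algebra D ℂ] [FaithfulSMul D ℂ]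
    {ξ : Fin n → ℂˣ} {u : Fin (n + 1) → (Fin n → ℤ) → ℂ} (h : IsGenericPair ξ u)
    {A : Fin n → Finset (Fin n → ℤ)} {b : Fin n → Fin n → ℤ} {T : Set (Fin n)}
    (hD : ∀ d, algebraMap D ℂ d ∈ Subfield.closure
      (Set.range (fun p : Fin n × (Fin n → ℤ) => fillRow (A p.1) (b p.1) ξ (u p.1.succ) p.2) ∪
        (fun j => (ξ j : ℂ)) '' T)) :
    AlgebraicIndependent D (u 0) := by
  let w : Fin n ⊕ (Fin n × (Fin n → ℤ)) → ℂ :=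
    Sum.elim (fun j => (ξ j : ℂ)) fun p => u p.1.succ p.2
  have hxw : AlgebraicIndependent ℤ (Sum.elim (u 0) w) := by
    let e : (Fin n → ℤ) ⊕ (Fin n ⊕ (Fin n × (Fin n → ℤ))) →
        Fin n ⊕ (Fin (n + 1) × (Fin n → ℤ)) :=
      Sum.elim (fun a => Sum.inr (0, a)) (Sum.elim Sum.inl fun p => Sum.inr (p.1.succ, p.2))
    have he : Function.Injective e := by
      rintro (a | a | ⟨i, a⟩) (a' | a' | ⟨i', a'⟩) <;>
        simp [e, Fin.succ_ne_zero, (Fin.succ_ne_zero _).symm]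
    convert AlgebraicIndependent.comp h e he using 1
    ext (a | a | ⟨i, a⟩) <;> rfl
  refine hxw.of_forall_isAlgebraic fun d => isAlgebraic_of_mem_closure ?_ (hD d)
  have hw : ∀ i, IsAlgebraic (Algebra.adjoin ℤ (Set.range w)) (w i) := fun i =>
    isAlgebraic_algebraMap (⟨w i, Algebra.subset_adjoin ⟨i, rfl⟩⟩ :
      Algebra.adjoin ℤ (Set.range w))
  rintro _ (⟨⟨i, a⟩, rfl⟩ | ⟨j, hj, rfl⟩)
  · simp only [fillRow]
    split_ifs
    · refine IsAlgebraic.neg ((Subalgebra.mem_algebraicClosure _ _).1 (sum_mem fun a ha =>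
        (Subalgebra.mem_algebraicClosure _ _).2 (IsAlgebraic.mul (hw (Sum.inr (i, a))) ?_)))
      exact isAlgebraic_chEval (fun j => hw (Sum.inl j)) _
    · exact hw (Sum.inr (i, a))
  · exact hw (Sum.inl j)

theorem MvPolynomial.exists_eq_intCast_of_isUnit {ι : Type*} {p : MvPolynomial ι ℤ}
    (hp : IsUnit p) : ∃ ε : ℤˣ, p = ((ε : ℤ) : MvPolynomial ι ℤ) := by
  obtain ⟨r, ⟨ε, rfl⟩, rfl⟩ := MvPolynomial.isUnit_iff_eq_C_of_isReduced.1 hp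
  exact ⟨ε, eq_intCast (MvPolynomial.C : ℤ →+* MvPolynomial ι ℤ) ε⟩

theorem IsGeneratorAt.exists_eq_mul {c : Fin (n + 1) → (Fin n → ℤ) → ℂ}
    {E E' : MvPolynomial (Fin (n + 1) × (Fin n → ℤ)) ℤ} (h : IsGeneratorAt c E)
    (h' : IsGeneratorAt c E') :
    ∃ ε : ℤˣ, E = ((ε : ℤ) : MvPolynomial (Fin (n + 1) × (Fin n → ℤ)) ℤ) * E' := by
  have h1 : Associated E' E := associated_of_dvd_dvd ((h'.2 E).1 ((h.2 E).2 dvd_rfl))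
    ((h.2 E').1 ((h'.2 E').2 dvd_rfl))
  obtain ⟨u, hu⟩ := h1
  obtain ⟨ε, hε⟩ := MvPolynomial.exists_eq_intCast_of_isUnit u.isUnit
  exact ⟨ε, by rw [← hu, hε, mul_comm]⟩

/-- If the incidence variety projects onto a hypersurface with equation `E`, the resultant is up
to sign the power of `E` by the number of generic roots. -/
theorem IsResultant.exists_eq_mul_pow {A : Fin (n + 1) → Finset (Fin n → ℤ)}
    {b : Fin (n + 1) → Fin n → ℤ} (hb : ∀ i, b i ∈ A i) {ξ : Fin n → ℂˣ}
    {u : Fin (n + 1) → (Fin n → ℤ) → ℂ} (hg : IsGenericPair ξ u)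
    {R E : MvPolynomial (Fin (n + 1) × (Fin n → ℤ)) ℤ} (hR : IsResultant A R)
    (hE : IsGeneratorAt (fillIn A b ξ u) E) :
    ∃ ε : ℤˣ, R = ((ε : ℤ) : MvPolynomial (Fin (n + 1) × (Fin n → ℤ)) ℤ) *
      E ^ Nat.card {η // IsRootOf A (fillIn A b ξ u) η} := by
  obtain ⟨E', hE', h⟩ | ⟨-, h⟩ := hR.exists_generator_or hb hg
  · obtain ⟨ε, rfl⟩ := hE'.exists_eq_mul hE
    set N := Nat.card {η // IsRootOf A (fillIn A b ξ u) η}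
    obtain h | h := h
    · exact ⟨ε ^ N, by rw [h, mul_pow]; push_cast; rfl⟩
    · exact ⟨-ε ^ N, by rw [h, mul_pow]; push_cast; ring⟩
  · exact absurd hE (h E)

/-- The index set of all coefficients, split into the first row and the remaining rows. -/
def rowEquiv (n : ℕ) :
    Fin (n + 1) × (Fin n → ℤ) ≃ (Fin n → ℤ) ⊕ (Fin n × (Fin n → ℤ)) where
  toFun p := Fin.cases (Sum.inl p.2) (fun i => Sum.inr (i, p.2)) p.1
  invFun := Sum.elim (fun a => (0, a)) fun p => (p.1.succ, p.2)
  left_inv := by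
    rintro ⟨i, a⟩
    refine Fin.cases ?_ (fun i => ?_) i <;> rfl
  right_inv := by rintro (a | ⟨i, a⟩) <;> rfl

/-- Polynomials in all coefficients as polynomials in those of the first row. -/
def rowAlgEquiv (n : ℕ) : MvPolynomial (Fin (n + 1) × (Fin n → ℤ)) ℤ ≃ₐ[ℤ]
    MvPolynomial (Fin n → ℤ) (MvPolynomial (Fin n × (Fin n → ℤ)) ℤ) :=
  (MvPolynomial.renameEquiv ℤ (rowEquiv n)).trans (MvPolynomial.sumAlgEquiv ℤ _ _)

theorem evalCoeff_cons (h : MvPolynomial (Fin (n + 1) × (Fin n → ℤ)) ℤ)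
    (c0 : (Fin n → ℤ) → ℂ) (cr : Fin n → (Fin n → ℤ) → ℂ) :
    evalCoeff h (Fin.cons c0 cr) =
      MvPolynomial.eval₂ (MvPolynomial.aeval fun p : Fin n × (Fin n → ℤ) => cr p.1 p.2 :
        MvPolynomial (Fin n × (Fin n → ℤ)) ℤ →ₐ[ℤ] ℂ) c0 (rowAlgEquiv n h) := by
  have : (MvPolynomial.aeval fun p : Fin (n + 1) × (Fin n → ℤ) =>
        (Fin.cons c0 cr : Fin (n + 1) → (Fin n → ℤ) → ℂ) p.1 p.2 :
        MvPolynomial _ ℤ →ₐ[ℤ] ℂ).toRingHom =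
      (MvPolynomial.eval₂Hom (MvPolynomial.aeval fun p : Fin n × (Fin n → ℤ) => cr p.1 p.2 :
        MvPolynomial (Fin n × (Fin n → ℤ)) ℤ →ₐ[ℤ] ℂ).toRingHom c0).comp
        (rowAlgEquiv n).toRingEquiv.toRingHom := by
    refine MvPolynomial.ringHom_ext (fun r => ?_) ?_
    · simp
    · rintro ⟨i, a⟩
      refine Fin.cases ?_ (fun i => ?_) i <;> simp [rowAlgEquiv, rowEquiv]
  exact congrArg (fun f : MvPolynomial _ ℤ →+* ℂ => f h) this

theorem isRootOf_cons_iff {A0 : Finset (Fin n → ℤ)} {Ar : Fin n → Finset (Fin n → ℤ)}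
    {c0 : (Fin n → ℤ) → ℂ} {cr : Fin n → (Fin n → ℤ) → ℂ} {η : Fin n → ℂˣ} :
    IsRootOf (Fin.cons A0 Ar) (Fin.cons c0 cr) η ↔
      ∑ a ∈ A0, c0 a * chEval η a = 0 ∧ ∀ i, ∑ a ∈ Ar i, cr i a * chEval η a = 0 := by
  simp [IsRootOf, Fin.forall_fin_succ]

theorem fun_apply_cons {α : Type*} (f : α → α) (c0 : (Fin n → ℤ) → α)
    (cr : Fin n → (Fin n → ℤ) → α) :
    (fun i a => f ((Fin.cons c0 cr : Fin (n + 1) → (Fin n → ℤ) → α) i a)) =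
      Fin.cons (fun a => f (c0 a)) fun i a => f (cr i a) := by
  funext i
  refine Fin.cases ?_ (fun i => ?_) i <;> rfl

theorem prodCoeff_conj (σ : ℂ →+* ℂ) (A A' : Finset (Fin n → ℤ)) (c c' : (Fin n → ℤ) → ℂ) :
    (fun a => σ (prodCoeff A A' c c' a)) =
      prodCoeff A A' (fun a => σ (c a)) fun a => σ (c' a) := by
  ext a
  simp [prodCoeff, apply_ite σ]

theorem evalCoeff_prodCoeff_conj {A A' : Finset (Fin n → ℤ)}
    {P Q S : MvPolynomial (Fin (n + 1) × (Fin n → ℤ)) ℤ} {cr : Fin n → (Fin n → ℤ) → ℂ} {k : ℤ}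
    (h : ∀ c c', evalCoeff S (Fin.cons (prodCoeff A A' c c') cr) =
      k * (evalCoeff P (Fin.cons c cr) * evalCoeff Q (Fin.cons c' cr)))
    (σ : ℂ ≃+* ℂ) (c c' : (Fin n → ℤ) → ℂ) :
    evalCoeff S (Fin.cons (prodCoeff A A' c c') fun i a => σ (cr i a)) =
      k * (evalCoeff P (Fin.cons c fun i a => σ (cr i a)) *
        evalCoeff Q (Fin.cons c' fun i a => σ (cr i a))) := by
  have hσ : ∀ (T : MvPolynomial (Fin (n + 1) × (Fin n → ℤ)) ℤ) (d : (Fin n → ℤ) → ℂ),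
      σ (evalCoeff T (Fin.cons d cr)) =
        evalCoeff T (Fin.cons (fun a => σ (d a)) fun i a => σ (cr i a)) := fun T d => by
    rw [← fun_apply_cons]
    exact (evalCoeff_conj (σ : ℂ →+* ℂ) T (Fin.cons d cr)).symm
  have h1 := congrArg σ (h (fun a => σ.symm (c a)) fun a => σ.symm (c' a))
  have h2 : (fun a => σ (prodCoeff A A' (fun a => σ.symm (c a)) (fun a => σ.symm (c' a)) a)) =
      prodCoeff A A' c c' := by
    refine (prodCoeff_conj (σ : ℂ →+* ℂ) A A' _ _).trans ?_
    simp
  rw [map_mul, map_mul, hσ, hσ, hσ, h2, map_intCast] at h1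
  simpa only [RingEquiv.apply_symm_apply] using h1

/-- An identity of coefficient polynomials that holds for one algebraically independent choice
of the last rows holds for all choices. -/
theorem evalCoeff_prodCoeff_of_algebraicIndependent {A A' : Finset (Fin n → ℤ)}
    {P Q S : MvPolynomial (Fin (n + 1) × (Fin n → ℤ)) ℤ} {cr : Fin n → (Fin n → ℤ) → ℂ}
    (hcr : AlgebraicIndependent ℤ fun p : Fin n × (Fin n → ℤ) => cr p.1 p.2) {k : ℤ}
    (h : ∀ c c', evalCoeff S (Fin.cons (prodCoeff A A' c c') cr) =
      k * (evalCoeff P (Fin.cons c cr) * evalCoeff Q (Fin.cons c' cr)))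
    (c c' : (Fin n → ℤ) → ℂ) (cr' : Fin n → (Fin n → ℤ) → ℂ) :
    evalCoeff S (Fin.cons (prodCoeff A A' c c') cr') =
      k * (evalCoeff P (Fin.cons c cr') * evalCoeff Q (Fin.cons c' cr')) := by
  have hcont : ∀ (T : MvPolynomial (Fin (n + 1) × (Fin n → ℤ)) ℤ) (d : (Fin n → ℤ) → ℂ),
      Continuous fun x : Fin n × (Fin n → ℤ) → ℂ =>
        evalCoeff T (Fin.cons d fun i a => x (i, a)) := fun T d => by
    refine (continuous_evalCoeff T).comp (continuous_pi fun i => ?_)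
    refine Fin.cases ?_ (fun i => ?_) i
    · exact continuous_const
    · simp only [Fin.cons_succ]
      fun_prop
  have key : (fun x : Fin n × (Fin n → ℤ) → ℂ =>
      evalCoeff S (Fin.cons (prodCoeff A A' c c') fun i a => x (i, a))) = fun x =>
      k * (evalCoeff P (Fin.cons c fun i a => x (i, a)) *
        evalCoeff Q (Fin.cons c' fun i a => x (i, a))) := by
    refine Continuous.ext_on dense_algebraicIndependent (hcont S _)
      (continuous_const.mul ((hcont P _).mul (hcont Q _))) fun x hx => ?_
    obtain ⟨σ, hσ⟩ := exists_algEquiv_apply_eq (D := ℤ) _ x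
      fun p => (map_eq_zero_iff _ hcr).trans (map_eq_zero_iff _ hx).symm
    have := evalCoeff_prodCoeff_conj h σ.toRingEquiv c c'
    rwa [show (fun i a => σ.toRingEquiv (cr i a)) = fun i a => x (i, a) from
      funext fun i => funext fun a => hσ (i, a)] at this
  exact congrFun key fun p => cr' p.1 p.2

open scoped Classical in
theorem card_isRootOf_cons {A0 : Finset (Fin n → ℤ)} {Ar : Fin n → Finset (Fin n → ℤ)}
    {c0 : (Fin n → ℤ) → ℂ} {cr : Fin n → (Fin n → ℤ) → ℂ} {V : Finset (Fin n → ℂˣ)}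
    (hV : ∀ η, η ∈ V ↔ ∀ i, ∑ a ∈ Ar i, cr i a * chEval η a = 0) :
    Nat.card {η // IsRootOf (Fin.cons A0 Ar) (Fin.cons c0 cr) η} =
      (V.filter fun η => ∑ a ∈ A0, c0 a * chEval η a = 0).card := by
  refine Nat.subtype_card _ fun η => ?_
  rw [Finset.mem_filter, hV, isRootOf_cons_iff, and_comm]

theorem forall_cons_mem {A0 : Finset (Fin n → ℤ)} {Ar : Fin n → Finset (Fin n → ℤ)}
    {b0 : Fin n → ℤ} {br : Fin n → Fin n → ℤ} (hb : b0 ∈ A0) (hbr : ∀ i, br i ∈ Ar i) :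
    ∀ i, (Fin.cons b0 br : Fin (n + 1) → Fin n → ℤ) i ∈
      (Fin.cons A0 Ar : Fin (n + 1) → Finset (Fin n → ℤ)) i := by
  simpa [Fin.forall_fin_succ] using ⟨hb, hbr⟩

open scoped Classical in
theorem IsResultant.exists_rowAlgEquiv_eq {ξ : Fin n → ℂˣ} {u : Fin (n + 1) → (Fin n → ℤ) → ℂ}
    (hg : IsGenericPair ξ u) {Ar : Fin n → Finset (Fin n → ℤ)} {br : Fin n → Fin n → ℤ}
    (hbr : ∀ i, br i ∈ Ar i) [Algebra (MvPolynomial (Fin n × (Fin n → ℤ)) ℤ) ℂ]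
    (halg : ∀ p, algebraMap (MvPolynomial (Fin n × (Fin n → ℤ)) ℤ) ℂ p =
      MvPolynomial.aeval (fun p : Fin n × (Fin n → ℤ) =>
        fillRow (Ar p.1) (br p.1) ξ (u p.1.succ) p.2) p)
    {V : Finset (Fin n → ℂˣ)} (hV : ∀ η, η ∈ V ↔
      ∀ i, ∑ a ∈ Ar i, fillRow (Ar i) (br i) ξ (u i.succ) a * chEval η a = 0)
    {A : Finset (Fin n → ℤ)} {b : Fin n → ℤ} (hb : b ∈ A)
    {R : MvPolynomial (Fin (n + 1) × (Fin n → ℤ)) ℤ} (hR : IsResultant (Fin.cons A Ar) R)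
    {S : MvPolynomial (Fin n → ℤ) (MvPolynomial (Fin n × (Fin n → ℤ)) ℤ)} {κ : ℂ}
    (hS : IsNormPoly (MvPolynomial (Fin n × (Fin n → ℤ)) ℤ) V A (fillRow A b ξ (u 0)) S
      (V.filter fun η => ∑ a ∈ A, fillRow A b ξ (u 0) a * chEval η a = 0).card κ) :
    ∃ ε : ℤˣ, ∀ c, evalCoeff R
        (Fin.cons c fun i => fillRow (Ar i) (br i) ξ (u i.succ)) =
      ((ε : ℤ) : ℂ) * (κ * ∏ η ∈ V, MvPolynomial.eval c (linForm A η)) := by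
  have hE : IsGeneratorAt (fillIn (Fin.cons A Ar) (Fin.cons b br) ξ u)
      ((rowAlgEquiv n).symm S) := by
    refine ⟨(MulEquiv.irreducible_iff (rowAlgEquiv n).symm.toMulEquiv).2 hS.irreducible,
      fun h => ?_⟩
    rw [fillIn_cons, evalCoeff_cons]
    have h1 := hS.aeval_eq_zero_iff (rowAlgEquiv n h)
    rw [MvPolynomial.aeval_def, show algebraMap (MvPolynomial (Fin n × (Fin n → ℤ)) ℤ) ℂ = _ from
      RingHom.ext halg] at h1
    refine h1.trans ⟨fun ⟨q, hq⟩ => ⟨(rowAlgEquiv n).symm q, ?_⟩, fun ⟨q, hq⟩ =>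
      ⟨rowAlgEquiv n q, ?_⟩⟩
    · rw [← map_mul, ← hq, AlgEquiv.symm_apply_apply]
    · rw [hq, map_mul, AlgEquiv.apply_symm_apply]
  obtain ⟨ε, hε⟩ := hR.exists_eq_mul_pow (forall_cons_mem hb hbr) hg hE
  rw [fillIn_cons, card_isRootOf_cons hV] at hε
  refine ⟨ε, fun c => ?_⟩
  have h2 := congrArg (MvPolynomial.eval c) hS.map_pow
  rw [map_mul, MvPolynomial.eval_C, map_prod] at h2
  rw [← h2, hε, evalCoeff_cons, map_mul, map_pow, map_intCast, AlgEquiv.apply_symm_apply,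
    ← map_pow, MvPolynomial.eval_map, show algebraMap (MvPolynomial (Fin n × (Fin n → ℤ)) ℤ) ℂ = _
      from RingHom.ext halg]
  exact (MvPolynomial.eval₂_mul _ _).trans (congrArg₂ (· * ·)
    (map_intCast (MvPolynomial.eval₂Hom _ _) _) rfl)

theorem injective_sumElim_base {ι α : Type*} (b : ι → α) : Function.Injective
    (Sum.elim (fun i => (i, b i)) fun p : {p : ι × α // p.2 ≠ b p.1} => p.1) := by
  refine Function.Injective.sumElim (fun i j h => congrArg Prod.fst h) Subtype.val_injective ?_
  rintro i ⟨p, hp⟩ rfl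
  exact hp rfl

theorem Int.units_cast_mul_self (R : Type*) [Ring R] (ε : ℤˣ) :
    ((ε : ℤ) : R) * ((ε : ℤ) : R) = 1 := by
  rw [← Int.cast_mul, ← Units.val_mul, Int.units_mul_self]
  simp

/-- The product formula when the coefficients of the last rows are unconstrained. -/
theorem IsResultant.product_of_algebraicIndependent {ξ : Fin n → ℂˣ}
    {u : Fin (n + 1) → (Fin n → ℤ) → ℂ} (hg : IsGenericPair ξ u)
    {Ar : Fin n → Finset (Fin n → ℤ)} {br : Fin n → Fin n → ℤ} (hbr : ∀ i, br i ∈ Ar i)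
    (hcr : AlgebraicIndependent ℤ fun p : Fin n × (Fin n → ℤ) =>
      fillRow (Ar p.1) (br p.1) ξ (u p.1.succ) p.2)
    {A A' : Finset (Fin n → ℤ)} {b b' : Fin n → ℤ} (hb : b ∈ A) (hb' : b' ∈ A')
    {R R' Rs : MvPolynomial (Fin (n + 1) × (Fin n → ℤ)) ℤ} (hR : IsResultant (Fin.cons A Ar) R)
    (hR' : IsResultant (Fin.cons A' Ar) R') (hRs : IsResultant (Fin.cons (A + A') Ar) Rs) :
    ∃ ε : ℤˣ, ∀ c c' cr, evalCoeff Rs (Fin.cons (prodCoeff A A' c c') cr) =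
      ((ε : ℤ) : ℂ) * (evalCoeff R (Fin.cons c cr) * evalCoeff R' (Fin.cons c' cr)) := by
  classical
  set cr := fun i => fillRow (Ar i) (br i) ξ (u i.succ) with hcr_def
  let D := MvPolynomial (Fin n × (Fin n → ℤ)) ℤ
  let _ : Algebra D ℂ := (MvPolynomial.aeval fun p : Fin n × (Fin n → ℤ) =>
    cr p.1 p.2 : D →ₐ[ℤ] ℂ).toRingHom.toAlgebra
  have halg : ∀ p : D, algebraMap D ℂ p = MvPolynomial.aeval (fun p : Fin n × (Fin n → ℤ) =>
    cr p.1 p.2) p := fun p => rfl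
  have : FaithfulSMul D ℂ := (faithfulSMul_iff_algebraMap_injective D ℂ).2 hcr
  have : Countable D := MvPolynomial.countable
  have hcD : ∀ i a, cr i a ∈ Set.range (algebraMap D ℂ) := fun i a =>
    ⟨MvPolynomial.X (i, a), by rw [halg, MvPolynomial.aeval_X]⟩
  have hD : ∀ d, algebraMap D ℂ d ∈ Subfield.closure
      (Set.range (fun p : Fin n × (Fin n → ℤ) => cr p.1 p.2) ∪ (fun j => (ξ j : ℂ)) '' ∅) := by
    intro d
    rw [halg]
    induction d using MvPolynomial.induction_on with
    | C k => rw [MvPolynomial.aeval_C]; exact intCast_mem _ k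
    | add p q hp hq => rw [map_add]; exact add_mem hp hq
    | mul_X p i hp =>
      rw [map_mul, MvPolynomial.aeval_X]
      exact mul_mem hp (Subfield.subset_closure (Or.inl ⟨i, rfl⟩))
  have hξ : ∀ i, ∑ a ∈ Ar i, cr i a * chEval ξ a = 0 := fun i => sum_fillRow_self (hbr i) ξ _
  have hyz : AlgebraicIndependent ℤ (Sum.elim (fun i => cr i (br i))
      fun p : {p : Fin n × (Fin n → ℤ) // p.2 ≠ br p.1} => cr p.1.1 p.1.2) := by
    convert hcr.comp _ (injective_sumElim_base br) using 1
    ext (i | p) <;> rfl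
  obtain ⟨V, hVmem, hstab, htrans, hξalg⟩ := exists_fiber (D := D) hbr hξ ∅ hyz
    (fun i => Or.inl ⟨i, rfl⟩) hcD (fun _ h => h.elim) hD
  have hV : ∀ η, η ∈ V ↔ ∀ i, ∑ a ∈ Ar i, cr i a * chEval η a = 0 := by simpa using hVmem
  have hu := hg.algebraicIndependent (D := D) hD
  have hnorm : ∀ {B : Finset (Fin n → ℤ)} {b : Fin n → ℤ}, b ∈ B → ∃ S κ,
      IsNormPoly D V B (fillRow B b ξ (u 0)) S (V.filter fun η =>
        ∑ a ∈ B, fillRow B b ξ (u 0) a * chEval η a = 0).card κ := fun {B b} hb =>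
    exists_isNormPoly hstab htrans ((hV ξ).2 hξ) hξalg hb (hu.comp _ Subtype.val_injective)
  obtain ⟨S, κ, hS⟩ := hnorm hb
  obtain ⟨S', κ', hS'⟩ := hnorm hb'
  obtain ⟨Ss, κs, hSs⟩ := hnorm (Finset.add_mem_add hb hb')
  obtain ⟨w, hw⟩ := hS.exists_unit ⟨b, hb⟩ ⟨b', hb'⟩ hS' hSs
  obtain ⟨δ, hδ⟩ := MvPolynomial.exists_eq_intCast_of_isUnit w.isUnit
  rw [hδ, map_intCast] at hw
  obtain ⟨ε, hε⟩ := hR.exists_rowAlgEquiv_eq hg hbr halg hV hb hS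
  obtain ⟨ε', hε'⟩ := hR'.exists_rowAlgEquiv_eq hg hbr halg hV hb' hS'
  obtain ⟨εs, hεs⟩ := hRs.exists_rowAlgEquiv_eq hg hbr halg hV (Finset.add_mem_add hb hb') hSs
  have key : ∀ c c', evalCoeff Rs (Fin.cons (prodCoeff A A' c c') cr) =
      (((εs * δ * ε * ε' : ℤˣ) : ℤ) : ℂ) *
        (evalCoeff R (Fin.cons c cr) * evalCoeff R' (Fin.cons c' cr)) := fun c c' => by
    rw [hε, hε', hεs, hw]
    simp only [linForm_prodCoeff, Finset.prod_mul_distrib]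
    push_cast
    linear_combination (-(((εs : ℤ) : ℂ) * ((δ : ℤ) : ℂ) * (κ * κ') *
      ((∏ η ∈ V, MvPolynomial.eval c (linForm A η)) *
        ∏ η ∈ V, MvPolynomial.eval c' (linForm A' η)))) *
      (((ε : ℤ) : ℂ) * ((ε : ℤ) : ℂ) * Int.units_cast_mul_self ℂ ε' +
        Int.units_cast_mul_self ℂ ε)
  exact ⟨_, evalCoeff_prodCoeff_of_algebraicIndependent (cr := cr) hcr key⟩

/-- The field generated by the coefficients of the last rows. -/
abbrev rowField (cr : Fin n → (Fin n → ℤ) → ℂ) : Subfield ℂ :=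
  Subfield.closure (Set.range fun p : Fin n × (Fin n → ℤ) => cr p.1 p.2)

theorem aeval_mem_rowField {cr : Fin n → (Fin n → ℤ) → ℂ}
    (g : MvPolynomial (Fin n × (Fin n → ℤ)) ℤ) :
    MvPolynomial.aeval (fun p : Fin n × (Fin n → ℤ) => cr p.1 p.2) g ∈ rowField cr := by
  induction g using MvPolynomial.induction_on with
  | C k => rw [MvPolynomial.aeval_C]; exact intCast_mem _ k
  | add p q hp hq => rw [map_add]; exact add_mem hp hq
  | mul_X p i hp =>
    rw [map_mul, MvPolynomial.aeval_X]
    exact mul_mem hp (Subfield.subset_closure ⟨i, rfl⟩)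

theorem algebraicIndependent_rowField_iff {cr : Fin n → (Fin n → ℤ) → ℂ}
    {c0 : (Fin n → ℤ) → ℂ} : AlgebraicIndependent (rowField cr) c0 ↔
      ∀ H : MvPolynomial (Fin n → ℤ) (MvPolynomial (Fin n × (Fin n → ℤ)) ℤ),
        MvPolynomial.eval₂ (MvPolynomial.aeval fun p : Fin n × (Fin n → ℤ) => cr p.1 p.2 :
          MvPolynomial (Fin n × (Fin n → ℤ)) ℤ →ₐ[ℤ] ℂ) c0 H = 0 →
        ∀ m, MvPolynomial.aeval (fun p : Fin n × (Fin n → ℤ) => cr p.1 p.2) (H.coeff m) = 0 := by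
  set φ : MvPolynomial (Fin n × (Fin n → ℤ)) ℤ →ₐ[ℤ] ℂ :=
    MvPolynomial.aeval fun p : Fin n × (Fin n → ℤ) => cr p.1 p.2 with hφ
  have hr : AlgebraicIndependent φ.range c0 ↔ AlgebraicIndependent (rowField cr) c0 := by
    refine ⟨fun h => h.subalgebraAlgebraicClosure.of_range_subset ?_,
      fun h => h.of_range_subset ?_⟩
    · rintro _ ⟨⟨d, hd⟩, rfl⟩
      refine ⟨⟨d, (Subalgebra.mem_algebraicClosure _ _).2 (isAlgebraic_of_mem_closure ?_ hd)⟩, rfl⟩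
      rintro _ ⟨p, rfl⟩
      exact isAlgebraic_algebraMap (⟨_, MvPolynomial.X p, MvPolynomial.aeval_X _ _⟩ : φ.range)
    · rintro _ ⟨⟨_, g, rfl⟩, rfl⟩
      exact ⟨⟨_, aeval_mem_rowField g⟩, rfl⟩
  rw [← hr, algebraicIndependent_iff]
  have hc : ∀ H : MvPolynomial (Fin n → ℤ) (MvPolynomial (Fin n × (Fin n → ℤ)) ℤ),
      MvPolynomial.eval₂ (φ : MvPolynomial (Fin n × (Fin n → ℤ)) ℤ →+* ℂ) c0 H =
      MvPolynomial.aeval c0 (MvPolynomial.map (φ.rangeRestrict : _ →+* φ.range) H) := by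
    intro H
    rw [MvPolynomial.aeval_def, MvPolynomial.eval₂_map]
    rfl
  constructor
  · intro h H hH m
    have := h _ ((hc H).symm.trans hH)
    have := congrArg (fun p => ((p.coeff m : φ.range) : ℂ)) this
    simpa [MvPolynomial.coeff_map] using this
  · intro h p hp
    obtain ⟨H, rfl⟩ := MvPolynomial.map_surjective (σ := Fin n → ℤ)
      (φ.rangeRestrict : MvPolynomial (Fin n × (Fin n → ℤ)) ℤ →+* φ.range)
      (by exact φ.rangeRestrict_surjective) p
    ext m
    rw [MvPolynomial.coeff_map]
    exact h H ((hc H).trans hp) m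

theorem IsGeneratorAt.exists_eq_C {c0 : (Fin n → ℤ) → ℂ} {cr : Fin n → (Fin n → ℤ) → ℂ}
    {E : MvPolynomial (Fin (n + 1) × (Fin n → ℤ)) ℤ} (h : IsGeneratorAt (Fin.cons c0 cr) E)
    (hcr : ¬ AlgebraicIndependent ℤ fun p : Fin n × (Fin n → ℤ) => cr p.1 p.2) :
    (∃ e, E = (rowAlgEquiv n).symm (MvPolynomial.C e) ∧ Prime e ∧
      ∀ g, MvPolynomial.aeval (fun p : Fin n × (Fin n → ℤ) => cr p.1 p.2) g = 0 ↔ e ∣ g) ∧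
    AlgebraicIndependent (rowField cr) c0 := by
  have h1 : ∀ H, MvPolynomial.eval₂ (MvPolynomial.aeval fun p : Fin n × (Fin n → ℤ) =>
      cr p.1 p.2 : MvPolynomial (Fin n × (Fin n → ℤ)) ℤ →ₐ[ℤ] ℂ) c0 H = 0 ↔
      rowAlgEquiv n E ∣ H := by
    intro H
    have := h.2 ((rowAlgEquiv n).symm H)
    rw [evalCoeff_cons, AlgEquiv.apply_symm_apply] at this
    rw [this, ← map_dvd_iff (rowAlgEquiv n), AlgEquiv.apply_symm_apply]
  have hC : ∀ g, MvPolynomial.aeval (fun p : Fin n × (Fin n → ℤ) => cr p.1 p.2) g = 0 ↔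
      rowAlgEquiv n E ∣ MvPolynomial.C g := by
    intro g
    rw [← h1, MvPolynomial.eval₂_C]
    rfl
  obtain ⟨g, hg, hg0⟩ : ∃ g, MvPolynomial.aeval (fun p : Fin n × (Fin n → ℤ) =>
      cr p.1 p.2) g = 0 ∧ g ≠ (0 : MvPolynomial (Fin n × (Fin n → ℤ)) ℤ) := by
    simpa [algebraicIndependent_iff] using hcr
  obtain ⟨e, -, he⟩ := (MvPolynomial.dvd_C_iff_exists hg0).1 ((hC g).1 hg)
  have hE : Prime (rowAlgEquiv n E) :=
    (MulEquiv.prime_iff (rowAlgEquiv n).toMulEquiv).2 h.1.prime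
  rw [he] at hE
  have hCe : ∀ g, MvPolynomial.aeval (fun p : Fin n × (Fin n → ℤ) => cr p.1 p.2) g = 0 ↔
      e ∣ g := by
    intro g
    rw [hC, he, MvPolynomial.C_dvd_iff_dvd_coeff]
    refine ⟨fun h => by simpa using h 0, fun h m => ?_⟩
    rw [MvPolynomial.coeff_C]
    split_ifs
    · exact h
    · exact dvd_zero _
  refine ⟨⟨e, by rw [← he, AlgEquiv.symm_apply_apply], (MvPolynomial.prime_C_iff _).1 hE, hCe⟩,
    algebraicIndependent_rowField_iff.2 fun H hH m => ?_⟩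
  rw [hCe]
  exact (MvPolynomial.C_dvd_iff_dvd_coeff _ _).1 (he ▸ (h1 H).1 hH) m

theorem isGeneratorAt_C {c0 : (Fin n → ℤ) → ℂ} {cr : Fin n → (Fin n → ℤ) → ℂ}
    {e : MvPolynomial (Fin n × (Fin n → ℤ)) ℤ} (he : Prime e)
    (hCe : ∀ g, MvPolynomial.aeval (fun p : Fin n × (Fin n → ℤ) => cr p.1 p.2) g = 0 ↔ e ∣ g)
    (h0 : AlgebraicIndependent (rowField cr) c0) :
    IsGeneratorAt (Fin.cons c0 cr) ((rowAlgEquiv n).symm (MvPolynomial.C e)) := by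
  refine ⟨((MulEquiv.prime_iff (rowAlgEquiv n).symm.toMulEquiv).2
    ((MvPolynomial.prime_C_iff _).2 he)).irreducible, fun h => ?_⟩
  rw [evalCoeff_cons]
  have hdvd : (rowAlgEquiv n).symm (MvPolynomial.C e) ∣ h ↔
      MvPolynomial.C e ∣ rowAlgEquiv n h := by
    rw [← map_dvd_iff (rowAlgEquiv n), AlgEquiv.apply_symm_apply]
  rw [hdvd, MvPolynomial.C_dvd_iff_dvd_coeff]
  refine ⟨fun hH m => (hCe _).1 (algebraicIndependent_rowField_iff.1 h0 _ hH m), fun hH => ?_⟩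
  rw [MvPolynomial.eval₂_eq]
  refine Finset.sum_eq_zero fun m _ => ?_
  exact mul_eq_zero_of_left ((hCe _).2 (hH m)) _

theorem IsAlgebraic.of_forall_isAlgebraic {D D' K : Type*} [CommRing D] [IsDomain D] [CommRing D']
    [Field K] [Algebra D K] [FaithfulSMul D K] [Algebra D' K] [FaithfulSMul D' K] {x : K}
    (hx : IsAlgebraic D' x) (h : ∀ d, IsAlgebraic D (algebraMap D' K d)) : IsAlgebraic D x := by
  have h4 : IsAlgebraic (Subalgebra.algebraicClosure D K) x := by
    refine hx.of_range_subset ?_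
    rintro _ ⟨d, rfl⟩
    exact ⟨⟨_, (Subalgebra.mem_algebraicClosure _ _).2 (h d)⟩, rfl⟩
  exact h4.restrictScalars D

/-- When the relations between the coefficients of the last rows are generated by one prime
polynomial, some base coefficient can be replaced by any number that is transcendental over
`rowField cr`. -/
theorem exists_update_algebraicIndependent {b : Fin n → Fin n → ℤ}
    {cr : Fin n → (Fin n → ℤ) → ℂ}
    (hz : AlgebraicIndependent ℤ
      fun p : {p : Fin n × (Fin n → ℤ) // p.2 ≠ b p.1} => cr p.1.1 p.1.2)
    {e : MvPolynomial (Fin n × (Fin n → ℤ)) ℤ} (he : Prime e)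
    (hCe : ∀ g, MvPolynomial.aeval (fun p : Fin n × (Fin n → ℤ) => cr p.1 p.2) g = 0 ↔ e ∣ g) :
    ∃ i₀, ∀ t : ℂ, Transcendental (rowField cr) t → AlgebraicIndependent ℤ
      (Sum.elim (Function.update (fun i => cr i (b i)) i₀ t)
        fun p : {p : Fin n × (Fin n → ℤ) // p.2 ≠ b p.1} => cr p.1.1 p.1.2) := by
  have hi : ∃ i₀, (i₀, b i₀) ∈ e.vars := by
    by_contra! h
    obtain ⟨q, rfl⟩ := MvPolynomial.exists_rename_eq_of_vars_subset_range e
      (Subtype.val : {p : Fin n × (Fin n → ℤ) // p.2 ≠ b p.1} → _) Subtype.val_injective (by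
        rintro ⟨i, a⟩ hp
        exact ⟨⟨(i, a), fun hab => h i (by rwa [← show a = b i from hab])⟩, rfl⟩)
    have h1 := (hCe _).2 dvd_rfl
    rw [MvPolynomial.aeval_rename] at h1
    have h2 := (map_eq_zero_iff _ hz).1 h1
    exact he.ne_zero (by rw [h2, map_zero])
  obtain ⟨i₀, hi₀⟩ := hi
  refine ⟨i₀, fun t ht => ?_⟩
  let w : {p : Fin n × (Fin n → ℤ) // p ≠ (i₀, b i₀)} → ℂ := fun p => cr p.1.1 p.1.2
  have hw : AlgebraicIndependent ℤ w := by
    rw [algebraicIndependent_iff]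
    intro g hg
    by_contra hg0
    have h1 : MvPolynomial.aeval (fun p : Fin n × (Fin n → ℤ) => cr p.1 p.2)
        (MvPolynomial.rename Subtype.val g) = 0 := by
      rw [MvPolynomial.aeval_rename]; exact hg
    obtain ⟨q, hq⟩ := (hCe _).1 h1
    have h2 : MvPolynomial.degreeOf (i₀, b i₀) (MvPolynomial.rename Subtype.val g) = 0 := by
      classical
      by_contra h2
      have := MvPolynomial.vars_rename _ _ (MvPolynomial.mem_vars_iff_degreeOf_ne_zero.2 h2)
      obtain ⟨p, -, hp⟩ := Finset.mem_image.1 this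
      exact p.2 hp
    have h3 : MvPolynomial.rename Subtype.val g ≠ 0 := fun h =>
      hg0 (MvPolynomial.rename_injective _ Subtype.val_injective (by rw [h, map_zero]))
    rw [hq] at h2 h3
    rw [MvPolynomial.degreeOf_mul_eq (left_ne_zero_of_mul h3) (right_ne_zero_of_mul h3)] at h2
    exact MvPolynomial.mem_vars_iff_degreeOf_ne_zero.1 hi₀ (by lia)
  have hwt : Transcendental (Algebra.adjoin ℤ (Set.range w)) t := by
    refine fun h => ht (h.of_range_subset ?_)
    rintro _ ⟨⟨x, hx⟩, rfl⟩
    refine ⟨⟨x, (Algebra.adjoin_le (S := subalgebraOfSubring (rowField cr).toSubring) ?_) hx⟩, rfl⟩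
    rintro _ ⟨p, rfl⟩
    exact Subfield.subset_closure ⟨p.1, rfl⟩
  have ho := (hw.option_iff_transcendental t).2 hwt
  let f : Fin n ⊕ {p : Fin n × (Fin n → ℤ) // p.2 ≠ b p.1} →
      Option {p : Fin n × (Fin n → ℤ) // p ≠ (i₀, b i₀)} :=
    Sum.elim (fun i => if h : i = i₀ then none else
        some ⟨(i, b i), fun h' => h (congrArg Prod.fst h')⟩)
      fun p => some ⟨p.1, fun h => p.2 (by rw [h])⟩
  have hf : Function.Injective f := by
    rintro (i | ⟨p, hp⟩) (i' | ⟨p', hp'⟩) h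
    · by_cases h1 : i = i₀ <;> by_cases h2 : i' = i₀ <;> simp_all [f]
    · by_cases h1 : i = i₀
      · simp [f, h1] at h
      · simp only [f, Sum.elim_inl, Sum.elim_inr, h1, dite_false, Option.some.injEq,
          Subtype.mk.injEq] at h
        exact absurd (by rw [← h]) hp'
    · by_cases h1 : i' = i₀
      · simp [f, h1] at h
      · simp only [f, Sum.elim_inl, Sum.elim_inr, h1, dite_false, Option.some.injEq,
          Subtype.mk.injEq] at h
        exact absurd (by rw [h]) hp
    · simpa [f] using h
  convert ho.comp f hf using 1
  ext (i | p)
  · by_cases h1 : i = i₀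
    · subst h1; simp [f]
    · simp [f, h1, w]
  · simp [f, w]

theorem exists_transcendental_coord {b : Fin n → Fin n → ℤ}
    {cr : Fin n → (Fin n → ℤ) → ℂ} {ξ : Fin n → ℂˣ}
    (hξz : AlgebraicIndependent ℤ (Sum.elim (fun j => (ξ j : ℂ))
      fun p : {p : Fin n × (Fin n → ℤ) // p.2 ≠ b p.1} => cr p.1.1 p.1.2))
    (hcr : ¬ AlgebraicIndependent ℤ fun p : Fin n × (Fin n → ℤ) => cr p.1 p.2) :
    ∃ j, Transcendental (rowField cr) (ξ j : ℂ) := by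
  set z := fun p : {p : Fin n × (Fin n → ℤ) // p.2 ≠ b p.1} => cr p.1.1 p.1.2 with hz
  by_contra! h
  refine hcr ?_
  have h1 := AlgebraicIndependent.sumElim_iff.1 hξz
  have h2 := (h1.2.exchange (x := fun i => cr i (b i)) fun j => ?_).1
  · have h3 := AlgebraicIndependent.sumElim_iff.2 ⟨h1.1, h2⟩
    let f : Fin n × (Fin n → ℤ) → Fin n ⊕ {p : Fin n × (Fin n → ℤ) // p.2 ≠ b p.1} :=
      fun p => if h : p.2 = b p.1 then Sum.inl p.1 else Sum.inr ⟨p, h⟩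
    have hf : Function.Injective f := by
      rintro ⟨i, a⟩ ⟨i', a'⟩ h
      by_cases h1 : a = b i <;> by_cases h2 : a' = b i' <;> simp_all [f]
    convert h3.comp f hf using 1
    ext p
    by_cases h1 : p.2 = b p.1
    · simp [f, h1]
    · simp [f, h1, hz]
  · have hj : IsAlgebraic (rowField cr) (ξ j : ℂ) := by simpa [Transcendental] using h j
    set B := Algebra.adjoin (Algebra.adjoin ℤ (Set.range z)) (Set.range fun i => cr i (b i))
    refine hj.of_forall_isAlgebraic fun x => isAlgebraic_of_mem_closure ?_ x.2
    rintro _ ⟨⟨i, a⟩, rfl⟩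
    by_cases hab : a = b i
    · subst hab
      exact isAlgebraic_algebraMap (⟨_, Algebra.subset_adjoin ⟨i, rfl⟩⟩ : B)
    · exact isAlgebraic_algebraMap (algebraMap (Algebra.adjoin ℤ (Set.range z)) B
        ⟨_, Algebra.subset_adjoin ⟨⟨(i, a), hab⟩, rfl⟩⟩)

theorem exists_conj_of_transcendental {A : Fin n → Finset (Fin n → ℤ)} {b : Fin n → Fin n → ℤ}
    (hb : ∀ i, b i ∈ A i) {cr : Fin n → (Fin n → ℤ) → ℂ} {i₀ : Fin n}
    (hI : ∀ t : ℂ, Transcendental (rowField cr) t → AlgebraicIndependent ℤ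
      (Sum.elim (Function.update (fun i => cr i (b i)) i₀ t)
        fun p : {p : Fin n × (Fin n → ℤ) // p.2 ≠ b p.1} => cr p.1.1 p.1.2))
    {η η' : Fin n → ℂˣ} (hη : ∀ i, ∑ a ∈ A i, cr i a * chEval η a = 0)
    (hη' : ∀ i, ∑ a ∈ A i, cr i a * chEval η' a = 0) {j j' : Fin n}
    (hj : Transcendental (rowField cr) (η j : ℂ))
    (hj' : Transcendental (rowField cr) (η' j' : ℂ)) :
    ∃ σ : ℂ ≃ₐ[rowField cr] ℂ, conjPt ((σ : ℂ ≃+* ℂ) : ℂ →+* ℂ) η = η' := by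
  have halg : ∀ {η : Fin n → ℂˣ}, (∀ i, ∑ a ∈ A i, cr i a * chEval η a = 0) → ∀ j i,
      IsAlgebraic (Algebra.adjoin (Algebra.adjoin ℤ (Set.range
        fun p : {p : Fin n × (Fin n → ℤ) // p.2 ≠ b p.1} => cr p.1.1 p.1.2))
        (Set.range fun j => (η j : ℂ)))
        (Function.update (fun i => cr i (b i)) i₀ (η j : ℂ) i) := by
    intro η hη j i
    by_cases hi : i = i₀
    · subst hi
      rw [Function.update_self]
      exact isAlgebraic_algebraMap (⟨η j, Algebra.subset_adjoin ⟨j, rfl⟩⟩ :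
        Algebra.adjoin (Algebra.adjoin ℤ _) (Set.range fun j => (η j : ℂ)))
    · rw [Function.update_of_ne hi]
      exact isAlgebraic_coeff_base hb hη i
  obtain ⟨σ, hσz, hσ⟩ := exists_conj_of_algebraicIndependent (hI _ hj) (hI _ hj')
    (halg hη j) (halg hη' j')
  refine ⟨AlgEquiv.ofRingEquiv (f := σ) fun d => eq_of_mem_closure ?_ d.2, hσ⟩
  rintro _ ⟨p, rfl⟩
  exact map_coeff_eq hb hη (hσ ▸ hη') hσz _ _

open Polynomial in
/-- The valuation at infinity of a rational function field extends to any larger field. -/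
theorem exists_valuation_eq_pow_natDegree {k K : Type*} [Field k] [Field K] [Algebra k[X] K]
    [FaithfulSMul k[X] K] : ∃ (O : ValuationSubring K) (γ : O.ValueGroup), 1 < γ ∧
      O.valuation (algebraMap k[X] K X) = γ ∧
      ∀ p : k[X], p ≠ 0 → O.valuation (algebraMap k[X] K p) = γ ^ p.natDegree := by
  set s := algebraMap k[X] K X with hs
  set i : k →+* K := (algebraMap k[X] K).comp C with hi
  have hinj := FaithfulSMul.algebraMap_injective k[X] K
  have hs0 : s ≠ 0 := (map_ne_zero_iff _ hinj).2 X_ne_zero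
  have hev : ∀ p, eval₂ i s p = algebraMap k[X] K p := by
    intro p
    rw [hi, hs, ← hom_eval₂, eval₂_C_X]
  have hrev : ∀ p : k[X], eval₂ i s⁻¹ p.reverse * s ^ p.natDegree = algebraMap k[X] K p := by
    intro p
    let _ : Invertible s := invertibleOfNonzero hs0
    rw [← hev, ← eval₂_reverse_mul_pow i s p, invOf_eq_inv]
  have hrev' : ∀ p : k[X], algebraMap k[X] K p.reverse * s⁻¹ ^ p.natDegree = eval₂ i s⁻¹ p := by
    intro p
    let _ : Invertible s⁻¹ := invertibleOfNonzero (inv_ne_zero hs0)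
    rw [← hev, ← eval₂_reverse_mul_pow i s⁻¹ p, invOf_eq_inv, inv_inv]
  let alg : Algebra k[X] K := (eval₂RingHom i s⁻¹).toAlgebra
  have hinj' : Function.Injective (eval₂RingHom i s⁻¹) := by
    rw [injective_iff_map_eq_zero]
    intro p hp
    rw [coe_eval₂RingHom, ← hrev' p, mul_eq_zero, map_eq_zero_iff _ hinj] at hp
    exact reverse_eq_zero.1 (hp.resolve_right (pow_ne_zero _ (inv_ne_zero hs0)))
  have hf : @FaithfulSMul k[X] K alg.toSMul :=
    (@faithfulSMul_iff_algebraMap_injective k[X] K _ _ alg).2 hinj'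
  obtain ⟨O, -, h1, h2⟩ := @exists_valuationSubring_of_prime k[X] _ _ K _ alg hf X prime_X
  replace h2 : O.valuation s⁻¹ < 1 := by
    convert h2 using 2
    exact (eval₂_X i s⁻¹).symm
  refine ⟨O, O.valuation s, ?_, rfl, fun p hp => ?_⟩
  · rw [map_inv₀] at h2
    exact (inv_lt_one₀ (zero_lt_iff.2 ((Valuation.ne_zero_iff _).2 hs0))).1 h2
  · rw [← hrev, map_mul, map_pow]
    refine mul_eq_right₀ (pow_ne_zero _ ((Valuation.ne_zero_iff _).2 hs0)) |>.2 (h1 _ ?_)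
    rw [X_dvd_iff, coeff_zero_reverse]
    exact leadingCoeff_ne_zero.2 hp

open Polynomial in
/-- The largest degree of a coefficient. -/
def coeffDegree {τ k : Type*} [Field k] (S : MvPolynomial τ k[X]) : ℕ :=
  S.support.sup fun m => (S.coeff m).natDegree

open Polynomial in
theorem isPrimitiveFor_inv_pow_coeffDegree {τ k K : Type*} [Field k] [Field K] [Algebra k[X] K]
    {O : ValuationSubring K} {γ : O.ValueGroup} (hγ : 1 < γ)
    (hX : O.valuation (algebraMap k[X] K X) = γ)
    (hO : ∀ p : k[X], p ≠ 0 → O.valuation (algebraMap k[X] K p) = γ ^ p.natDegree)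
    {S : MvPolynomial τ k[X]} (hS : S ≠ 0) :
    IsPrimitiveFor O (MvPolynomial.C (algebraMap k[X] K X ^ coeffDegree S)⁻¹ *
      MvPolynomial.map (algebraMap k[X] K) S) := by
  have hγ0 : γ ≠ 0 := (zero_lt_one.trans hγ).ne'
  have hv : ∀ m ∈ S.support, O.valuation (MvPolynomial.coeff m (MvPolynomial.C
      (algebraMap k[X] K X ^ coeffDegree S)⁻¹ * MvPolynomial.map (algebraMap k[X] K) S)) =
      (γ ^ coeffDegree S)⁻¹ * γ ^ (S.coeff m).natDegree := fun m hm => by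
    rw [MvPolynomial.coeff_C_mul, MvPolynomial.coeff_map, map_mul, map_inv₀, map_pow, hX,
      hO _ (MvPolynomial.mem_support_iff.1 hm)]
  obtain ⟨m, hm, hmax⟩ := Finset.exists_mem_eq_sup S.support
    (MvPolynomial.support_nonempty.2 hS) fun m => (S.coeff m).natDegree
  refine IsPrimitiveFor.of_coeff (fun m => ?_) (m := m) ?_
  · by_cases hm : m ∈ S.support
    · rw [← O.valuation_le_one_iff, hv m hm]
      exact inv_mul_le_one_of_le₀ (pow_le_pow_right₀ hγ.le
        (Finset.le_sup (f := fun m => (S.coeff m).natDegree) hm)) zero_le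
    · rw [MvPolynomial.coeff_C_mul, MvPolynomial.coeff_map, MvPolynomial.notMem_support_iff.1 hm,
        map_zero, mul_zero]
      exact zero_mem _
  · rw [hv m hm, coeffDegree, hmax, inv_mul_cancel₀ (pow_ne_zero _ hγ0)]

open Polynomial in
/-- The coefficient degree of norm polynomials is additive. -/
theorem IsNormPoly.coeffDegree_add {k : Type*} [Field k] [Algebra k[X] ℂ] [FaithfulSMul k[X] ℂ]
    {V : Finset (Fin n → ℂˣ)} {A A' : Finset (Fin n → ℤ)}
    (hA : A.Nonempty) (hA' : A'.Nonempty) {c c' cs : (Fin n → ℤ) → ℂ}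
    {S S' Ss : MvPolynomial (Fin n → ℤ) k[X]} {d d' ds : ℕ} {κ κ' κs : ℂ}
    (h : IsNormPoly k[X] V A c S d κ) (h' : IsNormPoly k[X] V A' c' S' d' κ')
    (hs : IsNormPoly k[X] V (A + A') cs Ss ds κs) :
    ds * coeffDegree Ss = d * coeffDegree S + d' * coeffDegree S' := by
  obtain ⟨u, hu⟩ := h.exists_unit hA hA' h' hs
  obtain ⟨O, γ, hγ, hX, hO⟩ := exists_valuation_eq_pow_natDegree (k := k) (K := ℂ)
  have hγ0 : γ ≠ 0 := (zero_lt_one.trans hγ).ne'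
  have hu1 : O.valuation (algebraMap k[X] ℂ u) = 1 := by
    rw [hO _ u.ne_zero, natDegree_coe_units, pow_zero]
  have hprim : ∀ {A : Finset (Fin n → ℤ)} {c : (Fin n → ℤ) → ℂ}
      {S : MvPolynomial (Fin n → ℤ) k[X]} {d : ℕ} {κ : ℂ}, IsNormPoly k[X] V A c S d κ →
      IsPrimitiveFor O (MvPolynomial.C (((algebraMap k[X] ℂ X ^ coeffDegree S)⁻¹) ^ d * κ) *
        ∏ η ∈ V, linForm A η) := by
    intro A c S d κ h
    have := (isPrimitiveFor_inv_pow_coeffDegree hγ hX hO h.irreducible.ne_zero).pow d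
    rwa [mul_pow, h.map_pow, ← mul_assoc, ← _root_.map_pow MvPolynomial.C,
      ← map_mul MvPolynomial.C] at this
  have := valuation_sum_eq_mul hA hA' (hprim h) (hprim h') (hprim hs)
  have hv : ∀ {κ : ℂ}, κ ≠ 0 → O.valuation κ ≠ 0 := (Valuation.ne_zero_iff _).2
  have hκ := hv h.ne_zero
  have hκ' := hv h'.ne_zero
  simp only [hu, map_mul, _root_.map_pow, map_inv₀, hX, hu1, one_mul] at this
  rw [inv_pow, inv_pow, inv_pow, mul_mul_mul_comm, ← mul_inv] at this
  have := inv_injective (mul_right_cancel₀ (mul_ne_zero hκ hκ') this)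
  rw [← pow_mul, ← pow_mul, ← pow_mul, ← pow_add] at this
  have := pow_right_injective₀ (zero_lt_one.trans hγ) hγ.ne' this
  lia

section

open Polynomial

variable {τ k : Type*} [Field k]

/-- A polynomial with coefficients in `k[X]`, seen as a polynomial in `X`. -/
def mvPolySwap (τ k : Type*) [Field k] : MvPolynomial τ k[X] ≃+* (MvPolynomial τ k)[X] :=
  ((MvPolynomial.optionEquivRight k τ).symm.trans (MvPolynomial.optionEquivLeft k τ)).toRingEquiv

theorem mvPolySwap_X (a : τ) :
    mvPolySwap τ k (MvPolynomial.X a) = C (MvPolynomial.X a) := by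
  change MvPolynomial.optionEquivLeft k τ ((MvPolynomial.optionEquivRight k τ).symm _) = _
  rw [← MvPolynomial.optionEquivRight_X_some, AlgEquiv.symm_apply_apply,
    MvPolynomial.optionEquivLeft_X_some]

theorem mvPolySwap_C (p : k[X]) :
    mvPolySwap τ k (MvPolynomial.C p) = p.map MvPolynomial.C := by
  change MvPolynomial.optionEquivLeft k τ ((MvPolynomial.optionEquivRight k τ).symm _) = _
  induction p using Polynomial.induction_on' with
  | add p q hp hq => rw [map_add, map_add, map_add, hp, hq, Polynomial.map_add]
  | monomial i r =>
    rw [← C_mul_X_pow_eq_monomial, map_mul, map_pow, ← MvPolynomial.optionEquivRight_X_none,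
      ← MvPolynomial.optionEquivRight_C, map_mul, map_pow, AlgEquiv.symm_apply_apply,
      AlgEquiv.symm_apply_apply, map_mul, map_pow, MvPolynomial.optionEquivLeft_C,
      MvPolynomial.optionEquivLeft_X_none]
    simp

theorem coeff_coeff_mvPolySwap (S : MvPolynomial τ k[X]) (i : ℕ) (m : τ →₀ ℕ) :
    ((mvPolySwap τ k S).coeff i).coeff m = (S.coeff m).coeff i := by
  classical
  induction S using MvPolynomial.induction_on generalizing m with
  | C p =>
    rw [mvPolySwap_C, coeff_map, MvPolynomial.coeff_C, MvPolynomial.coeff_C]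
    split_ifs <;> simp
  | add p q hp hq => rw [map_add, coeff_add, MvPolynomial.coeff_add, MvPolynomial.coeff_add,
      coeff_add, hp, hq]
  | mul_X p a hp =>
    rw [map_mul, mvPolySwap_X, coeff_mul_C, MvPolynomial.coeff_mul_X', MvPolynomial.coeff_mul_X']
    split_ifs
    · exact hp _
    · simp

theorem natDegree_mvPolySwap (S : MvPolynomial τ k[X]) :
    (mvPolySwap τ k S).natDegree = coeffDegree S := by
  refine le_antisymm (natDegree_le_iff_coeff_eq_zero.2 fun i hi => ?_)
    (Finset.sup_le fun m hm => ?_)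
  · ext m
    rw [coeff_coeff_mvPolySwap]
    by_cases hm : m ∈ S.support
    · exact coeff_eq_zero_of_natDegree_lt ((Finset.le_sup
        (f := fun m => (S.coeff m).natDegree) hm).trans_lt hi)
    · rw [MvPolynomial.notMem_support_iff.1 hm]; simp
  · refine natDegree_le_iff_coeff_eq_zero.2 fun i hi => ?_
    rw [← coeff_coeff_mvPolySwap, coeff_eq_zero_of_natDegree_lt hi]; simp

theorem eval₂_mvPolySwap {K : Type*} [Field K] [Algebra k K] (c : τ → K) (t : K)
    (S : MvPolynomial τ k[X]) :
    (mvPolySwap τ k S).eval₂ (MvPolynomial.aeval c : MvPolynomial τ k →ₐ[k] K) t =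
      MvPolynomial.eval₂ (Polynomial.aeval t : k[X] →ₐ[k] K) c S := by
  induction S using MvPolynomial.induction_on with
  | C p =>
    rw [mvPolySwap_C, eval₂_map, MvPolynomial.eval₂_C]
    change _ = Polynomial.aeval t p
    rw [Polynomial.aeval_def]
    congr 1
    ext x
    simp
  | add p q hp hq => rw [map_add, eval₂_add, MvPolynomial.eval₂_add, hp, hq]
  | mul_X p a hp =>
    rw [map_mul, mvPolySwap_X, eval₂_mul, MvPolynomial.eval₂_mul, hp, eval₂_C,
      MvPolynomial.eval₂_X]
    simp

end

instance countable_rowField (cr : Fin n → (Fin n → ℤ) → ℂ) : Countable (rowField cr) := by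
  rw [← Cardinal.mk_le_aleph0_iff]
  exact (Subfield.cardinalMk_closure_le_max _).trans
    (max_le (Cardinal.mk_le_aleph0_iff.2 (Set.countable_range _).to_subtype) le_rfl)

section

open Polynomial

variable {L : Type} [CommRing L] [IsDomain L] [UniqueFactorizationMonoid L] [Algebra L ℂ]
  [FaithfulSMul L ℂ]

theorem Polynomial.nodup_aroots_of_irreducible {Q : L[X]} (hQ : Irreducible Q) :
    (Q.aroots ℂ).Nodup := by
  classical
  have hinj := FaithfulSMul.algebraMap_injective L ℂ
  have : CharZero L := by
    refine ⟨fun m m' h => ?_⟩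
    have := congrArg (algebraMap L ℂ) h
    simpa using this
  rw [Multiset.nodup_iff_count_le_one]
  intro t
  rw [aroots, count_roots]
  by_contra! h
  have h0 : Q.map (algebraMap L ℂ) ≠ 0 := (Polynomial.map_ne_zero_iff hinj).2 hQ.ne_zero
  obtain ⟨h1, h2⟩ := (one_lt_rootMultiplicity_iff_isRoot h0).1 h
  rw [derivative_map, IsRoot.def, eval_map_algebraMap] at h2
  rw [IsRoot.def, eval_map_algebraMap] at h1
  have h3 := dvd_of_irreducible_of_aeval_eq_zero hQ h1 h2
  by_cases h4 : Q.natDegree = 0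
  · rw [eq_C_of_natDegree_eq_zero h4, aeval_C, map_eq_zero_iff _ hinj] at h1
    exact hQ.ne_zero (by rw [eq_C_of_natDegree_eq_zero h4, h1, C_0])
  · have h5 := natDegree_le_of_dvd h3 fun h => h4 (derivative_eq_zero.1 h)
    have := natDegree_derivative_lt h4
    lia

theorem Polynomial.natCard_root_of_irreducible {Q : L[X]} (hQ : Irreducible Q) :
    Nat.card {t : ℂ // aeval t Q = 0} = Q.natDegree := by
  classical
  rw [← IsAlgClosed.card_aroots_eq_natDegree (B := ℂ) (p := Q),
    ← Multiset.toFinset_card_of_nodup (nodup_aroots_of_irreducible hQ)]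
  exact Nat.subtype_card _ fun t => by
    rw [Multiset.mem_toFinset, mem_aroots, and_iff_right hQ.ne_zero]

theorem Polynomial.exists_algEquiv_apply_eq_of_irreducible [Countable L] {Q : L[X]}
    (hQ : Irreducible Q) {s t : ℂ} (hs : aeval s Q = 0) (ht : aeval t Q = 0) :
    ∃ σ : ℂ ≃ₐ[L] ℂ, σ s = t :=
  exists_algEquiv_apply_eq' s t fun _ =>
    ⟨fun h => aeval_eq_zero_of_dvd_aeval_eq_zero (dvd_of_irreducible_of_aeval_eq_zero hQ hs h) ht,
      fun h => aeval_eq_zero_of_dvd_aeval_eq_zero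
        (dvd_of_irreducible_of_aeval_eq_zero hQ ht h) hs⟩

end

theorem Nat.card_eq_card_mul_of_forall_fiber {α β : Type*} [Finite β] (f : α → β) {d : ℕ}
    [∀ y, Finite {x // f x = y}]
    (h : ∀ y, Nat.card {x // f x = y} = d) : Nat.card α = Nat.card β * d := by
  have := Fintype.ofFinite β
  rw [← Nat.card_congr (Equiv.sigmaFiberEquiv f), Nat.card_sigma, Finset.sum_congr rfl
    fun y _ => h y, Finset.sum_const, Nat.card_eq_fintype_card, smul_eq_mul, Finset.card_univ]

theorem sum_mul_chEval_conjPt {A : Finset (Fin n → ℤ)} {c : (Fin n → ℤ) → ℂ} {σ : ℂ →+* ℂ}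
    (hσ : ∀ a, σ (c a) = c a) {η : Fin n → ℂˣ} :
    ∑ a ∈ A, c a * chEval (conjPt σ η) a = σ (∑ a ∈ A, c a * chEval η a) := by
  simp only [map_sum, map_mul, chEval_conjPt, hσ]

open Polynomial in
theorem IsNormPoly.coeffDegree_eq_zero {k : Type*} [Field k] [Algebra k ℂ] [Algebra k[X] ℂ]
    [IsScalarTower k k[X] ℂ] {V : Finset (Fin n → ℂˣ)} {A : Finset (Fin n → ℤ)}
    {c : (Fin n → ℤ) → ℂ} {S : MvPolynomial (Fin n → ℤ) k[X]} {d : ℕ} {κ : ℂ}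
    (h : IsNormPoly k[X] V A c S d κ) (hc : ¬ AlgebraicIndependent k c) : coeffDegree S = 0 := by
  rw [algebraicIndependent_iff] at hc
  push Not at hc
  obtain ⟨p, hp, hp0⟩ := hc
  have h1 : MvPolynomial.aeval c (MvPolynomial.map C p : MvPolynomial (Fin n → ℤ) k[X]) = 0 := by
    rw [← hp]
    exact MvPolynomial.aeval_map_algebraMap k[X] c p
  have h2 := map_dvd (mvPolySwap (Fin n → ℤ) k) ((h.aeval_eq_zero_iff _).1 h1)
  have h3 : mvPolySwap (Fin n → ℤ) k (MvPolynomial.map C p) = C p := by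
    ext i m
    rw [coeff_coeff_mvPolySwap, MvPolynomial.coeff_map, coeff_C, coeff_C]
    split_ifs <;> simp
  rw [h3] at h2
  have h4 := natDegree_le_of_dvd h2 (C_ne_zero.2 hp0)
  rw [natDegree_C, natDegree_mvPolySwap] at h4
  exact Nat.le_zero.1 h4

open Polynomial in
open scoped Classical in
/-- The number of common roots is the coefficient degree times the size of one fibre of the
`j`-th coordinate. -/
theorem IsNormPoly.natCard_isRootOf {Ar : Fin n → Finset (Fin n → ℤ)} {br : Fin n → Fin n → ℤ}
    (hbr : ∀ i, br i ∈ Ar i) {cr : Fin n → (Fin n → ℤ) → ℂ} {i₀ : Fin n}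
    (hI : ∀ t : ℂ, Transcendental (rowField cr) t → AlgebraicIndependent ℤ
      (Sum.elim (Function.update (fun i => cr i (br i)) i₀ t)
        fun p : {p : Fin n × (Fin n → ℤ) // p.2 ≠ br p.1} => cr p.1.1 p.1.2))
    {ξ : Fin n → ℂˣ} {j : Fin n} (hj : Transcendental (rowField cr) (ξ j : ℂ))
    [Algebra (rowField cr)[X] ℂ]
    (halg : ∀ p : (rowField cr)[X], algebraMap (rowField cr)[X] ℂ p = aeval (ξ j : ℂ) p)
    {V : Finset (Fin n → ℂˣ)} (hξ : ξ ∈ V)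
    (hV : ∀ η, η ∈ V ↔ (∀ i, ∑ a ∈ Ar i, cr i a * chEval η a = 0) ∧ η j = ξ j)
    {A : Finset (Fin n → ℤ)} (hA : A.Nonempty) {c : (Fin n → ℤ) → ℂ}
    (hc : AlgebraicIndependent (rowField cr) c)
    {S : MvPolynomial (Fin n → ℤ) (rowField cr)[X]} {κ : ℂ}
    (h : IsNormPoly (rowField cr)[X] V A c S
      (V.filter fun η => ∑ a ∈ A, c a * chEval η a = 0).card κ) :
    Nat.card {η // IsRootOf (Fin.cons A Ar) (Fin.cons c cr) η} =
      (V.filter fun η => ∑ a ∈ A, c a * chEval η a = 0).card * coeffDegree S := by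
  set d := (V.filter fun η => ∑ a ∈ A, c a * chEval η a = 0).card with hd
  let L := MvPolynomial (Fin n → ℤ) (rowField cr)
  let _ : Algebra L ℂ := (MvPolynomial.aeval c : L →ₐ[rowField cr] ℂ).toRingHom.toAlgebra
  have : FaithfulSMul L ℂ := (faithfulSMul_iff_algebraMap_injective L ℂ).2 hc
  have : Countable L := MvPolynomial.countable
  set Q : L[X] := mvPolySwap (Fin n → ℤ) (rowField cr) S
  have hQ : Irreducible Q :=
    (MulEquiv.irreducible_iff (mvPolySwap (Fin n → ℤ) (rowField cr))).2 h.irreducible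
  have hev : ∀ t : ℂ, aeval t Q =
      MvPolynomial.eval₂ (aeval t : (rowField cr)[X] →ₐ[rowField cr] ℂ) c S := fun t =>
    eval₂_mvPolySwap c t S
  have hQs : aeval (ξ j : ℂ) Q = 0 := by
    have := (h.aeval_eq_zero_iff S).2 dvd_rfl
    rw [MvPolynomial.aeval_def,
      show algebraMap (rowField cr)[X] ℂ = _ from RingHom.ext halg] at this
    rw [hev]
    exact this
  have hkc : ∀ (σ : ℂ ≃ₐ[rowField cr] ℂ) i a, σ (cr i a) = cr i a := fun σ i a =>
    σ.commutes (⟨cr i a, Subfield.subset_closure ⟨(i, a), rfl⟩⟩ : (rowField cr))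
  have hLc : ∀ (σ : ℂ ≃ₐ[L] ℂ) a, σ (c a) = c a := fun σ a => by
    have := σ.commutes (MvPolynomial.X a : L)
    rwa [show algebraMap L ℂ (MvPolynomial.X a) = c a from MvPolynomial.aeval_X _ _] at this
  have hLcr : ∀ (σ : ℂ ≃ₐ[L] ℂ) i a, σ (cr i a) = cr i a := fun σ i a => by
    have := σ.commutes (MvPolynomial.C ⟨cr i a, Subfield.subset_closure ⟨(i, a), rfl⟩⟩ : L)
    rwa [show algebraMap L ℂ (MvPolynomial.C ⟨cr i a, _⟩) = cr i a from
      MvPolynomial.aeval_C _ _] at this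
  have hroot : ∀ η, IsRootOf (Fin.cons A Ar) (Fin.cons c cr) η → aeval (η j : ℂ) Q = 0 := by
    intro η hη
    rw [isRootOf_cons_iff] at hη
    obtain ⟨l, hl⟩ : ∃ l, Transcendental (rowField cr) (η l : ℂ) := by
      by_contra! hl
      obtain ⟨a, ha⟩ := hA
      exact chEval_ne_zero η a (eq_zero_of_sum_mul_eq_zero hc (fun a _ =>
        isAlgebraic_chEval (fun l => by simpa [Transcendental] using hl l) a) hη.1 a ha)
    obtain ⟨σ, hσ⟩ := exists_conj_of_transcendental hbr hI ((hV ξ).1 hξ).1 hη.2 hj hl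
    have hσj : σ (ξ j) = η j := by rw [← hσ]; rfl
    have h1 := congrArg (MvPolynomial.eval fun a => σ.symm (c a)) h.map_pow
    rw [map_mul, map_prod, Finset.prod_eq_zero hξ, mul_zero, _root_.map_pow] at h1
    · have h2 := congrArg σ (eq_zero_of_pow_eq_zero h1)
      rw [map_zero, MvPolynomial.eval_map] at h2
      rw [hev, ← h2]
      change _ = (σ : ℂ →+* ℂ) _
      rw [MvPolynomial.eval₂_comp_left]
      congr 1
      · ext p <;> simp [halg, ← hσj]
      · ext a; simp
    · rw [eval_linForm, ← map_eq_zero_iff σ σ.injective, ← hη.1, map_sum]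
      refine Finset.sum_congr rfl fun a _ => ?_
      rw [map_mul, AlgEquiv.apply_symm_apply, ← hσ, chEval_conjPt]
      rfl
  have hconj : ∀ (σ : ℂ ≃ₐ[L] ℂ) η,
      IsRootOf (Fin.cons A Ar) (Fin.cons c cr) η →
        IsRootOf (Fin.cons A Ar) (Fin.cons c cr) (conjPt ((σ : ℂ ≃+* ℂ) : ℂ →+* ℂ) η) := by
    intro σ η hη
    rw [isRootOf_cons_iff] at hη ⊢
    refine ⟨?_, fun i => ?_⟩
    · rw [sum_mul_chEval_conjPt (hLc σ), hη.1, map_zero]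
    · rw [sum_mul_chEval_conjPt (hLcr σ i), hη.2 i, map_zero]
  let f : {η // IsRootOf (Fin.cons A Ar) (Fin.cons c cr) η} → {t : ℂ // aeval t Q = 0} :=
    fun η => ⟨η.1 j, hroot η.1 η.2⟩
  have hfib : ∀ t, Nonempty ({η // η ∈ V.filter fun η => ∑ a ∈ A, c a * chEval η a = 0} ≃
      {η // f η = t}) := by
    intro t
    obtain ⟨σ, hσ⟩ := exists_algEquiv_apply_eq_of_irreducible hQ hQs t.2
    have hW : ∀ η, η ∈ V.filter (fun η => ∑ a ∈ A, c a * chEval η a = 0) ↔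
        IsRootOf (Fin.cons A Ar) (Fin.cons c cr) η ∧ η j = ξ j := by
      intro η
      rw [Finset.mem_filter, hV, isRootOf_cons_iff]
      tauto
    refine ⟨⟨fun η => ⟨⟨_, hconj σ _ ((hW _).1 η.2).1⟩, Subtype.ext ?_⟩, fun η =>
      ⟨_, (hW _).2 ⟨hconj σ.symm _ η.1.2, Units.ext ?_⟩⟩, fun η => ?_, fun η => ?_⟩⟩
    · change σ (η.1 j) = t.1
      rw [((hW _).1 η.2).2, hσ]
    · change σ.symm (η.1.1 j) = ξ j
      rw [show (η.1.1 j : ℂ) = σ (ξ j) from (congrArg Subtype.val η.2).trans hσ.symm,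
        AlgEquiv.symm_apply_apply]
    · refine Subtype.ext (funext fun l => Units.ext ?_)
      exact σ.symm_apply_apply _
    · refine Subtype.ext (Subtype.ext (funext fun l => Units.ext ?_))
      exact σ.apply_symm_apply _
  have : Finite {t : ℂ // aeval t Q = 0} :=
    Set.Finite.to_subtype ((Q.aroots ℂ).toFinset.finite_toSet.subset fun t ht =>
      Finset.mem_coe.2 (Multiset.mem_toFinset.2 (mem_aroots.2 ⟨hQ.ne_zero, ht⟩)))
  have : ∀ t, Finite {η // f η = t} := fun t => Finite.of_equiv _ (hfib t).some
  rw [Nat.card_eq_card_mul_of_forall_fiber f (d := d) fun t => ?_,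
    natCard_root_of_irreducible hQ, natDegree_mvPolySwap, mul_comm]
  rw [← Nat.card_congr (hfib t).some, Nat.card_eq_fintype_card, Fintype.card_coe]

open Polynomial in
open scoped Classical in
theorem IsResultant.exists_eq_mul_C_pow {ξ : Fin n → ℂˣ} {u : Fin (n + 1) → (Fin n → ℤ) → ℂ}
    (hg : IsGenericPair ξ u) {Ar : Fin n → Finset (Fin n → ℤ)} {br : Fin n → Fin n → ℤ}
    (hbr : ∀ i, br i ∈ Ar i) {cr : Fin n → (Fin n → ℤ) → ℂ}
    (hcr : cr = fun i => fillRow (Ar i) (br i) ξ (u i.succ))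
    {e : MvPolynomial (Fin n × (Fin n → ℤ)) ℤ} (he : Prime e)
    (hCe : ∀ g, MvPolynomial.aeval (fun p : Fin n × (Fin n → ℤ) => cr p.1 p.2) g = 0 ↔ e ∣ g)
    {i₀ : Fin n} (hI : ∀ t : ℂ, Transcendental (rowField cr) t → AlgebraicIndependent ℤ
      (Sum.elim (Function.update (fun i => cr i (br i)) i₀ t)
        fun p : {p : Fin n × (Fin n → ℤ) // p.2 ≠ br p.1} => cr p.1.1 p.1.2))
    {j : Fin n} (hj : Transcendental (rowField cr) (ξ j : ℂ))
    [Algebra (rowField cr)[X] ℂ]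
    (halg : ∀ p : (rowField cr)[X], algebraMap (rowField cr)[X] ℂ p = aeval (ξ j : ℂ) p)
    {V : Finset (Fin n → ℂˣ)} (hξ : ξ ∈ V)
    (hV : ∀ η, η ∈ V ↔ (∀ i, ∑ a ∈ Ar i, cr i a * chEval η a = 0) ∧ η j = ξ j)
    {A : Finset (Fin n → ℤ)} {b : Fin n → ℤ} (hb : b ∈ A)
    {R : MvPolynomial (Fin (n + 1) × (Fin n → ℤ)) ℤ} (hR : IsResultant (Fin.cons A Ar) R)
    {S : MvPolynomial (Fin n → ℤ) (rowField cr)[X]} {κ : ℂ}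
    (h : IsNormPoly (rowField cr)[X] V A (fillRow A b ξ (u 0)) S
      (V.filter fun η => ∑ a ∈ A, fillRow A b ξ (u 0) a * chEval η a = 0).card κ) :
    ∃ ε : ℤˣ, R = ((ε : ℤ) : MvPolynomial (Fin (n + 1) × (Fin n → ℤ)) ℤ) *
      (rowAlgEquiv n).symm (MvPolynomial.C e) ^
        ((V.filter fun η => ∑ a ∈ A, fillRow A b ξ (u 0) a * chEval η a = 0).card *
          coeffDegree S) := by
  have hfill : fillIn (Fin.cons A Ar) (Fin.cons b br) ξ u =
      Fin.cons (fillRow A b ξ (u 0)) cr := by rw [fillIn_cons, hcr]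
  by_cases hc : AlgebraicIndependent (rowField cr) (fillRow A b ξ (u 0))
  · obtain ⟨ε, hε⟩ := hR.exists_eq_mul_pow (forall_cons_mem hb hbr) hg
      (hfill ▸ isGeneratorAt_C (cr := cr) he hCe hc)
    rw [hfill, h.natCard_isRootOf hbr hI hj halg hξ hV ⟨b, hb⟩ hc] at hε
    exact ⟨ε, hε⟩
  · have : IsScalarTower (rowField cr) (rowField cr)[X] ℂ :=
      IsScalarTower.of_algebraMap_eq fun x => by
        rw [halg, Polynomial.algebraMap_apply, aeval_C]; rfl
    rw [h.coeffDegree_eq_zero hc, mul_zero, pow_zero]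
    have hni : ¬ AlgebraicIndependent ℤ fun p : Fin n × (Fin n → ℤ) => cr p.1 p.2 := fun hi =>
      he.ne_zero ((map_eq_zero_iff _ hi).1 ((hCe e).2 dvd_rfl))
    obtain ⟨E, hE, -⟩ | ⟨h1, -⟩ := hR.exists_generator_or (forall_cons_mem hb hbr) hg
    · rw [hfill] at hE
      exact absurd (hE.exists_eq_C hni).2 hc
    · obtain h1 | h1 := h1
      · exact ⟨1, by simp [h1]⟩
      · exact ⟨-1, by simp [h1]⟩

open scoped Classical in
/-- The product formula when the coefficients of the last rows satisfy a relation. -/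
theorem IsResultant.product_of_not_algebraicIndependent {ξ : Fin n → ℂˣ}
    {u : Fin (n + 1) → (Fin n → ℤ) → ℂ} (hg : IsGenericPair ξ u)
    {Ar : Fin n → Finset (Fin n → ℤ)} {br : Fin n → Fin n → ℤ} (hbr : ∀ i, br i ∈ Ar i)
    (hcr : ¬ AlgebraicIndependent ℤ fun p : Fin n × (Fin n → ℤ) =>
      fillRow (Ar p.1) (br p.1) ξ (u p.1.succ) p.2)
    {A A' : Finset (Fin n → ℤ)} {b b' : Fin n → ℤ} (hb : b ∈ A) (hb' : b' ∈ A')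
    {R R' Rs : MvPolynomial (Fin (n + 1) × (Fin n → ℤ)) ℤ} (hR : IsResultant (Fin.cons A Ar) R)
    (hR' : IsResultant (Fin.cons A' Ar) R') (hRs : IsResultant (Fin.cons (A + A') Ar) Rs) :
    ∃ ε : ℤˣ, ∀ c c' cr, evalCoeff Rs (Fin.cons (prodCoeff A A' c c') cr) =
      ((ε : ℤ) : ℂ) * (evalCoeff R (Fin.cons c cr) * evalCoeff R' (Fin.cons c' cr)) := by
  by_cases hgen : ∃ c0 E, IsGeneratorAt
      (Fin.cons c0 fun i => fillRow (Ar i) (br i) ξ (u i.succ)) E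
  swap
  · have h1 : ∀ {B : Finset (Fin n → ℤ)} {b : Fin n → ℤ}
        {R : MvPolynomial (Fin (n + 1) × (Fin n → ℤ)) ℤ}, b ∈ B → IsResultant (Fin.cons B Ar) R →
        ∃ ε : ℤˣ, ∀ c, evalCoeff R c = ((ε : ℤ) : ℂ) := by
      intro B b R hb hR
      obtain ⟨E, hE, -⟩ | ⟨h1 | h1, -⟩ := hR.exists_generator_or (forall_cons_mem hb hbr) hg
      · exact absurd ⟨_, E, by rwa [fillIn_cons] at hE⟩ hgen
      · exact ⟨1, by simp [h1, evalCoeff]⟩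
      · exact ⟨-1, by simp [h1, evalCoeff]⟩
    obtain ⟨ε, hε⟩ := h1 hb hR
    obtain ⟨ε', hε'⟩ := h1 hb' hR'
    obtain ⟨εs, hεs⟩ := h1 (Finset.add_mem_add hb hb') hRs
    refine ⟨εs * ε * ε', fun c c' cr => ?_⟩
    rw [hε, hε', hεs]
    push_cast
    linear_combination (-(((εs : ℤ) : ℂ))) *
      (((ε : ℤ) : ℂ) * ((ε : ℤ) : ℂ) * Int.units_cast_mul_self ℂ ε' +
        Int.units_cast_mul_self ℂ ε)
  set cr := fun i => fillRow (Ar i) (br i) ξ (u i.succ) with hcr_def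
  obtain ⟨c0, E, hE⟩ := hgen
  obtain ⟨e, -, he, hCe⟩ := (hE.exists_eq_C hcr).1
  have hbase : (fun p : {p : Fin n × (Fin n → ℤ) // p.2 ≠ br p.1} => cr p.1.1 p.1.2) =
      fun p => u p.1.1.succ p.1.2 := by
    ext p
    exact fillRow_of_ne p.2
  have hξz : AlgebraicIndependent ℤ (Sum.elim (fun j => (ξ j : ℂ))
      fun p : {p : Fin n × (Fin n → ℤ) // p.2 ≠ br p.1} => cr p.1.1 p.1.2) := by
    rw [hbase]
    let f : Fin n ⊕ {p : Fin n × (Fin n → ℤ) // p.2 ≠ br p.1} →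
        Fin n ⊕ (Fin (n + 1) × (Fin n → ℤ)) := Sum.map id fun p => (p.1.1.succ, p.1.2)
    have hf : Function.Injective f := Function.injective_id.sumMap fun p p' h => by
      ext <;> simp_all
    convert AlgebraicIndependent.comp hg f hf using 1
    ext (i | p) <;> rfl
  have hz := (AlgebraicIndependent.sumElim_iff.1 hξz).1
  obtain ⟨i₀, hI⟩ := exists_update_algebraicIndependent hz he hCe
  obtain ⟨j, hj⟩ := exists_transcendental_coord hξz hcr
  let D := Polynomial (rowField cr)
  let _ : Algebra D ℂ := (Polynomial.aeval (ξ j : ℂ) : D →ₐ[rowField cr] ℂ).toRingHom.toAlgebra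
  have halg : ∀ p : D, algebraMap D ℂ p = Polynomial.aeval (ξ j : ℂ) p := fun p => rfl
  have : FaithfulSMul D ℂ := (faithfulSMul_iff_algebraMap_injective D ℂ).2
    (transcendental_iff_injective.1 hj)
  have : Countable D :=
    have := MvPolynomial.countable (ι := PUnit.{1}) (D := rowField cr)
    (MvPolynomial.uniqueAlgEquiv (rowField cr) PUnit).symm.injective.countable
  have hcD : ∀ i a, cr i a ∈ Set.range (algebraMap D ℂ) := fun i a =>
    ⟨Polynomial.C ⟨cr i a, Subfield.subset_closure ⟨(i, a), rfl⟩⟩, by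
      rw [halg, Polynomial.aeval_C]; rfl⟩
  have hD : ∀ d, algebraMap D ℂ d ∈ Subfield.closure
      (Set.range (fun p : Fin n × (Fin n → ℤ) => cr p.1 p.2) ∪ (fun j => (ξ j : ℂ)) '' {j}) := by
    intro d
    rw [halg, Polynomial.aeval_eq_sum_range]
    refine sum_mem fun i _ => ?_
    rw [Algebra.smul_def]
    refine mul_mem (Subfield.closure_mono Set.subset_union_left (d.coeff i).2) (pow_mem ?_ i)
    exact Subfield.subset_closure (Or.inr ⟨j, rfl, rfl⟩)
  have hξ : ∀ i, ∑ a ∈ Ar i, cr i a * chEval ξ a = 0 := fun i => sum_fillRow_self (hbr i) ξ _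
  obtain ⟨V, hVmem, hstab, htrans, hξalg⟩ := exists_fiber (D := D) hbr hξ {j} (hI _ hj)
    (fun i => by
      by_cases hi : i = i₀
      · exact Or.inr ⟨j, rfl, by rw [hi, Function.update_self]⟩
      · exact Or.inl ⟨i, by rw [Function.update_of_ne hi]⟩) hcD
    (fun l hl => ⟨Polynomial.X, by rw [halg, Polynomial.aeval_X, Set.mem_singleton_iff.1 hl]⟩) hD
  have hV : ∀ η, η ∈ V ↔ (∀ i, ∑ a ∈ Ar i, cr i a * chEval η a = 0) ∧ η j = ξ j := by
    simpa using hVmem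
  have hξV : ξ ∈ V := (hV ξ).2 ⟨hξ, rfl⟩
  have hu := hg.algebraicIndependent (D := D) hD
  have hnorm : ∀ {B : Finset (Fin n → ℤ)} {b : Fin n → ℤ}, b ∈ B → ∃ S κ,
      IsNormPoly D V B (fillRow B b ξ (u 0)) S (V.filter fun η =>
        ∑ a ∈ B, fillRow B b ξ (u 0) a * chEval η a = 0).card κ := fun {B b} hb =>
    exists_isNormPoly hstab htrans hξV hξalg hb (hu.comp _ Subtype.val_injective)
  obtain ⟨S, κ, hS⟩ := hnorm hb
  obtain ⟨S', κ', hS'⟩ := hnorm hb'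
  obtain ⟨Ss, κs, hSs⟩ := hnorm (Finset.add_mem_add hb hb')
  have hdeg := hS.coeffDegree_add ⟨b, hb⟩ ⟨b', hb'⟩ hS' hSs
  have hmain : ∀ {R : MvPolynomial (Fin (n + 1) × (Fin n → ℤ)) ℤ}
      {m : ℕ}, (∃ ε : ℤˣ, R = ((ε : ℤ) : MvPolynomial (Fin (n + 1) × (Fin n → ℤ)) ℤ) *
        (rowAlgEquiv n).symm (MvPolynomial.C e) ^ m) →
      ∃ ε : ℤˣ, ∀ c cr', evalCoeff R (Fin.cons c cr') = ((ε : ℤ) : ℂ) *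
        MvPolynomial.aeval (fun p : Fin n × (Fin n → ℤ) => cr' p.1 p.2) e ^ m := by
    rintro R m ⟨ε, rfl⟩
    refine ⟨ε, fun c cr' => ?_⟩
    rw [evalCoeff_cons, map_mul, map_pow, map_intCast, AlgEquiv.apply_symm_apply]
    change MvPolynomial.eval₂Hom _ c _ = _
    rw [map_mul, map_pow, map_intCast, MvPolynomial.coe_eval₂Hom, MvPolynomial.eval₂_C]
    rfl
  obtain ⟨ε, hε⟩ := hmain
    (hR.exists_eq_mul_C_pow hg hbr hcr_def he hCe hI hj halg hξV hV hb hS)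
  obtain ⟨ε', hε'⟩ := hmain
    (hR'.exists_eq_mul_C_pow hg hbr hcr_def he hCe hI hj halg hξV hV hb' hS')
  obtain ⟨εs, hεs⟩ := hmain (hRs.exists_eq_mul_C_pow hg hbr hcr_def he hCe hI hj halg hξV hV
    (Finset.add_mem_add hb hb') hSs)
  refine ⟨εs * ε * ε', fun c c' cr' => ?_⟩
  rw [hε, hε', hεs, hdeg, pow_add]
  generalize MvPolynomial.aeval (fun p : Fin n × (Fin n → ℤ) => cr' p.1 p.2) e ^ _ = x
  generalize MvPolynomial.aeval (fun p : Fin n × (Fin n → ℤ) => cr' p.1 p.2) e ^ _ = y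
  push_cast
  linear_combination (-((εs : ℤ) : ℂ) * x * y) *
    (((ε : ℤ) : ℂ) * ((ε : ℤ) : ℂ) * Int.units_cast_mul_self ℂ ε' +
        Int.units_cast_mul_self ℂ ε)

/-- **product formula for the addition of supports.**
`Res_{A_0+A_0', A_1,…,A_n}(F_0 F_0', F_1,…,F_n)
  = ± Res_{A_0, A_1,…,A_n}(F_0, F) ⬝ Res_{A_0', A_1,…,A_n}(F_0', F)`,
as an identity between the evaluations at arbitrary coefficient families. -/
theorem resultant_minkowski_sum_mul
    (A0 A0' : Finset (Fin n → ℤ)) (hA0 : A0.Nonempty) (hA0' : A0'.Nonempty)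
    (Ar : Fin n → Finset (Fin n → ℤ)) (hAr : ∀ i, (Ar i).Nonempty)
    (R Rsum R' : MvPolynomial (Fin (n + 1) × (Fin n → ℤ)) ℤ)
    (hR : IsResultant (Fin.cons A0 Ar) R)
    (hR' : IsResultant (Fin.cons A0' Ar) R')
    (hRsum : IsResultant (Fin.cons (A0 + A0') Ar) Rsum) :
    (∀ (c0 c0' : (Fin n → ℤ) → ℂ) (cr : Fin n → (Fin n → ℤ) → ℂ),
      evalCoeff Rsum (Fin.cons (prodCoeff A0 A0' c0 c0') cr) =
        evalCoeff R (Fin.cons c0 cr) * evalCoeff R' (Fin.cons c0' cr)) ∨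
    (∀ (c0 c0' : (Fin n → ℤ) → ℂ) (cr : Fin n → (Fin n → ℤ) → ℂ),
      evalCoeff Rsum (Fin.cons (prodCoeff A0 A0' c0 c0') cr) =
        -(evalCoeff R (Fin.cons c0 cr) * evalCoeff R' (Fin.cons c0' cr))) := by
  classical
  choose br hbr using hAr
  obtain ⟨b, hb⟩ := hA0
  obtain ⟨b', hb'⟩ := hA0'
  obtain ⟨ξ, u, hg⟩ := exists_isGenericPair (n := n)
  obtain ⟨ε, hε⟩ : ∃ ε : ℤˣ, ∀ c c' cr, evalCoeff Rsum (Fin.cons (prodCoeff A0 A0' c c') cr) =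
      ((ε : ℤ) : ℂ) * (evalCoeff R (Fin.cons c cr) * evalCoeff R' (Fin.cons c' cr)) := by
    by_cases hcr : AlgebraicIndependent ℤ fun p : Fin n × (Fin n → ℤ) =>
        fillRow (Ar p.1) (br p.1) ξ (u p.1.succ) p.2
    · exact IsResultant.product_of_algebraicIndependent hg hbr hcr hb hb' hR hR' hRsum
    · exact IsResultant.product_of_not_algebraicIndependent hg hbr hcr hb hb' hR hR' hRsum
  obtain rfl | rfl := Int.units_eq_one_or ε
  · exact Or.inl fun c c' cr => by rw [hε]; simp
  · exact Or.inr fun c c' cr => by rw [hε]; simp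

end
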